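/- arXiv:1711.05804 — 3 statements merged into one kernel-verified Lean document; each statement's English description precedes it below -/
import Mathlib

section
/- (Tempered partition of unity, affine case.) Let X ⊆ ℝ^n be a closed semialgebraic set and let W_1, …, W_m ⊆ ℝ^n be open semialgebraic sets with X ⊆ W_1 ∪ … ∪ W_m. Then there exist tempered functions τ_1, …, τ_m : ℝ^n → ℝ such that: (1) τ_1(x) + … + τ_m(x) = 1 for every x ∈ X, and for each i the closure in X of {x ∈ X : τ_i(x) ≠ 0} is contained in W_i; (2) for every φ ∈ 𝓢(ℝ^n) and every i there exists ψ_i ∈ 𝓢(ℝ^n) flat on ℝ^n \ W_i such that ψ_i = τ_i·φ on X ∩ W_i. -/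
/-- A set `S ⊆ ℝⁿ` is semialgebraic if it is a finite union of sets of the form
`{x | p(x) = 0, q₁(x) > 0, …, q_r(x) > 0}` for real polynomials. -/
def IsSemialgebraic {n : ℕ} (S : Set (Fin n → ℝ)) : Prop :=
  ∃ (m : ℕ) (p : Fin m → MvPolynomial (Fin n) ℝ)
    (Q : Fin m → Finset (MvPolynomial (Fin n) ℝ)),
    S = ⋃ i, {x | MvPolynomial.eval x (p i) = 0 ∧ ∀ q ∈ Q i, 0 < MvPolynomial.eval x q}

/-- A smooth function is flat at `z` if all its iterated derivatives (including the
value, `k = 0`) vanish at `z`. -/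
def SmoothFlatAt {n : ℕ} (φ : (Fin n → ℝ) → ℝ) (z : Fin n → ℝ) : Prop :=
  ∀ k : ℕ, iteratedFDeriv ℝ k φ z = 0

open Polynomial in
/-- Evaluation of a polynomial at a point after specialising its coefficients. -/
noncomputable def tsEv {R : Type*} [CommRing R] (χ : R →+* ℝ) (f : Polynomial R) (y : ℝ) : ℝ :=
  (f.map χ).eval y

theorem tsEv_cont {R : Type*} [CommRing R] (χ : R →+* ℝ) (f : Polynomial R) :
    Continuous (tsEv χ f) := (f.map χ).continuous

theorem tsEv_of_natDegree_zero {R : Type*} [CommRing R] (χ : R →+* ℝ) {f : Polynomial R}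
    (h : f.natDegree = 0) (y : ℝ) : tsEv χ f y = χ f.leadingCoeff := by
  rw [Polynomial.eq_C_of_natDegree_eq_zero h]
  simp [tsEv]

/-- The two points have the same signs with respect to the family. -/
def SameSign {R : Type*} [CommRing R] (H : Set (Polynomial R)) (χ χ' : R →+* ℝ) (a b : ℝ) : Prop :=
  ∀ f ∈ H, SignType.sign (tsEv χ f a) = SignType.sign (tsEv χ' f b)

theorem SameSign.symm {R : Type*} [CommRing R] {H : Set (Polynomial R)} {χ χ' : R →+* ℝ} {a b : ℝ}
    (h : SameSign H χ χ' a b) : SameSign H χ' χ b a := fun f hf => (h f hf).symm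

theorem SameSign.trans {R : Type*} [CommRing R] {H : Set (Polynomial R)} {χ χ' χ'' : R →+* ℝ}
    {a b c : ℝ} (h : SameSign H χ χ' a b) (h' : SameSign H χ' χ'' b c) : SameSign H χ χ'' a c :=
  fun f hf => (h f hf).trans (h' f hf)

def DerClosed {R : Type*} [CommRing R] (H : Set (Polynomial R)) : Prop :=
  ∀ f ∈ H, 0 < f.natDegree → Polynomial.derivative f ∈ H

theorem tsEv_mono {R : Type*} [CommRing R] (χ : R →+* ℝ) (f : Polynomial R) {a b : ℝ}
    (h : ∀ z ∈ Set.Icc a b, 0 ≤ tsEv χ (Polynomial.derivative f) z) :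
    MonotoneOn (tsEv χ f) (Set.Icc a b) := by
  apply monotoneOn_of_deriv_nonneg (convex_Icc a b) (tsEv_cont χ f).continuousOn
  · exact (f.map χ).differentiable.differentiableOn
  · intro x hx
    have := h x (interior_subset hx)
    unfold tsEv at *
    rw [Polynomial.deriv, Polynomial.derivative_map]
    exact this

theorem tsEv_anti {R : Type*} [CommRing R] (χ : R →+* ℝ) (f : Polynomial R) {a b : ℝ}
    (h : ∀ z ∈ Set.Icc a b, tsEv χ (Polynomial.derivative f) z ≤ 0) :
    AntitoneOn (tsEv χ f) (Set.Icc a b) := by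
  apply antitoneOn_of_deriv_nonpos (convex_Icc a b) (tsEv_cont χ f).continuousOn
  · exact (f.map χ).differentiable.differentiableOn
  · intro x hx
    have := h x (interior_subset hx)
    unfold tsEv at *
    rw [Polynomial.deriv, Polynomial.derivative_map]
    exact this

theorem sign_le_of_le {a b : ℝ} (h : a ≤ b) : SignType.sign a ≤ SignType.sign b :=
  SignType.sign.monotone h

theorem nonneg_of_sign_eq {a b : ℝ} (h : SignType.sign a = SignType.sign b) (ha : 0 ≤ a) :
    0 ≤ b := by
  rw [← sign_nonneg_iff] at *
  rwa [← h]

theorem nonpos_of_sign_eq {a b : ℝ} (h : SignType.sign a = SignType.sign b) (ha : a ≤ 0) :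
    b ≤ 0 := by
  rw [← sign_nonpos_iff] at *
  rwa [← h]

/-- Thom lemma. -/
theorem thom {R : Type*} [CommRing R] {H : Set (Polynomial R)} (hH : DerClosed H) (χ : R →+* ℝ)
    {a b z : ℝ} (hab : SameSign H χ χ a b) (hz : z ∈ Set.Icc a b) : SameSign H χ χ a z := by
  have key : ∀ d : ℕ, ∀ f ∈ H, f.natDegree = d → ∀ w ∈ Set.Icc a b,
      SignType.sign (tsEv χ f a) = SignType.sign (tsEv χ f w) := by
    intro d
    induction d using Nat.strong_induction_on with
    | _ d ih =>
      intro f hf hd w hw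
      rcases Nat.eq_zero_or_pos d with h0 | hpos
      · rw [tsEv_of_natDegree_zero χ (hd.trans h0), tsEv_of_natDegree_zero χ (hd.trans h0)]
      · have hder := ih _ (by rw [← hd]; exact Polynomial.natDegree_derivative_lt (by omega))
          (Polynomial.derivative f) (hH f hf (by omega)) rfl
        have haI : a ∈ Set.Icc a b := ⟨le_rfl, hw.1.trans hw.2⟩
        have hbI : b ∈ Set.Icc a b := ⟨hw.1.trans hw.2, le_rfl⟩
        rcases le_total 0 (tsEv χ (Polynomial.derivative f) a) with h | h
        · have hm := tsEv_mono χ f (fun z hz => nonneg_of_sign_eq (hder z hz) h)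
          apply le_antisymm (sign_le_of_le (hm haI hw hw.1))
          rw [hab f hf]
          exact (sign_le_of_le (hm hw hbI hw.2))
        · have hm := tsEv_anti χ f (fun z hz => nonpos_of_sign_eq (hder z hz) h)
          apply le_antisymm _ (sign_le_of_le (hm haI hw hw.1))
          rw [hab f hf]
          exact (sign_le_of_le (hm hw hbI hw.2))
  exact fun f hf => key _ f hf rfl z hz

theorem order_lemma {R : Type*} [CommRing R] {H : Set (Polynomial R)} (hH : DerClosed H)
    {χ χ' : R →+* ℝ} {a b a' b' : ℝ} (ha : SameSign H χ χ' a a') (hb : SameSign H χ χ' b b')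
    (hab : a < b) (hne : ¬ SameSign H χ χ a b) : a' < b' := by
  by_contra hlt
  push Not at hlt
  apply hne
  have key : ∀ d : ℕ, ∀ f ∈ H, f.natDegree = d →
      SignType.sign (tsEv χ f a) = SignType.sign (tsEv χ f b) := by
    intro d
    induction d using Nat.strong_induction_on with
    | _ d ih =>
      intro f hf hd
      rcases Nat.eq_zero_or_pos d with h0 | hpos
      · rw [tsEv_of_natDegree_zero χ (hd.trans h0), tsEv_of_natDegree_zero χ (hd.trans h0)]
      · have hdc : DerClosed {g ∈ H | g.natDegree < d} := by
          intro g hg hg0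
          exact ⟨hH g hg.1 hg0, lt_of_lt_of_le
            (Polynomial.natDegree_derivative_lt (by omega)) hg.2.le⟩
        have h1 : SameSign {g ∈ H | g.natDegree < d} χ χ a b := fun g hg => ih _ hg.2 g hg.1 rfl
        have hdm : Polynomial.derivative f ∈ {g ∈ H | g.natDegree < d} :=
          ⟨hH f hf (by omega), by
            rw [← hd]; exact Polynomial.natDegree_derivative_lt (by omega)⟩
        have h2 : SameSign {g ∈ H | g.natDegree < d} χ' χ' b' a' := fun g hg => by
          rw [← ha g hg.1, ← hb g hg.1]; exact (h1 g hg).symm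
        have t1 := fun z hz => thom hdc χ (z := z) h1 hz _ hdm
        have t2 := fun z hz => thom hdc χ' (z := z) h2 hz _ hdm
        have haI : a ∈ Set.Icc a b := ⟨le_rfl, hab.le⟩
        have hbI : b ∈ Set.Icc a b := ⟨hab.le, le_rfl⟩
        have haI' : a' ∈ Set.Icc b' a' := ⟨hlt, le_rfl⟩
        have hbI' : b' ∈ Set.Icc b' a' := ⟨le_rfl, hlt⟩
        have e1 := ha f hf
        have e2 := hb f hf
        have e3 := hb _ hdm.1
        rcases le_total 0 (tsEv χ (Polynomial.derivative f) a) with h | h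
        · have hm := tsEv_mono χ f (fun z hz => nonneg_of_sign_eq (t1 z hz) h)
          have h' := nonneg_of_sign_eq e3 (nonneg_of_sign_eq (t1 b hbI) h)
          have hm' := tsEv_mono χ' f (fun z hz => nonneg_of_sign_eq (t2 z hz) h')
          apply le_antisymm (sign_le_of_le (hm haI hbI hab.le))
          rw [e1, e2]
          exact sign_le_of_le (hm' hbI' haI' hlt)
        · have hm := tsEv_anti χ f (fun z hz => nonpos_of_sign_eq (t1 z hz) h)
          have h' := nonpos_of_sign_eq e3 (nonpos_of_sign_eq (t1 b hbI) h)
          have hm' := tsEv_anti χ' f (fun z hz => nonpos_of_sign_eq (t2 z hz) h')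
          apply le_antisymm _ (sign_le_of_le (hm haI hbI hab.le))
          rw [e1, e2]
          exact sign_le_of_le (hm' hbI' haI' hlt)
  exact fun f hf => key _ f hf rfl

/-- Abstract K lemma. -/
theorem abstract_left (E E' M : ℝ → ℝ → Prop) (Iso Iso' : ℝ → Prop) (f f' : ℝ → ℝ)
    (hEsymm : ∀ a b, E a b → E b a)
    (hE'symm : ∀ a b, E' a b → E' b a)
    (hE'trans : ∀ a b c, E' a b → E' b c → E' a c)
    (hErefl : ∀ a, E a a)
    (hMl : ∀ a, ∃ a', M a a') (hMr : ∀ a', ∃ a, M a a')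
    (hME : ∀ a a' b b', M a a' → M b b' → (E a b ↔ E' a' b'))
    (hord : ∀ a a' b b', M a a' → M b b' → ¬ E a b → a < b → a' < b')
    (hopen' : ∀ a, ¬ Iso' a → IsOpen {z | E' a z})
    (hiso : ∀ a z, Iso a → E a z → a = z)
    (hMiso : ∀ a a', M a a' → Iso' a' → Iso a)
    (hf : Continuous f) (hf' : Continuous f')
    (hroot : ∀ a a', M a a' → Iso a → 0 ≤ f' a' → 0 ≤ f a)
    {y y' : ℝ} (hM : M y y') (hy' : ¬ Iso' y')
    (hmono : ∀ z w, E y z → E y w → z < w → f z < f w)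
    (hunb : (∀ z ≤ y', E' y' z) → ∃ z, E' y' z ∧ f' z < 0)
    (hneg : f y < 0) : ∃ z, E' y' z ∧ f' z < 0 := by
  by_contra hcon
  push Not at hcon
  have hex : ∃ w, w ≤ y' ∧ ¬ E' y' w := by
    by_contra h
    push Not at h
    obtain ⟨z, hz, hz'⟩ := hunb h
    exact absurd (hcon z hz) (not_le.2 hz')
  have hE'refl : E' y' y' := (hME _ _ _ _ hM hM).1 (hErefl y)
  set S : Set ℝ := {w | w ≤ y' ∧ ¬ E' y' w} with hS
  have hScl : IsClosed S := by
    apply IsClosed.inter isClosed_Iic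
    exact (hopen' y' hy').isClosed_compl
  have hSb : BddAbove S := ⟨y', fun w hw => hw.1⟩
  set a' := sSup S
  have ha'S : a' ∈ S := hScl.csSup_mem hex hSb
  have hlt : a' < y' := lt_of_le_of_ne ha'S.1 (fun h => ha'S.2 (by rw [h]; exact hE'refl))
  have hcell : ∀ z, a' < z → z ≤ y' → E' y' z := by
    intro z hz hzy
    by_contra h
    exact absurd (le_csSup hSb ⟨hzy, h⟩) (not_le.2 hz)
  have hIoc : Set.Ioc a' y' ∈ nhdsWithin a' (Set.Ioi a') := Ioc_mem_nhdsGT hlt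
  have hf'a : 0 ≤ f' a' := by
    have ht : Filter.Tendsto f' (nhdsWithin a' (Set.Ioi a')) (nhds (f' a')) :=
      hf'.continuousAt.tendsto.mono_left nhdsWithin_le_nhds
    refine ge_of_tendsto ht ?_
    filter_upwards [hIoc] with z hz using hcon z (hcell z hz.1 hz.2)
  have hiso' : Iso' a' := by
    by_contra h
    have ho := hopen' a' h
    obtain ⟨a, ha⟩ := hMr a'
    have hrefl : E' a' a' := (hME _ _ _ _ ha ha).1 (hErefl a)
    have h1 : {z | E' a' z} ∈ nhdsWithin a' (Set.Ioi a') :=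
      nhdsWithin_le_nhds (ho.mem_nhds hrefl)
    obtain ⟨z, hz1, hz2⟩ := Filter.nonempty_of_mem (Filter.inter_mem h1 hIoc)
    exact ha'S.2 (hE'trans _ _ _ (hcell z hz2.1 hz2.2) (hE'symm _ _ hz1))
  obtain ⟨a, ha⟩ := hMr a'
  have hisoa := hMiso a a' ha hiso'
  have hfa : 0 ≤ f a := hroot a a' ha hisoa hf'a
  have hnE : ¬ E y a := fun h => ha'S.2 ((hME _ _ _ _ hM ha).1 h)
  have hay : a < y := by
    rcases lt_trichotomy a y with h | h | h
    · exact h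
    · exact absurd (h ▸ hErefl y) hnE
    · exact absurd (hord _ _ _ _ hM ha hnE h) (not_lt.2 hlt.le)
  have hcell2 : ∀ z, a < z → z ≤ y → E y z := by
    intro z haz hzy
    by_contra h
    have hzy' : z < y := lt_of_le_of_ne hzy (fun e => h (e ▸ hErefl y))
    obtain ⟨z', hz'⟩ := hMl z
    have h1 : a' < z' := hord _ _ _ _ ha hz' (fun e => haz.ne (hiso a z hisoa e)) haz
    have h2 : z' < y' := hord _ _ _ _ hz' hM (fun e => h (hEsymm _ _ e)) hzy'
    exact h ((hME _ _ _ _ hM hz').2 (hcell z' h1 h2.le))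
  have : f a ≤ f y := by
    have ht : Filter.Tendsto f (nhdsWithin a (Set.Ioi a)) (nhds (f a)) :=
      hf.continuousAt.tendsto.mono_left nhdsWithin_le_nhds
    refine le_of_tendsto ht ?_
    filter_upwards [Ioo_mem_nhdsGT hay] with z hz using
      (hmono z y (hcell2 z hz.1 hz.2.le) (hErefl y) hz.2).le
  linarith

theorem abstract_step (E E' M : ℝ → ℝ → Prop) (Iso Iso' : ℝ → Prop) (f f' : ℝ → ℝ)
    (hEsymm : ∀ a b, E a b → E b a)
    (hEtrans : ∀ a b c, E a b → E b c → E a c)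
    (hE'symm : ∀ a b, E' a b → E' b a)
    (hE'trans : ∀ a b c, E' a b → E' b c → E' a c)
    (hErefl : ∀ a, E a a)
    (hMl : ∀ a, ∃ a', M a a') (hMr : ∀ a', ∃ a, M a a')
    (hME : ∀ a a' b b', M a a' → M b b' → (E a b ↔ E' a' b'))
    (hEM : ∀ a b a', E a b → M a a' → M b a')
    (hord : ∀ a a' b b', M a a' → M b b' → ¬ E a b → a < b → a' < b')
    (hconv' : ∀ a b z, E' a b → a ≤ z → z ≤ b → E' a z)
    (hopen : ∀ a, ¬ Iso a → IsOpen {z | E a z})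
    (hopen' : ∀ a, ¬ Iso' a → IsOpen {z | E' a z})
    (hiso : ∀ a z, Iso a → E a z → a = z)
    (hMiso : ∀ a a', M a a' → Iso' a' → Iso a)
    (hf : Continuous f) (hf' : Continuous f')
    (hroot : ∀ a a', M a a' → Iso a → SignType.sign (f a) = SignType.sign (f' a'))
    {y y' : ℝ} (hM : M y y') (hy : ¬ Iso y)
    (hmono : ∀ z w, E y z → E y w → z < w → f z < f w)
    (hunb : (∀ z ≤ y', E' y' z) → ∃ z, E' y' z ∧ f' z < 0)
    (hunb2 : (∀ z, y' ≤ z → E' y' z) → ∃ z, E' y' z ∧ 0 < f' z) :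
    ∃ z, E' y' z ∧ SignType.sign (f' z) = SignType.sign (f y) := by
  have hy' : ¬ Iso' y' := fun h => hy (hMiso _ _ hM h)
  have neg : ∀ u, E y u → f u < 0 → ∃ z, E' y' z ∧ f' z < 0 := by
    intro u hu hfu
    exact abstract_left E E' M Iso Iso' f f' hEsymm hE'symm hE'trans hErefl hMl hMr hME hord hopen'
      hiso hMiso hf hf' (fun a a' h1 h2 h3 => nonneg_of_sign_eq (hroot a a' h1 h2).symm h3)
      (hEM _ _ _ hu hM) hy' (fun z w hz hw => hmono z w (hEtrans _ _ _ hu hz) (hEtrans _ _ _ hu hw))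
      hunb hfu
  have pos : ∀ u, E y u → 0 < f u → ∃ z, E' y' z ∧ 0 < f' z := by
    intro u hu hfu
    have := abstract_left (fun a b => E (-a) (-b)) (fun a b => E' (-a) (-b))
      (fun a b => M (-a) (-b)) (fun a => Iso (-a)) (fun a => Iso' (-a))
      (fun x => - f (-x)) (fun x => - f' (-x))
      (fun a b => hEsymm _ _) (fun a b => hE'symm _ _) (fun a b c => hE'trans _ _ _)
      (fun a => hErefl _)
      (fun a => by
        obtain ⟨b, hb⟩ := hMl (-a)
        exact ⟨-b, by simpa using hb⟩)
      (fun a => by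
        obtain ⟨b, hb⟩ := hMr (-a)
        exact ⟨-b, by simpa using hb⟩)
      (fun a a' b b' h1 h2 => hME _ _ _ _ h1 h2)
      (fun a a' b b' h1 h2 h3 h4 => by
        have := hord _ _ _ _ h2 h1 (fun h => h3 (hEsymm _ _ h)) (neg_lt_neg h4)
        exact neg_lt_neg_iff.1 this)
      (fun a ha => (hopen' (-a) ha).preimage continuous_neg)
      (fun a z h1 h2 => neg_injective (hiso _ _ h1 h2))
      (fun a a' h1 h2 => hMiso _ _ h1 h2)
      (by fun_prop) (by fun_prop)
      (fun a a' h1 h2 h3 => by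
        have := nonpos_of_sign_eq (hroot _ _ h1 h2).symm (by linarith)
        linarith)
      (y := -u) (y' := -y')
      (by simpa using (hEM _ _ _ hu hM)) (by simpa using hy')
      (fun z w hz hw hzw => by
        simp only [neg_neg] at hz hw
        have := hmono _ _ (hEtrans _ _ _ hu hw) (hEtrans _ _ _ hu hz) (neg_lt_neg hzw)
        linarith)
      (fun h => by
        obtain ⟨z, hz, hz2⟩ := hunb2 (fun z hz => by simpa using h (-z) (by linarith))
        exact ⟨-z, by simpa using hz, by simpa using hz2⟩)
      (by simpa using hfu)
    obtain ⟨z, hz, hz2⟩ := this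
    exact ⟨-z, by simpa using hz, by linarith⟩
  rcases lt_trichotomy (f y) 0 with h | h | h
  · obtain ⟨z, hz, hz2⟩ := neg y (hErefl y) h
    exact ⟨z, hz, by rw [sign_neg hz2, sign_neg h]⟩
  · have hn := (hopen y hy).mem_nhds (hErefl y)
    obtain ⟨u, hu1, hu2⟩ : ∃ u, E y u ∧ u < y := by
      obtain ⟨u, h1, h2⟩ := Filter.nonempty_of_mem
        (Filter.inter_mem (nhdsWithin_le_nhds (s := Set.Iio y) hn) self_mem_nhdsWithin)
      exact ⟨u, h1, h2⟩
    obtain ⟨v, hv1, hv2⟩ : ∃ u, E y u ∧ y < u := by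
      obtain ⟨u, h1, h2⟩ := Filter.nonempty_of_mem
        (Filter.inter_mem (nhdsWithin_le_nhds (s := Set.Ioi y) hn) self_mem_nhdsWithin)
      exact ⟨u, h1, h2⟩
    obtain ⟨a, ha, ha2⟩ := neg u hu1 (by rw [← h]; exact hmono _ _ hu1 (hErefl y) hu2)
    obtain ⟨b, hb, hb2⟩ := pos v hv1 (by rw [← h]; exact hmono _ _ (hErefl y) hv1 hv2)
    have hab := hE'trans _ _ _ (hE'symm _ _ ha) hb
    have : (0:ℝ) ∈ f' '' (Set.uIcc a b) :=
      intermediate_value_uIcc hf'.continuousOn (Set.mem_uIcc.2 (Or.inl ⟨ha2.le, hb2.le⟩))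
    obtain ⟨c, hc, hc0⟩ := this
    refine ⟨c, ?_, by rw [hc0, h]⟩
    rcases Set.mem_uIcc.1 hc with ⟨h1, h2⟩ | ⟨h1, h2⟩
    · exact hE'trans _ _ _ ha (hconv' _ _ _ hab h1 h2)
    · exact hE'trans _ _ _ hb (hconv' _ _ _ (hE'symm _ _ hab) h1 h2)
  · obtain ⟨z, hz, hz2⟩ := pos y (hErefl y) h
    exact ⟨z, hz, by rw [sign_pos hz2, sign_pos h]⟩

/-- the isolated points -/
def IsoPt {R : Type*} [CommRing R] (H : Set (Polynomial R)) (χ : R →+* ℝ) (a : ℝ) : Prop :=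
  ∃ g ∈ H, g.map χ ≠ 0 ∧ tsEv χ g a = 0

/-- matching in one direction -/
def Matches {R : Type*} [CommRing R] (H : Set (Polynomial R)) (χ χ' : R →+* ℝ) : Prop :=
  ∀ y, ∃ y', SameSign H χ χ' y y'

theorem Matches.ne_zero {R : Type*} [CommRing R] {H : Set (Polynomial R)} {χ χ' : R →+* ℝ}
    (h : Matches H χ' χ) {g : Polynomial R} (hg : g ∈ H) (h0 : g.map χ' ≠ 0) : g.map χ ≠ 0 := by
  intro h1
  apply h0
  apply Polynomial.funext
  intro y
  obtain ⟨y', hy'⟩ := h y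
  have := hy' g hg
  have h2 : tsEv χ g y' = 0 := by simp [tsEv, h1]
  rw [h2, sign_zero, sign_eq_zero_iff] at this
  simpa [tsEv] using this

theorem isoPt_isolated {R : Type*} [CommRing R] {H : Set (Polynomial R)} (hH : DerClosed H)
    {χ : R →+* ℝ} {a z : ℝ} (ha : IsoPt H χ a) (haz : SameSign H χ χ a z) : a = z := by
  obtain ⟨g, hg, hg0, hga⟩ := ha
  by_contra hne
  apply hg0
  have key : ∀ u v, u < v → SameSign H χ χ u v → tsEv χ g u = 0 → g.map χ = 0 := by
    intro u v huv hs h0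
    apply Polynomial.eq_zero_of_infinite_isRoot
    apply (Set.Icc_infinite huv).mono
    intro w hw
    have := thom hH χ hs hw g hg
    rw [h0, sign_zero, eq_comm, sign_eq_zero_iff] at this
    exact this
  rcases lt_or_gt_of_ne hne with h | h
  · exact key a z h haz hga
  · refine key z a h haz.symm ?_
    have := haz g hg
    rwa [hga, sign_zero, eq_comm, sign_eq_zero_iff] at this

theorem nonIso_open {R : Type*} [CommRing R] {H : Set (Polynomial R)} (hfin : H.Finite)
    {χ : R →+* ℝ} {a : ℝ} (ha : ¬ IsoPt H χ a) : IsOpen {z | SameSign H χ χ a z} := by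
  have : {z | SameSign H χ χ a z} =
      ⋂ f ∈ H, {z | SignType.sign (tsEv χ f a) = SignType.sign (tsEv χ f z)} := by
    ext z; simp [SameSign]
  rw [this]
  apply hfin.isOpen_biInter
  intro f hf
  by_cases h0 : f.map χ = 0
  · simp [tsEv, h0]
  · rcases lt_trichotomy (tsEv χ f a) 0 with h | h | h
    · simp only [sign_neg h, eq_comm (a := (-1 : SignType)), sign_eq_neg_one_iff]
      exact isOpen_lt (tsEv_cont χ f) continuous_const
    · exact absurd ⟨f, hf, h0, h⟩ ha
    · simp only [sign_pos h, eq_comm (a := (1 : SignType)), sign_eq_one_iff]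
      exact isOpen_lt continuous_const (tsEv_cont χ f)

theorem poly_strict {R : Type*} [CommRing R] {H : Set (Polynomial R)} (hH : DerClosed H)
    {χ : R →+* ℝ} {f : Polynomial R} (hfd : Polynomial.derivative f ∈ H) {y : ℝ}
    (hpos : 0 < tsEv χ (Polynomial.derivative f) y) (z w : ℝ) (hz : SameSign H χ χ y z)
    (hw : SameSign H χ χ y w) (hzw : z < w) : tsEv χ f z < tsEv χ f w := by
  have : StrictMonoOn (tsEv χ f) (Set.Icc z w) := by
    apply strictMonoOn_of_deriv_pos (convex_Icc z w) (tsEv_cont χ f).continuousOn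
    intro x hx
    have h1 := (hz.trans (thom hH χ (hz.symm.trans hw) (interior_subset hx))) _ hfd
    rw [sign_pos hpos, eq_comm, sign_eq_one_iff] at h1
    unfold tsEv at *
    rw [Polynomial.deriv, Polynomial.derivative_map]
    exact h1
  exact this ⟨le_rfl, hzw.le⟩ ⟨hzw.le, le_rfl⟩ hzw

theorem poly_strict_anti {R : Type*} [CommRing R] {H : Set (Polynomial R)} (hH : DerClosed H)
    {χ : R →+* ℝ} {f : Polynomial R} (hfd : Polynomial.derivative f ∈ H) {y : ℝ}
    (hpos : tsEv χ (Polynomial.derivative f) y < 0) (z w : ℝ) (hz : SameSign H χ χ y z)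
    (hw : SameSign H χ χ y w) (hzw : z < w) : tsEv χ f w < tsEv χ f z := by
  have : StrictAntiOn (tsEv χ f) (Set.Icc z w) := by
    apply strictAntiOn_of_deriv_neg (convex_Icc z w) (tsEv_cont χ f).continuousOn
    intro x hx
    have h1 := (hz.trans (thom hH χ (hz.symm.trans hw) (interior_subset hx))) _ hfd
    rw [sign_neg hpos, eq_comm, sign_eq_neg_one_iff] at h1
    unfold tsEv at *
    rw [Polynomial.deriv, Polynomial.derivative_map]
    exact h1
  exact this ⟨le_rfl, hzw.le⟩ ⟨hzw.le, le_rfl⟩ hzw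

theorem poly_unb_left (P : Polynomial ℝ) (hP : 0 < P.degree) (y : ℝ)
    (hm : ∀ z ≤ y, P.eval z ≤ P.eval y) : ∃ z ≤ y, P.eval z < 0 := by
  by_contra h
  push Not at h
  have ht : Filter.Tendsto (fun x => |(P.comp (-Polynomial.X)).eval x|) Filter.atTop
    Filter.atTop := (P.comp (-Polynomial.X)).abs_tendsto_atTop (by simp [hP])
  obtain ⟨x, hx, hx2⟩ := ((ht.eventually_gt_atTop (P.eval y)).and
    (Filter.eventually_ge_atTop (-y))).exists
  simp only [Polynomial.eval_comp, Polynomial.eval_neg, Polynomial.eval_X] at hx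
  rw [abs_of_nonneg (h _ (by linarith))] at hx
  linarith [hm (-x) (by linarith)]

theorem poly_unb_right (P : Polynomial ℝ) (hP : 0 < P.degree) (y : ℝ)
    (hm : ∀ z, y ≤ z → P.eval y ≤ P.eval z) : ∃ z, y ≤ z ∧ 0 < P.eval z := by
  by_contra h
  push Not at h
  have ht := P.abs_tendsto_atTop hP
  obtain ⟨x, hx, hx2⟩ := ((ht.eventually_gt_atTop (-P.eval y)).and
    (Filter.eventually_ge_atTop y)).exists
  rw [abs_of_nonpos (h _ (by linarith))] at hx
  linarith [hm x (by linarith)]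

theorem step_lemma {R : Type*} [CommRing R] {H : Set (Polynomial R)} (hfin : H.Finite)
    (hH : DerClosed H) {χ χ' : R →+* ℝ} (hm : Matches H χ χ') (hm' : Matches H χ' χ)
    {f : Polynomial R} (hfd : Polynomial.derivative f ∈ H)
    (hdeg : 0 < (f.map χ).natDegree) (hdeg' : 0 < (f.map χ').natDegree)
    (hroot : ∀ g ∈ H, g.map χ ≠ 0 → ∀ y y', SameSign H χ χ' y y' → tsEv χ g y = 0 →
      SignType.sign (tsEv χ f y) = SignType.sign (tsEv χ' f y')) :
    Matches (insert f H) χ χ' := by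
  intro y
  obtain ⟨y', hy'⟩ := hm y
  by_cases hiso : IsoPt H χ y
  · obtain ⟨g, hg, hg0, hgy⟩ := hiso
    refine ⟨y', ?_⟩
    rintro h (rfl | hh)
    · exact hroot g hg hg0 y y' hy' hgy
    · exact hy' h hh
  suffices hs : ∃ z, SameSign H χ' χ' y' z ∧
      SignType.sign (tsEv χ' f z) = SignType.sign (tsEv χ f y) by
    obtain ⟨z, hz, hz2⟩ := hs
    refine ⟨z, ?_⟩
    rintro h (rfl | hh)
    · exact hz2.symm
    · exact (hy'.trans hz) h hh
  have hd0 : (Polynomial.derivative f).map χ ≠ 0 := by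
    rw [← Polynomial.derivative_map]
    intro h
    have := Polynomial.derivative_eq_zero.1 h
    omega
  have hdy : tsEv χ (Polynomial.derivative f) y ≠ 0 := fun h => hiso ⟨_, hfd, hd0, h⟩
  have hdP : 0 < (f.map χ').degree := Polynomial.natDegree_pos_iff_degree_pos.1 hdeg'
  have main := fun (s : ℝ) (hs : s ≠ 0) => abstract_step (SameSign H χ χ) (SameSign H χ' χ') (SameSign H χ χ') (IsoPt H χ)
    (IsoPt H χ') (fun x => s * tsEv χ f x) (fun x => s * tsEv χ' f x)
    (fun _ _ h => h.symm) (fun _ _ _ h h' => h.trans h') (fun _ _ h => h.symm)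
    (fun _ _ _ h h' => h.trans h') (fun _ _ _ => rfl) hm
    (fun a' => by
      obtain ⟨a, ha⟩ := hm' a'
      exact ⟨a, ha.symm⟩)
    (fun a a' b b' h h' => ⟨fun e => (h.symm.trans e).trans h', fun e => (h.trans e).trans h'.symm⟩)
    (fun a b a' h h' => h.symm.trans h')
    (fun a a' b b' h h' hne hab => order_lemma hH h h' hab hne)
    (fun a b z h h1 h2 => thom hH χ' h ⟨h1, h2⟩)
    (fun a ha => nonIso_open hfin ha) (fun a ha => nonIso_open hfin ha)
    (fun a z ha haz => isoPt_isolated hH ha haz)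
    (fun a a' h hi => by
      obtain ⟨g, hg, hg0, hga⟩ := hi
      refine ⟨g, hg, hm'.ne_zero hg hg0, ?_⟩
      have := h g hg
      rwa [hga, sign_zero, sign_eq_zero_iff] at this)
    ((tsEv_cont χ f).const_mul s) ((tsEv_cont χ' f).const_mul s)
    (fun a a' h hi => by
      obtain ⟨g, hg, hg0, hga⟩ := hi
      simp only [sign_mul, hroot g hg hg0 a a' h hga])
    hy' hiso
  have e := hy' _ hfd
  rcases lt_or_gt_of_ne hdy with hlt | hgt
  · have hlt' : tsEv χ' (Polynomial.derivative f) y' < 0 := by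
      rwa [sign_neg hlt, eq_comm, sign_eq_neg_one_iff] at e
    have hP' : 0 < (-(f.map χ')).degree := by rwa [Polynomial.degree_neg]
    obtain ⟨z, hz, hz2⟩ := main (-1) (by norm_num)
      (fun z w hz hw hzw => by linarith [poly_strict_anti hH hfd hlt z w hz hw hzw])
      (fun h => by
        obtain ⟨z, hz, hz2⟩ := poly_unb_left _ hP' y' (fun z hz => by
          rcases hz.lt_or_eq with h1 | h1
          · have := poly_strict_anti hH hfd hlt' z y' (h z hz) (fun _ _ => rfl) h1
            simp only [tsEv] at this
            simp [this.le]
          · rw [h1])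
        exact ⟨z, h z hz, by simpa [tsEv] using hz2⟩)
      (fun h => by
        obtain ⟨z, hz, hz2⟩ := poly_unb_right _ hP' y' (fun z hz => by
          rcases hz.lt_or_eq with h1 | h1
          · have := poly_strict_anti hH hfd hlt' y' z (fun _ _ => rfl) (h z hz) h1
            simp only [tsEv] at this
            simp [this.le]
          · rw [h1])
        exact ⟨z, h z hz, by simpa [tsEv] using hz2⟩)
    refine ⟨z, hz, ?_⟩
    simpa [Left.sign_neg] using hz2
  · have hgt' : 0 < tsEv χ' (Polynomial.derivative f) y' := by
      rwa [sign_pos hgt, eq_comm, sign_eq_one_iff] at e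
    obtain ⟨z, hz, hz2⟩ := main 1 (by norm_num)
      (fun z w hz hw hzw => by linarith [poly_strict hH hfd hgt z w hz hw hzw])
      (fun h => by
        obtain ⟨z, hz, hz2⟩ := poly_unb_left _ hdP y' (fun z hz => by
          rcases hz.lt_or_eq with h1 | h1
          · exact (poly_strict hH hfd hgt' z y' (h z hz) (fun _ _ => rfl) h1).le
          · rw [h1])
        exact ⟨z, h z hz, by simpa [tsEv] using hz2⟩)
      (fun h => by
        obtain ⟨z, hz, hz2⟩ := poly_unb_right _ hdP y' (fun z hz => by
          rcases hz.lt_or_eq with h1 | h1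
          · exact (poly_strict hH hfd hgt' y' z (fun _ _ => rfl) (h z hz) h1).le
          · rw [h1])
        exact ⟨z, h z hz, by simpa [tsEv] using hz2⟩)
    refine ⟨z, hz, ?_⟩
    simpa using hz2

theorem pseudo_div {R : Type*} [CommRing R] (f g : Polynomial R) :
    ∃ (k : ℕ) (q r : Polynomial R), Polynomial.C (g.leadingCoeff ^ k) * f = q * g + r ∧
      (0 < g.natDegree → r.natDegree < g.natDegree) := by
  by_cases hg : 0 < g.natDegree
  swap
  · exact ⟨0, 0, f, by simp, fun h => absurd h hg⟩
  have key : ∀ d : ℕ, ∀ f : Polynomial R, f.natDegree = d → ∃ (k : ℕ) (q r : Polynomial R),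
      Polynomial.C (g.leadingCoeff ^ k) * f = q * g + r ∧ r.natDegree < g.natDegree := by
    intro d
    induction d using Nat.strong_induction_on with
    | _ d ih =>
      intro f hd
      by_cases hlt : f.natDegree < g.natDegree
      · exact ⟨0, 0, f, by simp, hlt⟩
      push Not at hlt
      set f₁ := Polynomial.C g.leadingCoeff * f
        - Polynomial.C f.leadingCoeff * Polynomial.X ^ (f.natDegree - g.natDegree) * g with hf₁
      have hf₁d : f₁.natDegree < f.natDegree := by
        have h1 : f₁.natDegree ≤ f.natDegree := by
          rw [← max_self f.natDegree]
          apply Polynomial.natDegree_sub_le_of_le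
          · exact (Polynomial.natDegree_C_mul_le _ _)
          · refine (Polynomial.natDegree_mul_le).trans ?_
            have := Polynomial.natDegree_C_mul_X_pow_le f.leadingCoeff (f.natDegree - g.natDegree)
            omega
        have h2 : f₁.coeff f.natDegree = 0 := by
          rw [hf₁, Polynomial.coeff_sub, Polynomial.coeff_C_mul, mul_assoc, Polynomial.coeff_C_mul,
            Polynomial.coeff_X_pow_mul', if_pos (by omega)]
          have : f.natDegree - (f.natDegree - g.natDegree) = g.natDegree := by omega
          rw [this, Polynomial.coeff_natDegree, Polynomial.coeff_natDegree]
          ring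
        rcases h1.lt_or_eq with h | h
        · exact h
        · exfalso
          rw [← h, Polynomial.coeff_natDegree, Polynomial.leadingCoeff_eq_zero] at h2
          rw [h2] at h
          simp at h
          omega
      obtain ⟨k, q, r, h, hr⟩ := ih _ (hd ▸ hf₁d) f₁ rfl
      refine ⟨k + 1, q + Polynomial.C (g.leadingCoeff ^ k) * (Polynomial.C f.leadingCoeff *
        Polynomial.X ^ (f.natDegree - g.natDegree)), r, ?_, hr⟩
      rw [hf₁, mul_sub, sub_eq_iff_eq_add] at h
      have e : Polynomial.C (g.leadingCoeff ^ (k+1)) * f =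
        Polynomial.C (g.leadingCoeff ^ k) * (Polynomial.C g.leadingCoeff * f) := by
        rw [pow_succ, Polynomial.C_mul]; ring
      rw [e, h]
      ring
  obtain ⟨k, q, r, h, hr⟩ := key _ f rfl
  exact ⟨k, q, r, h, fun _ => hr⟩

open Classical in
theorem ops_closure {R : Type*} [CommRing R]
    (ops : Polynomial R → Polynomial R → Finset (Polynomial R))
    (hops : ∀ f g, 0 < g.natDegree → ∀ h ∈ ops f g, h.natDegree < g.natDegree)
    (F : Finset (Polynomial R)) :
    ∃ F' : Finset (Polynomial R), F ⊆ F' ∧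
      ∀ f ∈ F', ∀ g ∈ F', 0 < g.natDegree → g.natDegree ≤ f.natDegree → ops f g ⊆ F' := by
  have key : ∀ j k : ℕ, F.sup Polynomial.natDegree < k + j → ∃ F' : Finset (Polynomial R), F ⊆ F' ∧
      ∀ f ∈ F', ∀ g ∈ F', k ≤ g.natDegree → 0 < g.natDegree → g.natDegree ≤ f.natDegree →
        ops f g ⊆ F' := by
    intro j
    induction j with
    | zero =>
      intro k hk
      refine ⟨F, subset_rfl, fun f _ g hg hkg => ?_⟩
      have := Finset.le_sup (f := Polynomial.natDegree) hg
      omega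
    | succ j ih =>
      intro k hk
      obtain ⟨F₁, hF₁, h₁⟩ := ih (k + 1) (by omega)
      rcases Nat.eq_zero_or_pos k with h0 | hkpos
      · exact ⟨F₁, hF₁, fun f hf g hg _ h0' hfg => h₁ f hf g hg (by omega) h0' hfg⟩
      set N := (F₁ ×ˢ F₁.filter (fun g => g.natDegree = k)).biUnion (fun x => ops x.1 x.2) with hN
      have hNd : ∀ h ∈ N, h.natDegree < k := by
        intro h hh
        simp only [hN, Finset.mem_biUnion, Finset.mem_product, Finset.mem_filter] at hh
        obtain ⟨x, ⟨_, _, hx⟩, hx2⟩ := hh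
        rw [← hx]
        exact hops _ _ (by omega) _ hx2
      refine ⟨F₁ ∪ N, hF₁.trans Finset.subset_union_left, ?_⟩
      intro f hf g hg hkg h0 hgf
      have hin : ∀ h ∈ F₁ ∪ N, k ≤ h.natDegree → h ∈ F₁ := by
        intro h hh hk
        rcases Finset.mem_union.1 hh with h1 | h1
        · exact h1
        · have := hNd h h1
          omega
      have hf1 := hin f hf (by omega)
      have hg1 := hin g hg hkg
      rcases Nat.lt_or_ge k g.natDegree with h | h
      · exact (h₁ f hf1 g hg1 h h0 hgf).trans Finset.subset_union_left
      · refine Finset.Subset.trans ?_ Finset.subset_union_right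
        intro u hu
        simp only [hN, Finset.mem_biUnion, Finset.mem_product, Finset.mem_filter]
        exact ⟨(f, g), ⟨hf1, hg1, le_antisymm h hkg⟩, hu⟩
  obtain ⟨F', h1, h2⟩ := key (F.sup Polynomial.natDegree + 1) 0 (by omega)
  exact ⟨F', h1, fun f hf g hg => h2 f hf g hg (by omega)⟩

theorem map_eraseLead {R : Type*} [CommRing R] (χ : R →+* ℝ) (f : Polynomial R)
    (h : χ f.leadingCoeff = 0) : f.map χ = f.eraseLead.map χ := by
  conv_lhs => rw [← Polynomial.eraseLead_add_monomial_natDegree_leadingCoeff f]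
  rw [Polynomial.map_add, Polynomial.map_monomial, h]
  simp

/-- the three operations -/
structure OpsClosed {R : Type*} [CommRing R] (pr : Polynomial R → Polynomial R → Polynomial R)
    (H : Finset (Polynomial R)) : Prop where
  der : ∀ g ∈ H, 0 < g.natDegree → Polynomial.derivative g ∈ H
  erase : ∀ g ∈ H, 0 < g.natDegree → g.eraseLead ∈ H
  prem : ∀ f ∈ H, ∀ g ∈ H, 0 < g.natDegree → g.natDegree ≤ f.natDegree → pr f g ∈ H

theorem ts_root {R : Type*} [CommRing R] (pr : Polynomial R → Polynomial R → Polynomial R)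
    (hpr : ∀ f g, ∃ (k : ℕ) (q : Polynomial R),
      Polynomial.C (g.leadingCoeff ^ k) * f = q * g + pr f g)
    (s : Finset (Polynomial R)) (a : Polynomial R)
    (herase : ∀ g ∈ s, 0 < g.natDegree → g.eraseLead ∈ s)
    (hprem : ∀ g ∈ s, 0 < g.natDegree → pr a g ∈ s)
    (χ χ' : R →+* ℝ)
    (hlc : ∀ g ∈ s, SignType.sign (χ g.leadingCoeff) = SignType.sign (χ' g.leadingCoeff)) :
    ∀ g ∈ (s : Set (Polynomial R)), g.map χ ≠ 0 → ∀ y y', SameSign (s : Set (Polynomial R)) χ χ' y y' →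
      tsEv χ g y = 0 → SignType.sign (tsEv χ a y) = SignType.sign (tsEv χ' a y') := by
  have key : ∀ d : ℕ, ∀ g ∈ s, g.natDegree = d → g.map χ ≠ 0 → ∀ y y',
      SameSign (s : Set (Polynomial R)) χ χ' y y' →
      tsEv χ g y = 0 → SignType.sign (tsEv χ a y) = SignType.sign (tsEv χ' a y') := by
    intro d
    induction d using Nat.strong_induction_on with
    | _ d ih =>
      intro g hg hd hg0 y y' hyy hgy
      rcases Nat.eq_zero_or_pos d with h0 | hpos
      · exfalso
        apply hg0
        rw [tsEv_of_natDegree_zero χ (hd.trans h0)] at hgy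
        rw [Polynomial.eq_C_of_natDegree_eq_zero (hd.trans h0), Polynomial.map_C]
        rw [Polynomial.leadingCoeff, hd, h0] at hgy
        rw [hgy, Polynomial.C_0]
      by_cases hl : χ g.leadingCoeff = 0
      · have hm := map_eraseLead χ g hl
        have hlt : g.eraseLead.natDegree < d := by
          have := Polynomial.eraseLead_natDegree_le g
          omega
        refine ih _ hlt g.eraseLead (herase g hg (by omega)) rfl (hm ▸ hg0) y y' hyy ?_
        simpa [tsEv, ← hm] using hgy
      · obtain ⟨k, q, hq⟩ := hpr a g
        have hr := hprem g hg (by omega)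
        have hgy' : tsEv χ' g y' = 0 := by
          have := hyy g hg
          rwa [hgy, sign_zero, eq_comm, sign_eq_zero_iff] at this
        have e : ∀ (ψ : R →+* ℝ) (w : ℝ), tsEv ψ g w = 0 →
            (ψ g.leadingCoeff) ^ k * tsEv ψ a w = tsEv ψ (pr a g) w := by
          intro ψ w hw
          have := congrArg (fun p => tsEv ψ p w) hq
          simp only [tsEv, Polynomial.map_mul, Polynomial.map_C, Polynomial.eval_mul,
            Polynomial.eval_C, Polynomial.map_add, Polynomial.eval_add, map_pow] at this hw ⊢
          rw [hw] at this
          simpa using this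
        have h1 := congrArg SignType.sign (e χ y hgy)
        have h2 := congrArg SignType.sign (e χ' y' hgy')
        rw [sign_mul, hyy _ hr, ← h2, sign_mul, sign_pow, sign_pow, hlc g hg] at h1
        have hne : (SignType.sign (χ' g.leadingCoeff)) ^ k ≠ 0 := by
          apply pow_ne_zero
          rw [← hlc g hg]
          simpa using hl
        exact mul_left_cancel₀ hne h1
  exact fun g hg => key _ g hg rfl

open Classical in
theorem ts_one {R : Type*} [CommRing R] (F : Finset (Polynomial R)) :
    ∃ G : Finset R, ∀ χ χ' : R →+* ℝ,
      (∀ c ∈ G, SignType.sign (χ c) = SignType.sign (χ' c)) →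
      ∀ y, ∃ y', ∀ f ∈ F, SignType.sign (tsEv χ f y) = SignType.sign (tsEv χ' f y') := by
  choose k q pr hpr hprd using fun f g : Polynomial R => pseudo_div f g
  have hops : ∀ f g : Polynomial R, 0 < g.natDegree →
      ∀ h ∈ ({Polynomial.derivative g, g.eraseLead, pr f g} : Finset (Polynomial R)),
        h.natDegree < g.natDegree := by
    intro f g hg h hh
    simp only [Finset.mem_insert, Finset.mem_singleton] at hh
    rcases hh with rfl | rfl | rfl
    · exact Polynomial.natDegree_derivative_lt (by omega)
    · have := Polynomial.eraseLead_natDegree_le g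
      omega
    · exact hprd f g hg
  have hdd : ∀ g : Polynomial R, 0 < g.natDegree →
      (Polynomial.derivative g).natDegree < g.natDegree :=
    fun g hg => hops g g hg _ (Finset.mem_insert_self _ _)
  have hde : ∀ g : Polynomial R, 0 < g.natDegree → g.eraseLead.natDegree < g.natDegree :=
    fun g hg => hops g g hg _ (Finset.mem_insert_of_mem (Finset.mem_insert_self _ _))
  obtain ⟨F', hF, hcl⟩ := ops_closure
    (fun f g => ({Polynomial.derivative g, g.eraseLead, pr f g} : Finset (Polynomial R))) hops F
  have hclosed : OpsClosed pr F' :=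
    ⟨fun g hg h0 => hcl g hg g hg h0 le_rfl (by simp),
     fun g hg h0 => hcl g hg g hg h0 le_rfl (by simp),
     fun f hf g hg h0 h => hcl f hf g hg h0 h (by simp)⟩
  have main : ∀ χ χ' : R →+* ℝ, ∀ s : Finset (Polynomial R),
      (∀ g ∈ s, SignType.sign (χ g.leadingCoeff) = SignType.sign (χ' g.leadingCoeff)) →
      OpsClosed pr s → Matches (s : Set (Polynomial R)) χ χ' ∧ Matches (s : Set (Polynomial R)) χ' χ := by
    intro χ χ' s
    refine Finset.induction_on_max_value Polynomial.natDegree s ?_ ?_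
    · intro _ _
      exact ⟨fun y => ⟨y, fun f hf => by simp at hf⟩, fun y => ⟨y, fun f hf => by simp at hf⟩⟩
    · intro a s has hmax ih hlc hc
      have hsub : ∀ h, h ∈ insert a s → h.natDegree < a.natDegree → h ∈ s := by
        intro h hh hlt
        rcases Finset.mem_insert.1 hh with rfl | h1
        · omega
        · exact h1
      have hcs : OpsClosed pr s := by
        refine ⟨fun g hg h0 => ?_, fun g hg h0 => ?_, fun f hf g hg h0 hgf => ?_⟩
        · refine hsub _ (hc.der g (Finset.mem_insert_of_mem hg) h0) ?_
          exact lt_of_lt_of_le (hdd g h0) (hmax g hg)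
        · refine hsub _ (hc.erase g (Finset.mem_insert_of_mem hg) h0) ?_
          exact lt_of_lt_of_le (hde g h0) (hmax g hg)
        · refine hsub _ (hc.prem f (Finset.mem_insert_of_mem hf) g
            (Finset.mem_insert_of_mem hg) h0 hgf) ?_
          exact lt_of_lt_of_le (hprd f g h0) (hmax g hg)
      have hlcs : ∀ g ∈ s, SignType.sign (χ g.leadingCoeff) = SignType.sign (χ' g.leadingCoeff) :=
        fun g hg => hlc g (Finset.mem_insert_of_mem hg)
      have hlca := hlc a (Finset.mem_insert_self _ _)
      obtain ⟨m1, m2⟩ := ih hlcs hcs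
      rw [Finset.coe_insert]
      -- trivial extension
      have triv : ∀ ψ ψ' : R →+* ℝ, Matches (s : Set (Polynomial R)) ψ ψ' →
          (∀ y y', SameSign (s : Set (Polynomial R)) ψ ψ' y y' →
            SignType.sign (tsEv ψ a y) = SignType.sign (tsEv ψ' a y')) →
          Matches (insert a (s : Set (Polynomial R))) ψ ψ' := by
        intro ψ ψ' hm h y
        obtain ⟨y', hy'⟩ := hm y
        refine ⟨y', ?_⟩
        rintro g (rfl | hg)
        · exact h y y' hy'
        · exact hy' g hg
      rcases Nat.eq_zero_or_pos a.natDegree with h0 | hpos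
      · refine ⟨triv _ _ m1 fun y y' _ => ?_, triv _ _ m2 fun y y' _ => ?_⟩
        · rw [tsEv_of_natDegree_zero χ h0, tsEv_of_natDegree_zero χ' h0, hlca]
        · rw [tsEv_of_natDegree_zero χ h0, tsEv_of_natDegree_zero χ' h0, hlca]
      have herase : a.eraseLead ∈ s := hsub _ (hc.erase a (Finset.mem_insert_self _ _) hpos)
        (hde a hpos)
      have hder : Polynomial.derivative a ∈ s := hsub _ (hc.der a (Finset.mem_insert_self _ _) hpos)
        (hdd a hpos)
      by_cases hl : χ a.leadingCoeff = 0
      · have hl' : χ' a.leadingCoeff = 0 := by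
          rwa [hl, sign_zero, eq_comm, sign_eq_zero_iff] at hlca
        have e1 := map_eraseLead χ a hl
        have e2 := map_eraseLead χ' a hl'
        refine ⟨triv _ _ m1 fun y y' h => ?_, triv _ _ m2 fun y y' h => ?_⟩
        · have := h _ herase
          simpa only [tsEv, e1, e2] using this
        · have := h _ herase
          simpa only [tsEv, e1, e2] using this
      · have hl' : χ' a.leadingCoeff ≠ 0 := by
          intro h
          rw [h, sign_zero, sign_eq_zero_iff] at hlca
          exact hl hlca
        have hdc : DerClosed (s : Set (Polynomial R)) := fun f hf h => hcs.der f hf h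
        have hd1 : 0 < (a.map χ).natDegree := by
          rwa [Polynomial.natDegree_map_of_leadingCoeff_ne_zero _ hl]
        have hd2 : 0 < (a.map χ').natDegree := by
          rwa [Polynomial.natDegree_map_of_leadingCoeff_ne_zero _ hl']
        have hprem : ∀ g ∈ s, 0 < g.natDegree → pr a g ∈ s := fun g hg hg0 =>
          hsub _ (hc.prem a (Finset.mem_insert_self _ _) g (Finset.mem_insert_of_mem hg) hg0
            (hmax g hg)) (lt_of_lt_of_le (hprd a g hg0) (hmax g hg))
        have hpr' : ∀ f g, ∃ (k : ℕ) (q : Polynomial R),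
          Polynomial.C (g.leadingCoeff ^ k) * f = q * g + pr f g := fun f g => ⟨_, _, hpr f g⟩
        exact ⟨step_lemma s.finite_toSet hdc m1 m2 hder hd1 hd2
            (ts_root pr hpr' s a hcs.erase hprem χ χ' hlcs),
          step_lemma s.finite_toSet hdc m2 m1 hder hd2 hd1
            (ts_root pr hpr' s a hcs.erase hprem χ' χ (fun g hg => (hlcs g hg).symm))⟩
  refine ⟨F'.image Polynomial.leadingCoeff, fun χ χ' h y => ?_⟩
  obtain ⟨y', hy'⟩ := (main χ χ' F' (fun g hg => h _ (Finset.mem_image_of_mem _ hg)) hclosed).1 y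
  exact ⟨y', fun f hf => hy' f (hF hf)⟩

/-- Tarski and Seidenberg in several variables, semantic form. -/
theorem ts_many {R : Type*} [CommRing R] (M : ℕ) (F : Finset (MvPolynomial (Fin M) R)) :
    ∃ G : Finset R, ∀ χ χ' : R →+* ℝ,
      (∀ c ∈ G, SignType.sign (χ c) = SignType.sign (χ' c)) →
      ∀ z : Fin M → ℝ, ∃ z' : Fin M → ℝ, ∀ f ∈ F,
        SignType.sign (MvPolynomial.eval₂Hom χ z f) = SignType.sign (MvPolynomial.eval₂Hom χ' z' f) := by
  classical
  induction M with
  | zero =>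
    refine ⟨F.image (MvPolynomial.coeff 0), fun χ χ' h z => ⟨z, fun f hf => ?_⟩⟩
    have := h _ (Finset.mem_image_of_mem _ hf)
    rw [MvPolynomial.eq_C_of_isEmpty f]
    simpa using this
  | succ M ih =>
    obtain ⟨G₁, hG₁⟩ := ts_one (F.image (MvPolynomial.finSuccEquiv R M))
    obtain ⟨G, hG⟩ := ih G₁
    have ev : ∀ (χ : R →+* ℝ) (s : Fin M → ℝ) (y : ℝ) (f : MvPolynomial (Fin (M+1)) R),
        MvPolynomial.eval₂Hom χ (Fin.cons y s : Fin (M+1) → ℝ) f =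
        tsEv (MvPolynomial.eval₂Hom χ s) (MvPolynomial.finSuccEquiv R M f) y := by
      intro χ s y f
      have : MvPolynomial.eval₂Hom χ (Fin.cons y s : Fin (M+1) → ℝ) =
        ((Polynomial.evalRingHom y).comp (Polynomial.mapRingHom (MvPolynomial.eval₂Hom χ s))).comp
          (MvPolynomial.finSuccEquiv R M : MvPolynomial (Fin (M+1)) R →+* _) := by
        apply MvPolynomial.ringHom_ext
        · intro r
          simp [MvPolynomial.finSuccEquiv_apply]
        · intro i
          refine Fin.cases ?_ (fun j => ?_) i
          · simp [MvPolynomial.finSuccEquiv_X_zero]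
          · simp [MvPolynomial.finSuccEquiv_X_succ]
      rw [this]
      rfl
    refine ⟨G, fun χ χ' h z => ?_⟩
    obtain ⟨s', hs'⟩ := hG χ χ' h (Fin.tail z)
    obtain ⟨y', hy'⟩ := hG₁ _ _ hs' (z 0)
    refine ⟨Fin.cons y' s', fun f hf => ?_⟩
    have := hy' _ (Finset.mem_image_of_mem _ hf)
    rw [← ev, ← ev, Fin.cons_self_tail] at this
    exact this

theorem poly_bound (a : Polynomial ℝ) : ∃ d : ℕ, ∀ᶠ r : ℝ in Filter.atTop, |a.eval r| ≤ r ^ d := by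
  induction a using Polynomial.induction_on' with
  | add p q hp hq =>
    obtain ⟨d1, h1⟩ := hp
    obtain ⟨d2, h2⟩ := hq
    refine ⟨max d1 d2 + 1, ?_⟩
    filter_upwards [h1, h2, Filter.eventually_ge_atTop (2:ℝ)] with r h1 h2 hr
    have e1 : r ^ d1 ≤ r ^ (max d1 d2) := pow_le_pow_right₀ (by linarith) (le_max_left _ _)
    have e2 : r ^ d2 ≤ r ^ (max d1 d2) := pow_le_pow_right₀ (by linarith) (le_max_right _ _)
    have e3 : 0 ≤ r ^ (max d1 d2) := by positivity
    rw [Polynomial.eval_add, pow_succ]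
    calc |p.eval r + q.eval r| ≤ |p.eval r| + |q.eval r| := abs_add_le _ _
      _ ≤ r ^ (max d1 d2) * r := by nlinarith
  | monomial k c =>
    refine ⟨k + 1, ?_⟩
    filter_upwards [Filter.eventually_ge_atTop (max 1 |c|)] with r hr
    have h1 : 1 ≤ r := (le_max_left _ _).trans hr
    have h2 : |c| ≤ r := (le_max_right _ _).trans hr
    rw [Polynomial.eval_monomial, abs_mul, abs_of_nonneg (by positivity : 0 ≤ r ^ k), pow_succ, mul_comm]
    gcongr

open Polynomial in
theorem poly2_bound (P : ℝ[X][X]) : ∃ d : ℕ, ∀ᶠ r : ℝ in Filter.atTop, ∀ t ∈ Set.Ioo (0:ℝ) 1,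
    |P.evalEval r t| ≤ r ^ d := by
  induction P using Polynomial.induction_on' with
  | add p q hp hq =>
    obtain ⟨d1, h1⟩ := hp
    obtain ⟨d2, h2⟩ := hq
    refine ⟨max d1 d2 + 1, ?_⟩
    filter_upwards [h1, h2, Filter.eventually_ge_atTop (2:ℝ)] with r h1 h2 hr t ht
    have h1 := h1 t ht
    have h2 := h2 t ht
    have e1 : r ^ d1 ≤ r ^ (max d1 d2) := pow_le_pow_right₀ (by linarith) (le_max_left _ _)
    have e2 : r ^ d2 ≤ r ^ (max d1 d2) := pow_le_pow_right₀ (by linarith) (le_max_right _ _)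
    have e3 : 0 ≤ r ^ (max d1 d2) := by positivity
    rw [Polynomial.evalEval_add, pow_succ]
    calc |p.evalEval r t + q.evalEval r t| ≤ |p.evalEval r t| + |q.evalEval r t| := abs_add_le _ _
      _ ≤ r ^ (max d1 d2) * r := by nlinarith
  | monomial k c =>
    obtain ⟨d, hd⟩ := poly_bound c
    refine ⟨d, ?_⟩
    filter_upwards [hd] with r hr t ht
    have h1 : t ^ k ≤ 1 := pow_le_one₀ ht.1.le ht.2.le
    have h0 : 0 ≤ t ^ k := pow_nonneg ht.1.le k
    have : (Polynomial.monomial k c).evalEval r t = c.eval r * t ^ k := by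
      simp [Polynomial.evalEval, Polynomial.eval_monomial]
    rw [this, abs_mul, abs_of_nonneg h0]
    calc |c.eval r| * t ^ k ≤ |c.eval r| * 1 := by gcongr
      _ ≤ r ^ d := by simpa using hr

theorem poly_lower (a : Polynomial ℝ) (ha : a ≠ 0) :
    ∃ c > 0, ∀ᶠ r : ℝ in Filter.atTop, c ≤ |a.eval r| := by
  by_cases h : 0 < a.degree
  · exact ⟨1, one_pos, (a.abs_tendsto_atTop h).eventually_ge_atTop 1⟩
  · rw [Polynomial.eq_C_of_degree_le_zero (not_lt.1 h)] at ha ⊢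
    refine ⟨|a.coeff 0|, by simpa using ha, by simp⟩

open Polynomial in
theorem poly2_sign (P : ℝ[X][X]) : ∃ N : ℕ, ∀ᶠ r : ℝ in Filter.atTop, ∃ s : SignType,
    ∀ t ∈ Set.Ioo (0:ℝ) (1 / r ^ N), SignType.sign (P.evalEval r t) = s := by
  have key : ∀ d : ℕ, ∀ P : ℝ[X][X], P.natDegree = d → ∃ N : ℕ, ∀ᶠ r : ℝ in Filter.atTop,
      ∃ s : SignType, ∀ t ∈ Set.Ioo (0:ℝ) (1 / r ^ N), SignType.sign (P.evalEval r t) = s := by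
    intro d
    induction d with
    | zero =>
      intro P hP
      rw [Polynomial.eq_C_of_natDegree_eq_zero hP]
      exact ⟨0, Filter.Eventually.of_forall fun r => ⟨_, fun t _ => by
        rw [Polynomial.evalEval_C]⟩⟩
    | succ d ih =>
      intro P hP
      have hdec : ∀ r t, P.evalEval r t = P.divX.evalEval r t * t + (P.coeff 0).eval r := by
        intro r t
        conv_lhs => rw [← Polynomial.divX_mul_X_add P]
        simp [Polynomial.evalEval_C]
      by_cases h0 : P.coeff 0 = 0
      · obtain ⟨N, hN⟩ := ih P.divX (by
          rw [Polynomial.natDegree_divX_eq_natDegree_tsub_one, hP]; rfl)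
        refine ⟨N, ?_⟩
        filter_upwards [hN] with r hr
        obtain ⟨s, hs⟩ := hr
        refine ⟨s, fun t ht => ?_⟩
        rw [hdec, h0, Polynomial.eval_zero, add_zero, sign_mul, sign_pos ht.1, mul_one, hs t ht]
      · obtain ⟨c, hc, hcr⟩ := poly_lower _ h0
        obtain ⟨d, hd⟩ := poly2_bound P.divX
        refine ⟨d + 1, ?_⟩
        filter_upwards [hcr, hd, Filter.eventually_ge_atTop (max 1 (1 / c))] with r h1 h2 h3
        have hr1 : 1 ≤ r := (le_max_left _ _).trans h3
        have hrc : 1 / c ≤ r := (le_max_right _ _).trans h3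
        refine ⟨SignType.sign ((P.coeff 0).eval r), fun t ht => ?_⟩
        have hpos : 0 < r ^ d := by positivity
        have ht2 : t * (r ^ d * r) < 1 := by
          have := ht.2
          rwa [lt_div_iff₀ (by positivity), pow_succ] at this
        have ht1 : t < 1 := by
          refine lt_of_lt_of_le ht.2 ?_
          rw [div_le_one (by positivity)]
          exact one_le_pow₀ hr1
        have hq := h2 t ⟨ht.1, ht1⟩
        have hsmall : |P.divX.evalEval r t * t| < c := by
          rw [abs_mul, abs_of_pos ht.1]
          have : |P.divX.evalEval r t| * t ≤ r ^ d * t := mul_le_mul_of_nonneg_right hq ht.1.le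
          refine lt_of_le_of_lt this ?_
          have h4 : 1 ≤ r * c := by rwa [div_le_iff₀ hc] at hrc
          have h5 : 0 < r ^ d * t := mul_pos hpos ht.1
          nlinarith
        rw [hdec]
        have h6 := abs_lt.1 hsmall
        rcases lt_trichotomy ((P.coeff 0).eval r) 0 with h | h | h
        · rw [abs_of_neg h] at h1
          rw [sign_neg h, sign_neg (by linarith)]
        · rw [h] at h1; simp at h1; linarith
        · rw [abs_of_pos h] at h1
          rw [sign_pos h, sign_pos (by linarith)]
  exact key _ P rfl

open Polynomial in
theorem poly2_sign_finset (G : Finset ℝ[X][X]) : ∃ N : ℕ, ∀ᶠ r : ℝ in Filter.atTop,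
    ∀ t ∈ Set.Ioo (0:ℝ) (1 / r ^ N), ∀ t' ∈ Set.Ioo (0:ℝ) (1 / r ^ N), ∀ P ∈ G,
      SignType.sign (P.evalEval r t) = SignType.sign (P.evalEval r t') := by
  choose N hN using poly2_sign
  refine ⟨G.sup N, ?_⟩
  have := (Filter.eventually_all_finset G).2 (fun P _ => hN P)
  filter_upwards [this, Filter.eventually_ge_atTop (1:ℝ)] with r hr h1 t ht t' ht' P hP
  obtain ⟨s, hs⟩ := hr P hP
  have hle : 1 / r ^ (G.sup N) ≤ 1 / r ^ (N P) :=
    one_div_le_one_div_of_le (by positivity) (pow_le_pow_right₀ h1 (Finset.le_sup hP))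
  rw [hs t ⟨ht.1, ht.2.trans_le hle⟩, hs t' ⟨ht'.1, ht'.2.trans_le hle⟩]

theorem bounded_of_sq (M : ℕ) (r : ℝ) : IsCompact {z : Fin M → ℝ | ∑ i, z i ^ 2 ≤ r} := by
  apply Metric.isCompact_of_isClosed_isBounded
  · exact isClosed_le (by fun_prop) continuous_const
  · apply (Metric.isBounded_closedBall (x := (0 : Fin M → ℝ)) (r := 1 + r)).subset
    intro z hz
    have hz : ∑ i, z i ^ 2 ≤ r := hz
    have hr : 0 ≤ r := (Finset.sum_nonneg fun i _ => sq_nonneg _).trans hz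
    rw [mem_closedBall_zero_iff, pi_norm_le_iff_of_nonneg (by linarith)]
    intro i
    have h1 : z i ^ 2 ≤ r :=
      (Finset.single_le_sum (f := fun i => z i ^ 2) (fun i _ => sq_nonneg _) (Finset.mem_univ i)).trans hz
    rw [Real.norm_eq_abs]
    have := sq_abs (z i)
    nlinarith [sq_nonneg (|z i| - 1), abs_nonneg (z i)]

open Polynomial in
theorem loj_fin (M : ℕ) (Z : Set (Fin M → ℝ)) (hZ : IsClosed Z)
    (F : Finset (MvPolynomial (Fin M) ℝ))
    (hF : ∀ z z', (∀ f ∈ F, SignType.sign (MvPolynomial.eval z f) =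
      SignType.sign (MvPolynomial.eval z' f)) → z ∈ Z → z' ∈ Z)
    (g : MvPolynomial (Fin M) ℝ) (hg : ∀ z ∈ Z, 0 < MvPolynomial.eval z g) :
    ∃ c > 0, ∃ N : ℕ, ∀ z ∈ Z, c ≤ MvPolynomial.eval z g * (1 + ∑ i, z i ^ 2) ^ N := by
  classical
  set ι : ℝ →+* ℝ[X][X] := Polynomial.C.comp Polynomial.C with hι
  have hev : ∀ (r t : ℝ) (z : Fin M → ℝ) (f : MvPolynomial (Fin M) ℝ),
      MvPolynomial.eval₂Hom (Polynomial.evalEvalRingHom r t) z (MvPolynomial.map ι f) =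
        MvPolynomial.eval z f := by
    intro r t z f
    rw [MvPolynomial.coe_eval₂Hom, MvPolynomial.eval₂_map]
    have : (Polynomial.evalEvalRingHom r t).comp ι = RingHom.id ℝ := by
      ext x; simp [hι]
    rw [this]
    rfl
  obtain ⟨p1, hp1⟩ : ∃ p : MvPolynomial (Fin M) ℝ[X][X],
    p = MvPolynomial.map ι g - MvPolynomial.C (Polynomial.X : ℝ[X][X]) := ⟨_, rfl⟩
  obtain ⟨p2, hp2⟩ : ∃ p : MvPolynomial (Fin M) ℝ[X][X],
    p = (∑ i : Fin M, (MvPolynomial.X i : MvPolynomial (Fin M) ℝ[X][X]) ^ 2) -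
      MvPolynomial.C (Polynomial.C (Polynomial.X : ℝ[X]) : ℝ[X][X]) := ⟨_, rfl⟩
  obtain ⟨G, hG⟩ := ts_many M (F.image (MvPolynomial.map ι) ∪ {p1, p2})
  obtain ⟨N, hN⟩ := poly2_sign_finset G
  obtain ⟨r₀, hr₀⟩ := Filter.eventually_atTop.1 hN
  have hgc : Continuous fun z : Fin M → ℝ => MvPolynomial.eval z g := MvPolynomial.continuous_eval g
  -- lower bound on compact pieces
  have hcomp : ∀ r, ∃ c > 0, ∀ z ∈ Z, ∑ i, z i ^ 2 ≤ r → c ≤ MvPolynomial.eval z g := by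
    intro r
    have hK : IsCompact ({z : Fin M → ℝ | ∑ i, z i ^ 2 ≤ r} ∩ Z) := (bounded_of_sq M r).inter_right hZ
    rcases Set.eq_empty_or_nonempty ({z : Fin M → ℝ | ∑ i, z i ^ 2 ≤ r} ∩ Z) with he | hne
    · refine ⟨1, one_pos, fun z hz hzr => ?_⟩
      have : z ∈ ({z : Fin M → ℝ | ∑ i, z i ^ 2 ≤ r} ∩ Z) := ⟨hzr, hz⟩
      rw [he] at this
      exact this.elim
    · obtain ⟨z₀, hz₀, hmin⟩ := hK.exists_isMinOn hne hgc.continuousOn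
      exact ⟨_, hg z₀ hz₀.2, fun z hz hzr => hmin ⟨hzr, hz⟩⟩
  obtain ⟨c, hc, hcb⟩ := hcomp (max r₀ 1)
  refine ⟨min c 1, lt_min hc one_pos, N, fun z hz => ?_⟩
  have hs0 : 0 ≤ ∑ i, z i ^ 2 := Finset.sum_nonneg fun i _ => sq_nonneg _
  have hone : 1 ≤ (1 + ∑ i, z i ^ 2) ^ N := one_le_pow₀ (by linarith)
  rcases le_or_gt (∑ i, z i ^ 2) (max r₀ 1) with h | h
  · have h1 := hcb z hz h
    calc min c 1 ≤ c := min_le_left _ _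
      _ ≤ MvPolynomial.eval z g * 1 := by linarith
      _ ≤ _ := by gcongr; exact (hg z hz).le
  · refine (min_le_right _ _).trans ?_
    set r := ∑ i, z i ^ 2 with hr
    have hr0 : r₀ ≤ r := (le_max_left _ _).trans h.le
    have hr1 : 1 < r := (le_max_right _ _).trans_lt h
    have hrN : 0 < r ^ N := by positivity
    have hle : 1 ≤ MvPolynomial.eval z g * r ^ N := by
      by_contra hlt
      push Not at hlt
      have ht : MvPolynomial.eval z g ∈ Set.Ioo (0:ℝ) (1 / r ^ N) :=
        ⟨hg z hz, by rwa [lt_div_iff₀ hrN]⟩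
      obtain ⟨c₁, hc₁, hcb₁⟩ := hcomp r
      have ht' : min (c₁ / 2) (1 / r ^ N / 2) ∈ Set.Ioo (0:ℝ) (1 / r ^ N) := by
        refine ⟨by positivity, (min_le_right _ _).trans_lt ?_⟩
        have : 0 < 1 / r ^ N := by positivity
        linarith
      set t := MvPolynomial.eval z g with htdef
      set t' := min (c₁ / 2) (1 / r ^ N / 2) with ht'def
      obtain ⟨z', hz'⟩ := hG (Polynomial.evalEvalRingHom r t) (Polynomial.evalEvalRingHom r t')
        (fun P hP => by simpa using hr₀ r hr0 t ht t' ht' P hP) z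
      have hz'Z : z' ∈ Z := by
        refine hF z z' (fun f hf => ?_) hz
        have := hz' _ (Finset.mem_union_left _ (Finset.mem_image_of_mem _ hf))
        rwa [hev, hev] at this
      have e1 := hz' p1
        (Finset.mem_union_right _ (by simp))
      have e2 := hz' p2
        (Finset.mem_union_right _ (by simp))
      rw [hp1, RingHom.map_sub, RingHom.map_sub, hev, hev] at e1
      rw [hp2] at e2
      simp only [MvPolynomial.coe_eval₂Hom, MvPolynomial.eval₂_C, MvPolynomial.eval₂_sub,
        MvPolynomial.eval₂_sum, MvPolynomial.eval₂_pow, MvPolynomial.eval₂_X,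
        Polynomial.coe_evalEvalRingHom, Polynomial.evalEval_X, Polynomial.evalEval_C,
        Polynomial.eval_X] at e1 e2
      rw [← htdef, sub_self, sign_zero, eq_comm, sign_eq_zero_iff, sub_eq_zero] at e1
      rw [← hr, sub_self, sign_zero, eq_comm, sign_eq_zero_iff, sub_eq_zero] at e2
      have := hcb₁ z' hz'Z e2.le
      rw [e1] at this
      have := this.trans (min_le_left _ _)
      linarith
    refine hle.trans ?_
    have := hg z hz
    gcongr
    linarith

/-- Łojasiewicz inequality. -/
theorem loj {σ : Type*} [Fintype σ] (Z : Set (σ → ℝ)) (hZ : IsClosed Z)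
    (F : Finset (MvPolynomial σ ℝ))
    (hF : ∀ z z', (∀ f ∈ F, SignType.sign (MvPolynomial.eval z f) =
      SignType.sign (MvPolynomial.eval z' f)) → z ∈ Z → z' ∈ Z)
    (g : MvPolynomial σ ℝ) (hg : ∀ z ∈ Z, 0 < MvPolynomial.eval z g) :
    ∃ c > 0, ∃ N : ℕ, ∀ z ∈ Z, c ≤ MvPolynomial.eval z g * (1 + ∑ i, z i ^ 2) ^ N := by
  classical
  set e := Fintype.equivFin σ
  obtain ⟨c, hc, N, h⟩ := loj_fin (Fintype.card σ) ((fun z : Fin (Fintype.card σ) → ℝ => z ∘ e) ⁻¹' Z)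
    (hZ.preimage (by fun_prop)) (F.image (MvPolynomial.rename e))
    (fun z z' hs hz => hF _ _ (fun f hf => by
      have := hs _ (Finset.mem_image_of_mem _ hf)
      rwa [MvPolynomial.eval_rename, MvPolynomial.eval_rename] at this) hz)
    (MvPolynomial.rename e g) (fun z hz => by rw [MvPolynomial.eval_rename]; exact hg _ hz)
  refine ⟨c, hc, N, fun z hz => ?_⟩
  have e1 : (z ∘ e.symm) ∘ e = z := by ext i; simp
  have := h (z ∘ e.symm) (by rw [Set.mem_preimage, e1]; exact hz)
  rw [MvPolynomial.eval_rename, e1] at this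
  have e2 : ∑ i, (z ∘ e.symm) i ^ 2 = ∑ i, z i ^ 2 := e.symm.sum_comp (fun i => z i ^ 2)
  rwa [e2] at this

theorem pos_iff_of_sign_eq {a b : ℝ} (h : SignType.sign a = SignType.sign b) : 0 < a ↔ 0 < b := by
  rw [← sign_eq_one_iff, h, sign_eq_one_iff]

theorem zero_iff_of_sign_eq {a b : ℝ} (h : SignType.sign a = SignType.sign b) : a = 0 ↔ b = 0 := by
  rw [← sign_eq_zero_iff, h, sign_eq_zero_iff]

theorem semialg_signs {n : ℕ} {S : Set (Fin n → ℝ)} (hS : IsSemialgebraic S) :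
    ∃ F : Finset (MvPolynomial (Fin n) ℝ), ∀ z z', (∀ f ∈ F, SignType.sign (MvPolynomial.eval z f) =
      SignType.sign (MvPolynomial.eval z' f)) → (z ∈ S ↔ z' ∈ S) := by
  classical
  obtain ⟨m, p, Q, rfl⟩ := hS
  refine ⟨Finset.univ.image p ∪ Finset.univ.biUnion Q, fun z z' h => ?_⟩
  simp only [Set.mem_iUnion, Set.mem_ofPred_eq]
  refine exists_congr fun i => and_congr ?_ (forall₂_congr fun q hq => ?_)
  · exact zero_iff_of_sign_eq (h _ (Finset.mem_union_left _ (Finset.mem_image_of_mem _ (Finset.mem_univ _))))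
  · exact pos_iff_of_sign_eq (h _ (Finset.mem_union_right _ (Finset.mem_biUnion.2 ⟨i, Finset.mem_univ _, hq⟩)))

theorem open_piece {n : ℕ} {W : Set (Fin n → ℝ)} (hWo : IsOpen W) (hW : IsSemialgebraic W)
    (p : MvPolynomial (Fin n) ℝ) (Q : Finset (MvPolynomial (Fin n) ℝ))
    (hpQ : ∀ x, MvPolynomial.eval x p = 0 → (∀ q ∈ Q, 0 < MvPolynomial.eval x q) → x ∈ W) :
    ∃ s : MvPolynomial (Fin n) ℝ,
      (∀ x, MvPolynomial.eval x p = 0 → (∀ q ∈ Q, 0 < MvPolynomial.eval x q) →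
        0 < MvPolynomial.eval x s) ∧
      (∀ x, 0 < MvPolynomial.eval x s → (∀ q ∈ Q, 0 < MvPolynomial.eval x q) → x ∈ W) := by
  classical
  obtain ⟨F, hF⟩ := semialg_signs hW
  let eqn : {q // q ∈ Q} → MvPolynomial (Fin n ⊕ {q // q ∈ Q}) ℝ := fun q =>
    MvPolynomial.X (Sum.inr q) ^ 2 * MvPolynomial.rename Sum.inl q.1 - 1
  have heqn : ∀ z q, MvPolynomial.eval z (eqn q) =
      z (Sum.inr q) ^ 2 * MvPolynomial.eval (z ∘ Sum.inl) q.1 - 1 := by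
    intro z q
    simp [eqn, MvPolynomial.eval_rename]
  let Z : Set (Fin n ⊕ {q // q ∈ Q} → ℝ) :=
    {z | z ∘ Sum.inl ∉ W ∧ ∀ q, MvPolynomial.eval z (eqn q) = 0}
  have hZ : IsClosed Z := by
    refine IsClosed.inter ?_ ?_
    · exact hWo.isClosed_compl.preimage (f := fun z : Fin n ⊕ {q // q ∈ Q} → ℝ => z ∘ Sum.inl)
        (by fun_prop)
    · have : {z : Fin n ⊕ {q // q ∈ Q} → ℝ | ∀ q, MvPolynomial.eval z (eqn q) = 0} =
          ⋂ q, {z | MvPolynomial.eval z (eqn q) = 0} := by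
        ext z
        simp only [Set.mem_iInter]
        rfl
      change IsClosed {z : Fin n ⊕ {q // q ∈ Q} → ℝ | ∀ q, MvPolynomial.eval z (eqn q) = 0}
      rw [this]
      exact isClosed_iInter fun q =>
        isClosed_eq (MvPolynomial.continuous_eval _) continuous_const
  have hqpos : ∀ z ∈ Z, ∀ q ∈ Q, 0 < MvPolynomial.eval (z ∘ Sum.inl) q := by
    intro z hz q hq
    have := hz.2 ⟨q, hq⟩
    rw [heqn] at this
    by_contra hn
    have h2 := mul_nonpos_of_nonneg_of_nonpos (sq_nonneg (z (Sum.inr ⟨q, hq⟩))) (not_lt.1 hn)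
    simp only at this
    linarith
  obtain ⟨c, hc, N, hN⟩ := loj Z hZ (F.image (MvPolynomial.rename Sum.inl) ∪ Finset.univ.image eqn)
    (fun z z' h hz => by
      refine ⟨fun hmem => hz.1 ((hF _ _ fun f hf => ?_).2 hmem), fun q => ?_⟩
      · have := h _ (Finset.mem_union_left _ (Finset.mem_image_of_mem _ hf))
        rwa [MvPolynomial.eval_rename, MvPolynomial.eval_rename] at this
      · exact (zero_iff_of_sign_eq (h _ (Finset.mem_union_right _
          (Finset.mem_image_of_mem _ (Finset.mem_univ _))))).1 (hz.2 q))
    (MvPolynomial.rename Sum.inl (p ^ 2))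
    (fun z hz => by
      rw [MvPolynomial.eval_rename, map_pow]
      have : MvPolynomial.eval (z ∘ Sum.inl) p ≠ 0 := fun h => hz.1 (hpQ _ h (hqpos z hz))
      positivity)
  let D : MvPolynomial (Fin n) ℝ := (1 + ∑ i, MvPolynomial.X i ^ 2) * (∏ q ∈ Q, q) +
    ∑ q ∈ Q, ∏ q' ∈ Q.erase q, q'
  have hD : ∀ x, (∀ q ∈ Q, 0 < MvPolynomial.eval x q) → MvPolynomial.eval x D =
      (1 + ∑ i, x i ^ 2 + ∑ q ∈ Q, 1 / MvPolynomial.eval x q) *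
        ∏ q ∈ Q, MvPolynomial.eval x q := by
    intro x hx
    simp only [D, map_add, map_mul, map_sum, map_prod, map_one, map_pow, MvPolynomial.eval_X]
    rw [add_mul _ (∑ q ∈ Q, _), Finset.sum_mul]
    congr 1
    refine Finset.sum_congr rfl fun q hq => ?_
    rw [← Finset.mul_prod_erase Q _ hq, ← mul_assoc, one_div_mul_cancel (hx q hq).ne', one_mul]
  refine ⟨MvPolynomial.C c * (∏ q ∈ Q, q) ^ N - p ^ 2 * D ^ N, fun x hp hq => ?_, fun x hs hq => ?_⟩
  · have : 0 < ∏ q ∈ Q, MvPolynomial.eval x q := Finset.prod_pos hq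
    simp only [map_sub, map_mul, map_pow, map_prod, MvPolynomial.eval_C, hp]
    simp only [ne_eq, OfNat.ofNat_ne_zero, not_false_eq_true, zero_pow, zero_mul, sub_zero]
    positivity
  · by_contra hxW
    have hP : 0 < ∏ q ∈ Q, MvPolynomial.eval x q := Finset.prod_pos hq
    let z : Fin n ⊕ {q // q ∈ Q} → ℝ := Sum.elim x fun q => 1 / √(MvPolynomial.eval x q.1)
    have hzx : z ∘ Sum.inl = x := by ext; simp [z]
    have hzq : ∀ q : {q // q ∈ Q}, z (Sum.inr q) ^ 2 = 1 / MvPolynomial.eval x q.1 := by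
      intro q
      simp only [z, Sum.elim_inr, div_pow, one_pow]
      rw [Real.sq_sqrt (hq _ q.2).le]
    have hz : z ∈ Z := by
      refine ⟨by rwa [hzx], fun q => ?_⟩
      rw [heqn, hzx, hzq, one_div_mul_cancel (hq _ q.2).ne', sub_self]
    have h1 := hN z hz
    rw [MvPolynomial.eval_rename, hzx, map_pow, Fintype.sum_sum_type] at h1
    simp only [hzq] at h1
    rw [Finset.sum_coe_sort Q (fun q => 1 / MvPolynomial.eval x q), ← add_assoc] at h1
    simp only [map_sub, map_mul, map_pow, map_prod, MvPolynomial.eval_C, hD x hq] at hs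
    have h2 := mul_le_mul_of_nonneg_right h1 (pow_pos hP N).le
    rw [mul_pow] at hs
    have hzi : ∀ i, z (Sum.inl i) = x i := fun i => rfl
    simp only [hzi] at h2
    nlinarith

theorem open_basic {n : ℕ} {W : Set (Fin n → ℝ)} (hWo : IsOpen W) (hW : IsSemialgebraic W) :
    ∃ (m : ℕ) (V : Fin m → Finset (MvPolynomial (Fin n) ℝ)),
      W = ⋃ i, {x | ∀ v ∈ V i, 0 < MvPolynomial.eval x v} := by
  classical
  obtain ⟨m, p, Q, hpQ⟩ := id hW
  have := fun i => open_piece hWo hW (p i) (Q i) (fun x h1 h2 => by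
    rw [hpQ]; exact Set.mem_iUnion.2 ⟨i, h1, h2⟩)
  choose s hs1 hs2 using this
  refine ⟨m, fun i => insert (s i) (Q i), Set.Subset.antisymm ?_ ?_⟩
  · intro x hx
    rw [hpQ] at hx
    obtain ⟨i, h1, h2⟩ := Set.mem_iUnion.1 hx
    refine Set.mem_iUnion.2 ⟨i, ?_⟩
    simpa using ⟨hs1 i x h1 h2, h2⟩
  · intro x hx
    obtain ⟨i, hi⟩ := Set.mem_iUnion.1 hx
    simp only [Set.mem_ofPred_eq, Finset.forall_mem_insert] at hi
    exact hs2 i x hi.1 hi.2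

theorem basic_cover {n m : ℕ} (X : Set (Fin n → ℝ)) (W : Fin m → Set (Fin n → ℝ))
    (hWo : ∀ i, IsOpen (W i)) (hWsa : ∀ i, IsSemialgebraic (W i)) (hcov : X ⊆ ⋃ i, W i) :
    ∃ (M : ℕ) (π : Fin M → Fin m) (V : Fin M → Finset (MvPolynomial (Fin n) ℝ)),
      (∀ k x, (∀ v ∈ V k, 0 < MvPolynomial.eval x v) → x ∈ W (π k)) ∧
      ∀ x ∈ X, ∃ k, ∀ v ∈ V k, 0 < MvPolynomial.eval x v := by
  choose l V hV using fun i => open_basic (hWo i) (hWsa i)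
  let e := Fintype.equivFin (Σ i : Fin m, Fin (l i))
  refine ⟨_, fun k => (e.symm k).1, fun k => V (e.symm k).1 (e.symm k).2, fun k x h => ?_,
    fun x hx => ?_⟩
  · dsimp only
    rw [hV]
    exact Set.mem_iUnion.2 ⟨_, h⟩
  · obtain ⟨i, hi⟩ := Set.mem_iUnion.1 (hcov hx)
    rw [hV] at hi
    obtain ⟨a, ha⟩ := Set.mem_iUnion.1 hi
    have key : ∀ y : (Σ i : Fin m, Fin (l i)), y = ⟨i, a⟩ →
        ∀ v ∈ V y.1 y.2, 0 < MvPolynomial.eval x v := by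
      rintro y rfl
      exact ha
    exact ⟨e ⟨i, a⟩, key _ (e.symm_apply_apply _)⟩

theorem shrink_cover {n M : ℕ} (X : Set (Fin n → ℝ)) (hXcl : IsClosed X) (hXsa : IsSemialgebraic X)
    (V : Fin M → Finset (MvPolynomial (Fin n) ℝ))
    (hV : ∀ x ∈ X, ∃ k, ∀ v ∈ V k, 0 < MvPolynomial.eval x v) :
    ∃ h : MvPolynomial (Fin n) ℝ, (∀ x, 0 < MvPolynomial.eval x h) ∧
      ∀ x ∈ X, ∃ k, ∀ v ∈ V k, 1 ≤ MvPolynomial.eval x (v * h) := by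
  classical
  obtain ⟨F, hF⟩ := semialg_signs hXsa
  let s : MvPolynomial (Option (Fin n)) ℝ := MvPolynomial.X none
  let ρ : MvPolynomial (Fin n) ℝ → MvPolynomial (Option (Fin n)) ℝ := fun v =>
    MvPolynomial.rename some v
  have hρ : ∀ z v, MvPolynomial.eval z (ρ v) = MvPolynomial.eval (z ∘ some) v := fun z v =>
    MvPolynomial.eval_rename _ _ _
  have hs : ∀ z, MvPolynomial.eval z s = z none := fun z => MvPolynomial.eval_X _
  let Z : Set (Option (Fin n) → ℝ) :=
    {z | z ∘ some ∈ X} ∩ {z | 0 ≤ MvPolynomial.eval z s} ∩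
      ⋂ k, ⋃ v ∈ V k, {z | MvPolynomial.eval z (ρ v - s) ≤ 0}
  have hZ : IsClosed Z := by
    refine IsClosed.inter (IsClosed.inter ?_ ?_) ?_
    · exact hXcl.preimage (f := fun z : Option (Fin n) → ℝ => z ∘ some) (by fun_prop)
    · exact isClosed_le continuous_const (MvPolynomial.continuous_eval _)
    · refine isClosed_iInter fun k => ?_
      exact Set.Finite.isClosed_biUnion (V k).finite_toSet fun v _ =>
        isClosed_le (MvPolynomial.continuous_eval _) continuous_const
  have hmem : ∀ z, z ∈ Z ↔ (z ∘ some ∈ X ∧ 0 ≤ MvPolynomial.eval z s) ∧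
      ∀ k, ∃ v ∈ V k, MvPolynomial.eval z (ρ v - s) ≤ 0 := by
    intro z
    simp only [Z, Set.mem_inter_iff, Set.mem_iInter, Set.mem_iUnion, exists_prop]
    rfl
  obtain ⟨c, hc, N, hN⟩ := loj Z hZ
    (F.image ρ ∪ ({s} ∪ Finset.univ.biUnion fun k => (V k).image fun v => ρ v - s))
    (fun z z' h hz => by
      rw [hmem] at hz ⊢
      refine ⟨⟨(hF _ _ fun f hf => ?_).1 hz.1.1, ?_⟩, fun k => ?_⟩
      · have := h _ (Finset.mem_union_left _ (Finset.mem_image_of_mem _ hf))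
        rwa [hρ, hρ] at this
      · exact nonneg_of_sign_eq (h s (Finset.mem_union_right _ (Finset.mem_union_left _ (by simp)))) hz.1.2
      · obtain ⟨v, hv, hle⟩ := hz.2 k
        refine ⟨v, hv, nonpos_of_sign_eq (h (ρ v - s) ?_) hle⟩
        refine Finset.mem_union_right _ (Finset.mem_union_right _ (Finset.mem_biUnion.2 ⟨k, Finset.mem_univ _, ?_⟩))
        exact Finset.mem_image_of_mem (fun v => ρ v - s) hv)
    s
    (fun z hz => by
      rw [hmem] at hz
      obtain ⟨k, hk⟩ := hV _ hz.1.1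
      obtain ⟨v, hv, hle⟩ := hz.2 k
      have := hk v hv
      rw [map_sub, hρ] at hle
      linarith)
  set c' := min c 1 with hc'
  have hc'0 : 0 < c' := lt_min hc one_pos
  refine ⟨MvPolynomial.C (2 / c') * (MvPolynomial.C 2 + ∑ i, MvPolynomial.X i ^ 2) ^ N,
    fun x => ?_, fun x hx => ?_⟩
  · have : 0 ≤ ∑ i, x i ^ 2 := Finset.sum_nonneg fun i _ => sq_nonneg _
    simp only [map_mul, map_pow, map_add, map_sum, MvPolynomial.eval_C, MvPolynomial.eval_X]
    positivity
  · by_contra! hcon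
    have hs0 : 0 ≤ ∑ i, x i ^ 2 := Finset.sum_nonneg fun i _ => sq_nonneg _
    set A := 2 + ∑ i, x i ^ 2 with hA
    have hA0 : 0 < A ^ N := by positivity
    have hA1 : 1 ≤ A ^ N := one_le_pow₀ (by linarith)
    let t : ℝ := c' / (2 * A ^ N)
    have ht0 : 0 < t := by positivity
    have ht1 : t ≤ 1 := by
      rw [div_le_one (by positivity)]
      have : c' ≤ 1 := min_le_right _ _
      linarith
    let z : Option (Fin n) → ℝ := fun o => o.elim t x
    have hzx : z ∘ some = x := by ext; simp [z]
    have hzn : z none = t := rfl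
    have hz : z ∈ Z := by
      rw [hmem, hzx, hs, hzn]
      refine ⟨⟨hx, ht0.le⟩, fun k => ?_⟩
      obtain ⟨v, hv, hlt⟩ := hcon k
      refine ⟨v, hv, ?_⟩
      rw [map_sub, hρ, hs, hzx, hzn]
      simp only [map_mul, map_pow, map_add, map_sum, MvPolynomial.eval_C, MvPolynomial.eval_X] at hlt
      rw [← hA] at hlt
      have : MvPolynomial.eval x v * (2 / c' * A ^ N) = MvPolynomial.eval x v / t := by
        simp only [t]; field_simp
      rw [this, div_lt_one ht0] at hlt
      linarith
    have h1 := hN z hz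
    rw [hs, Fintype.sum_option, hzn] at h1
    have hzi : ∀ i, z (some i) = x i := fun i => rfl
    simp only [hzi] at h1
    have h2 : (1 + (t ^ 2 + ∑ i, x i ^ 2)) ^ N ≤ A ^ N := by
      gcongr
      rw [hA]; nlinarith
    have h3 : t * A ^ N = c' / 2 := by simp only [t]; field_simp
    have h4 : c' ≤ c := min_le_left _ _
    have := mul_le_mul_of_nonneg_left h2 ht0.le
    linarith

theorem tempered_poly {n : ℕ} (p : MvPolynomial (Fin n) ℝ) :
    Function.HasTemperateGrowth fun x : Fin n → ℝ => MvPolynomial.eval x p := by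
  induction p using MvPolynomial.induction_on with
  | C a => simp
  | add p q hp hq => simp only [map_add]; exact hp.add hq
  | mul_X p i hp =>
    have : Function.HasTemperateGrowth fun x : Fin n → ℝ => x i :=
      (ContinuousLinearMap.proj (R := ℝ) (φ := fun _ : Fin n => ℝ) i).hasTemperateGrowth
    simp only [map_mul, MvPolynomial.eval_X]; exact hp.mul this

theorem tempered_prod {E ι : Type*} [NormedAddCommGroup E] [NormedSpace ℝ E]
    {f : ι → E → ℝ} {s : Finset ι}
    (hf : ∀ i ∈ s, (f i).HasTemperateGrowth) : (fun x => ∏ i ∈ s, f i x).HasTemperateGrowth := by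
  classical
  induction s using Finset.induction_on with
  | empty => simp
  | insert a s has ih =>
    simp only [Finset.prod_insert has]
    exact (hf a (Finset.mem_insert_self _ _)).mul (ih fun i hi => hf i (Finset.mem_insert_of_mem hi))

open scoped ContDiff in
theorem tempered_transition : Function.HasTemperateGrowth Real.smoothTransition := by
  have hsm : ContDiff ℝ ∞ Real.smoothTransition := Real.smoothTransition.contDiff
  refine Function.HasTemperateGrowth.of_fderiv (k := 0) (C := 1) ?_
    (hsm.differentiable (by simp)) ?_
  · refine HasCompactSupport.hasTemperateGrowth ?_ (hsm.fderiv_right (by simp))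
    refine HasCompactSupport.of_support_subset_isCompact (isCompact_Icc (a := (0:ℝ)) (b := 1)) ?_
    intro x hx
    by_contra hn
    apply hx
    rw [Set.mem_Icc, not_and_or, not_le, not_le] at hn
    rcases hn with h | h
    · have : Real.smoothTransition =ᶠ[nhds x] fun _ => 0 := by
        filter_upwards [Iio_mem_nhds h] with y hy
        exact Real.smoothTransition.zero_of_nonpos (le_of_lt hy)
      rw [this.fderiv_eq]; simp
    · have : Real.smoothTransition =ᶠ[nhds x] fun _ => 1 := by
        filter_upwards [Ioi_mem_nhds h] with y hy
        exact Real.smoothTransition.one_of_one_le (le_of_lt hy)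
      rw [this.fderiv_eq]; simp
  · intro x
    simp only [pow_zero, mul_one, Real.norm_eq_abs]
    rw [abs_of_nonneg (Real.smoothTransition.nonneg x)]
    exact Real.smoothTransition.le_one x

/-- Tempered partition of unity, affine case: given a closed semialgebraic `X ⊆ ℝⁿ`
covered by open semialgebraic sets `W 1, …, W m`, there are tempered functions
`τ 1, …, τ m` summing to `1` on `X`, with the closure in `X` of `{x ∈ X | τ i x ≠ 0}`
contained in `W i`, and such that for every Schwartz `φ` and every `i` there is a
Schwartz `ψᵢ` flat on `ℝⁿ \ W i` with `ψᵢ = τ i · φ` on `X ∩ W i`. -/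
theorem stmt_2 {n m : ℕ} (X : Set (Fin n → ℝ))
    (hXcl : IsClosed X) (hXsa : IsSemialgebraic X)
    (W : Fin m → Set (Fin n → ℝ))
    (hWo : ∀ i, IsOpen (W i)) (hWsa : ∀ i, IsSemialgebraic (W i))
    (hcov : X ⊆ ⋃ i, W i) :
    ∃ τ : Fin m → (Fin n → ℝ) → ℝ,
      (∀ i, Function.HasTemperateGrowth (τ i)) ∧
      (∀ x ∈ X, ∑ i, τ i x = 1) ∧
      (∀ i, X ∩ closure {x | x ∈ X ∧ τ i x ≠ 0} ⊆ W i) ∧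
      (∀ φ : SchwartzMap ((Fin n) → ℝ) ℝ, ∀ i, ∃ ψ : SchwartzMap ((Fin n) → ℝ) ℝ,
        (∀ z ∈ (W i)ᶜ, SmoothFlatAt (⇑ψ) z) ∧
        ∀ x ∈ X ∩ W i, ψ x = τ i x * φ x) := by
  classical
  obtain ⟨M, π, V, hVW, hVX⟩ := basic_cover X W hWo hWsa hcov
  obtain ⟨h, hh, hcovh⟩ := shrink_cover X hXcl hXsa V hVX
  let η : Fin M → (Fin n → ℝ) → ℝ := fun k x =>
    ∏ v ∈ V k, Real.smoothTransition (MvPolynomial.eval x (2 * (v * h) - 1))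
  have hηt : ∀ k, (η k).HasTemperateGrowth := fun k =>
    tempered_prod fun v _ => tempered_transition.comp (tempered_poly _)
  let K : Fin M → Set (Fin n → ℝ) := fun k =>
    ⋂ v ∈ V k, {x | 0 ≤ MvPolynomial.eval x (2 * (v * h) - 1)}
  have hKcl : ∀ k, IsClosed (K k) := fun k => isClosed_biInter fun v _ =>
    isClosed_le continuous_const (MvPolynomial.continuous_eval _)
  have hKW : ∀ k, K k ⊆ W (π k) := by
    intro k x hx
    refine hVW k x fun v hv => ?_
    have h1 : 0 ≤ MvPolynomial.eval x (2 * (v * h) - 1) := Set.mem_iInter₂.1 hx v hv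
    simp only [map_sub, map_mul, map_one, map_ofNat] at h1
    exact pos_of_mul_pos_left (by linarith : 0 < MvPolynomial.eval x v * MvPolynomial.eval x h) (hh x).le
  have hηK : ∀ k x, x ∉ K k → η k x = 0 := by
    intro k x hx
    simp only [K, Set.mem_iInter, not_forall] at hx
    obtain ⟨v, hv, hlt⟩ := hx
    exact Finset.prod_eq_zero hv (Real.smoothTransition.zero_of_nonpos (le_of_lt (not_le.1 hlt)))
  have hη1 : ∀ x ∈ X, ∃ k, η k x = 1 := by
    intro x hx
    obtain ⟨k, hk⟩ := hcovh x hx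
    refine ⟨k, Finset.prod_eq_one fun v hv => Real.smoothTransition.one_of_one_le ?_⟩
    have := hk v hv
    simp only [map_sub, map_mul, map_one, map_ofNat] at this ⊢
    linarith
  let θ : Fin M → (Fin n → ℝ) → ℝ := fun k x =>
    η k x * ∏ j ∈ Finset.univ with j < k, (1 - η j x)
  have hθt : ∀ k, (θ k).HasTemperateGrowth := fun k =>
    (hηt k).mul (tempered_prod fun j _ => (Function.HasTemperateGrowth.const 1).sub (hηt j))
  let τ : Fin m → (Fin n → ℝ) → ℝ := fun i x => ∑ k ∈ Finset.univ with π k = i, θ k x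
  have hτt : ∀ i, (τ i).HasTemperateGrowth := fun i =>
    Function.HasTemperateGrowth.sum fun k _ => hθt k
  let L : Fin m → Set (Fin n → ℝ) := fun i => ⋃ k ∈ (Finset.univ.filter fun k => π k = i), K k
  have hLcl : ∀ i, IsClosed (L i) := fun i =>
    Set.Finite.isClosed_biUnion (Finset.finite_toSet _) fun k _ => hKcl k
  have hLW : ∀ i, L i ⊆ W i := by
    intro i x hx
    obtain ⟨k, hk, hxk⟩ := Set.mem_iUnion₂.1 hx
    rw [← (Finset.mem_filter.1 hk).2]
    exact hKW k hxk
  have hτL : ∀ i x, x ∉ L i → τ i x = 0 := by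
    intro i x hx
    refine Finset.sum_eq_zero fun k hk => ?_
    have : η k x = 0 := hηK k x fun hxk => hx (Set.mem_iUnion₂.2 ⟨k, hk, hxk⟩)
    simp only [θ, this, zero_mul]
  refine ⟨τ, hτt, fun x hx => ?_, fun i => ?_, fun φ i => ?_⟩
  · have h1 : ∑ i, τ i x = ∑ k, θ k x :=
      Finset.sum_fiberwise_of_maps_to (fun k _ => Finset.mem_univ (π k)) _
    have h2 := Finset.prod_one_sub_ordered Finset.univ (fun k => η k x)
    obtain ⟨k, hk⟩ := hη1 x hx
    rw [Finset.prod_eq_zero (Finset.mem_univ k) (by rw [hk, sub_self])] at h2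
    rw [h1]
    simp only [θ]
    linarith
  · refine Set.inter_subset_right.trans ((closure_minimal ?_ (hLcl i)).trans (hLW i))
    intro x hx
    by_contra hn
    exact hx.2 (hτL i x hn)
  · refine ⟨SchwartzMap.smulLeftCLM ℝ (τ i) φ, fun z hz k => ?_, fun x _ => ?_⟩
    · have hev : (SchwartzMap.smulLeftCLM ℝ (τ i) φ : (Fin n → ℝ) → ℝ) =ᶠ[nhds z] fun _ => 0 := by
        filter_upwards [(hLcl i).isOpen_compl.mem_nhds fun hzL => hz (hLW i hzL)] with x hx
        rw [SchwartzMap.smulLeftCLM_apply_apply (hτt i), hτL i x hx, zero_smul]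
      rw [(hev.iteratedFDeriv ℝ k).eq_of_nhds]
      exact congrFun iteratedFDeriv_fun_zero z
    · rw [SchwartzMap.smulLeftCLM_apply_apply (hτt i), smul_eq_mul]
end

section
/- (Cosheaf exactness for Schwartz functions, affine case.) Let X ⊆ ℝ^n be a closed semialgebraic set and W_1, W_2 ⊆ ℝ^n open semialgebraic sets with X ⊆ W_1 ∪ W_2. Suppose ψ_1, ψ_2 ∈ 𝓢(ℝ^n) satisfy: ψ_i is flat on ℝ^n \ W_i for i = 1, 2, and ψ_1(x) + ψ_2(x) = 0 for all x ∈ X. Then there exists χ ∈ 𝓢(ℝ^n) flat on ℝ^n \ (W_1 ∩ W_2) such that χ(x) = ψ_1(x) for all x ∈ X. -/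
namespace SchwartzGlue

open scoped ContDiff Convolution
open MeasureTheory

/-- Convolution of a function bounded by one: derivative bounds independent of the function. -/
lemma conv_bound {n : ℕ} (k : ℕ) : ∀ {F F' : Type} [NormedAddCommGroup F] [NormedSpace ℝ F]
    [NormedAddCommGroup F'] [NormedSpace ℝ F'] (L : ℝ →L[ℝ] F →L[ℝ] F')
    (g : (Fin n → ℝ) → F) (_ : HasCompactSupport g) (_ : ContDiff ℝ ∞ g),
    ∃ M : ℝ, 0 ≤ M ∧ ∀ f : (Fin n → ℝ) → ℝ, LocallyIntegrable f volume → (∀ x, ‖f x‖ ≤ 1) →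
      ∀ x, ‖iteratedFDeriv ℝ k (f ⋆[L, volume] g) x‖ ≤ M := by
  induction k with
  | zero =>
    intro F F' _ _ _ _ L g hc hg
    refine ⟨‖L‖ * ∫ y, ‖g y‖, by positivity, fun f hf h1 x => ?_⟩
    rw [norm_iteratedFDeriv_zero, convolution_def]
    have hint : Integrable (fun y => ‖g y‖) := (hg.continuous.integrable_of_hasCompactSupport hc).norm
    calc ‖∫ t, L (f t) (g (x - t))‖ ≤ ∫ t, ‖L‖ * ‖g (x - t)‖ := by
          refine norm_integral_le_of_norm_le ((hint.comp_sub_left x).const_mul _) (.of_forall fun t => ?_)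
          calc ‖L (f t) (g (x - t))‖ ≤ ‖L‖ * ‖f t‖ * ‖g (x - t)‖ := L.le_opNorm₂ _ _
            _ ≤ ‖L‖ * 1 * ‖g (x - t)‖ := by gcongr; exact h1 t
            _ = _ := by ring
      _ = _ := by
          rw [integral_const_mul, integral_sub_left_eq_self (fun y => ‖g y‖) volume x]
  | succ k ih =>
    intro F F' _ _ _ _ L g hc hg
    obtain ⟨M, hM, h⟩ := ih (L.precompR (Fin n → ℝ)) (fderiv ℝ g) (hc.fderiv ℝ)
      (hg.fderiv_right (by simp))
    refine ⟨M, hM, fun f hf h1 x => ?_⟩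
    have : fderiv ℝ (f ⋆[L, volume] g) = f ⋆[L.precompR (Fin n → ℝ), volume] fderiv ℝ g := by
      ext1 y
      exact (hc.hasFDerivAt_convolution_right L hf (hg.of_le (by simp)) y).fderiv
    rw [← norm_iteratedFDeriv_fderiv, this]
    exact h f hf h1 x

lemma unit_cutoff (n : ℕ) : ∃ M : ℕ → ℝ, (∀ k, 0 ≤ M k) ∧ ∀ B : Set (Fin n → ℝ), IsOpen B →
    ∃ v : (Fin n → ℝ) → ℝ, ContDiff ℝ ∞ v ∧ (∀ k y, ‖iteratedFDeriv ℝ k v y‖ ≤ M k) ∧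
      (∀ y, (∀ t, dist t y < 1 → t ∈ B) → v y = 0) ∧
      (∀ y, (∀ t, dist t y < 1 → t ∉ B) → v y = 1) := by
  let φ : ContDiffBump (0 : Fin n → ℝ) := ⟨1/2, 1, by norm_num, by norm_num⟩
  have hφs : ContDiff ℝ ∞ (φ.normed volume) := φ.contDiff_normed
  have hφc : HasCompactSupport (φ.normed volume) := φ.hasCompactSupport_normed
  choose M hM0 hM using fun k => conv_bound (n := n) k (ContinuousLinearMap.lsmul ℝ ℝ)
    (φ.normed volume) hφc hφs
  refine ⟨M, hM0, fun B hB => ?_⟩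
  let f : (Fin n → ℝ) → ℝ := Set.indicator Bᶜ (fun _ => 1)
  have hf : LocallyIntegrable f volume :=
    (locallyIntegrable_const 1).indicator hB.measurableSet.compl
  have hf1 : ∀ x, ‖f x‖ ≤ 1 := fun x => by
    by_cases h : x ∈ B <;> simp [f, h]
  have key : ∀ y c, (∀ t, dist t y < 1 → f t = c) →
      (f ⋆[ContinuousLinearMap.lsmul ℝ ℝ, volume] (φ.normed volume)) y = c := by
    intro y c h
    rw [convolution_def]
    have : ∀ t, (ContinuousLinearMap.lsmul ℝ ℝ (f t)) (φ.normed volume (y - t))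
        = c * φ.normed volume (y - t) := by
      intro t
      by_cases ht : dist t y < 1
      · simp [h t ht]
      · have : φ.normed volume (y - t) = 0 := by
          rw [← Function.notMem_support, φ.support_normed_eq]
          simp only [Metric.mem_ball, dist_zero_right]
          rw [← dist_eq_norm, dist_comm]; exact ht
        simp [this]
    simp_rw [this]
    rw [integral_const_mul, integral_sub_left_eq_self (fun y => φ.normed volume y) volume y,
      φ.integral_normed, mul_one]
  refine ⟨_, hφc.contDiff_convolution_right (ContinuousLinearMap.lsmul ℝ ℝ) hf hφs,
    fun k y => hM k f hf hf1 y, fun y h => key y 0 fun t ht => ?_, fun y h => key y 1 fun t ht => ?_⟩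
  · simp [f, h t ht]
  · simp [f, h t ht]

lemma cutoffs {n : ℕ} (C : Set (Fin n → ℝ)) : ∃ a : ℕ → (Fin n → ℝ) → ℝ,
    (∀ j, ContDiff ℝ ∞ (a j)) ∧
    (∀ k, ∃ M : ℝ, 0 ≤ M ∧ ∀ j x, ‖iteratedFDeriv ℝ k (a j) x‖ ≤ M * (2 ^ j) ^ k) ∧
    (∀ j, ∀ z ∈ C, a j =ᶠ[nhds z] 0) ∧
    (∀ j x, (∀ z ∈ C, (1/2) ^ j ≤ dist x z) → a j x = 1) := by
  obtain ⟨M, hM0, hM⟩ := unit_cutoff n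
  choose v hv hvM hv0 hv1 using fun j : ℕ => hM
    {y | (1/4 * (1/2 : ℝ) ^ j) • y ∈ Metric.thickening (1/2 * (1/2) ^ j) C}
    (Metric.isOpen_thickening.preimage (by fun_prop))
  have hsc : ∀ (j : ℕ) (x t : Fin n → ℝ), dist t ((4 * 2 ^ j : ℝ) • x) < 1 →
      dist ((1/4 * (1/2 : ℝ) ^ j) • t) x < 1/4 * (1/2) ^ j := by
    intro j x t h
    have hx : x = (1/4 * (1/2 : ℝ) ^ j) • ((4 * 2 ^ j : ℝ) • x) := by
      rw [smul_smul]
      have : (1/4 * (1/2 : ℝ) ^ j) * (4 * 2 ^ j) = 1 := by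
        rw [mul_mul_mul_comm, ← mul_pow]; norm_num
      rw [this, one_smul]
    have hp : 0 < (1/4 * (1/2 : ℝ) ^ j) := by positivity
    conv_lhs => rw [hx]
    rw [dist_smul₀, Real.norm_of_nonneg hp.le]
    nlinarith
  refine ⟨fun j x => v j ((4 * 2 ^ j : ℝ) • x), fun j => (hv j).comp (by fun_prop), fun k => ?_,
    fun j z hz => ?_, fun j x h => ?_⟩
  · refine ⟨M k * 4 ^ k, mul_nonneg (hM0 k) (by positivity), fun j x => ?_⟩
    rw [iteratedFDeriv_comp_const_smul _ ((hv j).of_le (by exact_mod_cast le_top))]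
    simp only [norm_smul]
    rw [Real.norm_of_nonneg (by positivity), mul_pow, mul_comm (M k), mul_right_comm]
    gcongr
    exact hvM j k _
  · filter_upwards [Metric.ball_mem_nhds z (show 0 < 1/4 * (1/2 : ℝ) ^ j by positivity)] with x hx
    apply hv0
    intro t ht
    rw [Set.mem_ofPred_eq, Metric.mem_thickening_iff]
    refine ⟨z, hz, ?_⟩
    have := hsc j x t ht
    have h3 := dist_triangle ((1/4 * (1/2 : ℝ) ^ j) • t) x z
    rw [Metric.mem_ball] at hx
    linarith
  · apply hv1
    intro t ht
    rw [Set.mem_ofPred_eq, Metric.mem_thickening_iff]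
    rintro ⟨z, hz, hlt⟩
    have := hsc j x t ht
    have h3 := dist_triangle x ((1/4 * (1/2 : ℝ) ^ j) • t) z
    rw [dist_comm x ((1/4 * (1/2 : ℝ) ^ j) • t)] at h3
    have := h z hz
    have hp : 0 < (1/2 : ℝ) ^ j := by positivity
    linarith

lemma flat_est {n : ℕ} (ψ : SchwartzMap (Fin n → ℝ) ℝ) (C : Set (Fin n → ℝ))
    (h : ∀ z ∈ C, ∀ k, iteratedFDeriv ℝ k ψ z = 0) (N : ℕ) : ∀ k p : ℕ, ∃ A : ℝ, 0 ≤ A ∧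
    ∀ z ∈ C, ∀ x, ‖x - z‖ ≤ 2 → (3 + ‖z‖) ^ p * ‖iteratedFDeriv ℝ k ψ x‖ ≤ A * ‖x - z‖ ^ N := by
  induction N with
  | zero =>
    intro k p
    refine ⟨5 ^ p * (2 ^ p * ((Finset.Iic (p, k)).sup fun m => SchwartzMap.seminorm ℝ m.1 m.2) ψ),
      by positivity, fun z hz x hx => ?_⟩
    have h1 := SchwartzMap.one_add_le_sup_seminorm_apply (𝕜 := ℝ) (m := (p, k)) le_rfl le_rfl ψ x
    have h2 : ‖z‖ ≤ ‖x‖ + 2 := by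
      have := norm_sub_norm_le z x
      rw [norm_sub_rev] at this; linarith
    calc (3 + ‖z‖) ^ p * ‖iteratedFDeriv ℝ k ψ x‖
        ≤ (5 * (1 + ‖x‖)) ^ p * ‖iteratedFDeriv ℝ k ψ x‖ := by
          gcongr; nlinarith [norm_nonneg x]
      _ = 5 ^ p * ((1 + ‖x‖) ^ p * ‖iteratedFDeriv ℝ k ψ x‖) := by rw [mul_pow]; ring
      _ ≤ _ := by rw [pow_zero, mul_one]; gcongr
  | succ N ih =>
    intro k p
    obtain ⟨A, hA, hb⟩ := ih (k + 1) p
    refine ⟨A, hA, fun z hz x hx => ?_⟩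
    have hp : 0 < (3 + ‖z‖) ^ p := by positivity
    have hd : ∀ y, DifferentiableAt ℝ (iteratedFDeriv ℝ k ψ) y := fun y =>
      (ψ.smooth ⊤).differentiable_iteratedFDeriv (by exact_mod_cast WithTop.coe_lt_top k) y
    have := (convex_closedBall z ‖x - z‖).norm_image_sub_le_of_norm_fderiv_le
      (f := iteratedFDeriv ℝ k ψ) (𝕜 := ℝ) (C := A * ‖x - z‖ ^ N / (3 + ‖z‖) ^ p)
      (fun y _ => hd y) (fun y hy => ?_) (x := z) (y := x) (by simp) (by simp [dist_eq_norm])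
    · rw [h z hz, sub_zero] at this
      calc _ ≤ (3 + ‖z‖) ^ p * (A * ‖x - z‖ ^ N / (3 + ‖z‖) ^ p * ‖x - z‖) := by gcongr
        _ = _ := by field_simp; ring
    · rw [norm_fderiv_iteratedFDeriv, le_div_iff₀ hp, mul_comm]
      rw [Metric.mem_closedBall, dist_eq_norm] at hy
      refine (hb z hz y (hy.trans hx)).trans ?_
      gcongr

lemma mul_bound {n : ℕ} {a b : ℕ → (Fin n → ℝ) → ℝ} (ha : ∀ j, ContDiff ℝ ∞ (a j))
    (hb : ∀ j, ContDiff ℝ ∞ (b j))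
    (hA : ∀ k, ∃ M : ℝ, 0 ≤ M ∧ ∀ j x, ‖iteratedFDeriv ℝ k (a j) x‖ ≤ M * (2 ^ j) ^ k)
    (hB : ∀ k, ∃ M : ℝ, 0 ≤ M ∧ ∀ j x, ‖iteratedFDeriv ℝ k (b j) x‖ ≤ M * (2 ^ j) ^ k) (k : ℕ) :
    ∃ M : ℝ, 0 ≤ M ∧ ∀ j x, ‖iteratedFDeriv ℝ k (fun y => a j y * b j y) x‖ ≤ M * (2 ^ j) ^ k := by
  choose A hA0 hA using hA
  choose B hB0 hB using hB
  refine ⟨∑ i ∈ Finset.range (k + 1), k.choose i * A i * B (k - i), Finset.sum_nonneg fun i _ =>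
    mul_nonneg (mul_nonneg (by positivity) (hA0 i)) (hB0 _), fun j x => ?_⟩
  refine (norm_iteratedFDeriv_mul_le (ha j) (hb j) x (n := k) (by exact_mod_cast le_top)).trans ?_
  rw [Finset.sum_mul]
  refine Finset.sum_le_sum fun i hi => ?_
  have hik : i + (k - i) = k := by have := Finset.mem_range.1 hi; omega
  calc _ ≤ (k.choose i : ℝ) * (A i * (2 ^ j) ^ i) * (B (k - i) * (2 ^ j) ^ (k - i)) := by
        have := hA0 i
        gcongr
        exacts [hA i j x, hB _ j x]
    _ = k.choose i * A i * B (k - i) * ((2 ^ j) ^ i * (2 ^ j) ^ (k - i)) := by ring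
    _ = _ := by rw [← pow_add, hik]

lemma diff_bound {n : ℕ} {a : ℕ → (Fin n → ℝ) → ℝ} (ha : ∀ j, ContDiff ℝ ∞ (a j))
    (hA : ∀ k, ∃ M : ℝ, 0 ≤ M ∧ ∀ j x, ‖iteratedFDeriv ℝ k (a j) x‖ ≤ M * (2 ^ j) ^ k) (k : ℕ) :
    ∃ M : ℝ, 0 ≤ M ∧ ∀ j x, ‖iteratedFDeriv ℝ k (fun y => a (j+1) y - a j y) x‖
      ≤ M * (2 ^ j) ^ k := by
  obtain ⟨M, hM, h⟩ := hA k
  refine ⟨M * 2 ^ k + M, by positivity, fun j x => ?_⟩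
  have e : (fun y => a (j+1) y - a j y) = a (j+1) - a j := rfl
  rw [e, iteratedFDeriv_sub_apply ((ha _).contDiffAt.of_le (by exact_mod_cast le_top))
    ((ha _).contDiffAt.of_le (by exact_mod_cast le_top))]
  refine (norm_sub_le _ _).trans ?_
  have h1 := h (j+1) x
  have h2 := h j x
  have e2 : ((2:ℝ) ^ (j+1)) ^ k = 2 ^ k * (2 ^ j) ^ k := by rw [← mul_pow, pow_succ']
  rw [e2] at h1
  linarith

/-- The series `∑ m_j ψ` defines a Schwartz function. -/
lemma series {n : ℕ} (ψ : SchwartzMap (Fin n → ℝ) ℝ) (C : Set (Fin n → ℝ))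
    (h : ∀ z ∈ C, ∀ k, iteratedFDeriv ℝ k ψ z = 0) (m : ℕ → (Fin n → ℝ) → ℝ)
    (hm : ∀ j, ContDiff ℝ ∞ (m j))
    (hM : ∀ k, ∃ M : ℝ, 0 ≤ M ∧ ∀ j x, ‖iteratedFDeriv ℝ k (m j) x‖ ≤ M * (2 ^ j) ^ k)
    (hsupp : ∀ j x, (∀ z ∈ C, (1/2) ^ j ≤ dist x z) → m j x = 0) :
    ∃ χ : SchwartzMap (Fin n → ℝ) ℝ, (∀ x, HasSum (fun j => m j x * ψ x) (χ x)) ∧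
      ∀ z, (∀ j, m j =ᶠ[nhds z] 0) → ∀ k, iteratedFDeriv ℝ k χ z = 0 := by
  have hψ : ContDiff ℝ ∞ ψ := ψ.smooth ⊤
  choose M hM0 hM using hM
  have hu : ∀ j, ContDiff ℝ ∞ (fun x => m j x * ψ x) := fun j => (hm j).mul hψ
  -- vanishing of derivatives far from `C`
  have hfar : ∀ j x, (∀ z ∈ C, 2 * (1/2) ^ j ≤ dist x z) → ∀ k,
      iteratedFDeriv ℝ k (fun x => m j x * ψ x) x = 0 := by
    intro j x hx k
    have : (fun x => m j x * ψ x) =ᶠ[nhds x] fun _ => 0 := by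
      filter_upwards [Metric.ball_mem_nhds x (show 0 < (1/2 : ℝ) ^ j by positivity)] with y hy
      rw [hsupp j y, zero_mul]
      intro z hz
      have := hx z hz
      have h3 := dist_triangle x y z
      rw [Metric.mem_ball, dist_comm] at hy
      linarith
    rw [(this.iteratedFDeriv ℝ k).eq_of_nhds]
    simp
  have bound : ∀ p k, ∃ A : ℝ, 0 ≤ A ∧ ∀ j x,
      ‖x‖ ^ p * ‖iteratedFDeriv ℝ k (fun x => m j x * ψ x) x‖ ≤ A * (1/2) ^ j := by
    intro p k
    choose A hA0 hA using fun i => flat_est ψ C h (k + 1) i p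
    refine ⟨∑ i ∈ Finset.range (k + 1), k.choose i * M i * A (k - i) * 2 ^ (k+1),
      Finset.sum_nonneg fun i _ =>
      mul_nonneg (mul_nonneg (mul_nonneg (by positivity) (hM0 i)) (hA0 _)) (by positivity),
      fun j x => ?_⟩
    by_cases hx : ∀ z ∈ C, 2 * (1/2) ^ j ≤ dist x z
    · rw [hfar j x hx, norm_zero, mul_zero]
      exact mul_nonneg (Finset.sum_nonneg fun i _ =>
        mul_nonneg (mul_nonneg (mul_nonneg (by positivity) (hM0 i)) (hA0 _)) (by positivity))
        (by positivity)
    push Not at hx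
    obtain ⟨z, hz, hlt⟩ := hx
    rw [dist_eq_norm] at hlt
    have hle1 : (1/2 : ℝ) ^ j ≤ 1 := pow_le_one₀ (by norm_num) (by norm_num)
    have h2 : ‖x - z‖ ≤ 2 := by linarith
    have hxz : ‖x‖ ≤ 3 + ‖z‖ := by
      have := norm_sub_norm_le x z
      linarith
    have hψb : ∀ i, ‖x‖ ^ p * ‖iteratedFDeriv ℝ i ψ x‖ ≤ A i * (2 * (1/2) ^ j) ^ (k + 1) := by
      intro i
      have := hA0 i
      calc _ ≤ (3 + ‖z‖) ^ p * ‖iteratedFDeriv ℝ i ψ x‖ := by gcongr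
        _ ≤ A i * ‖x - z‖ ^ (k + 1) := hA i z hz x h2
        _ ≤ _ := by gcongr
    calc _ ≤ ‖x‖ ^ p * ∑ i ∈ Finset.range (k + 1),
          (k.choose i : ℝ) * ‖iteratedFDeriv ℝ i (m j) x‖ * ‖iteratedFDeriv ℝ (k - i) ψ x‖ := by
          gcongr
          exact norm_iteratedFDeriv_mul_le (hm j) hψ x (n := k) (by exact_mod_cast le_top)
      _ ≤ _ := by
          rw [Finset.mul_sum, Finset.sum_mul]
          refine Finset.sum_le_sum fun i hi => ?_
          have hik : i ≤ k := by have := Finset.mem_range.1 hi; omega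
          have hMi := hM0 i
          have hAi := hA0 (k - i)
          have hpow : ((2:ℝ) ^ j) ^ i ≤ (2 ^ j) ^ k :=
            pow_le_pow_right₀ (one_le_pow₀ (by norm_num)) hik
          have e1 : ((2:ℝ) ^ j) ^ k * ((1/2) ^ j) ^ k = 1 := by
            rw [← mul_pow, ← mul_pow]; norm_num
          calc _ = (k.choose i : ℝ) * ‖iteratedFDeriv ℝ i (m j) x‖ *
                (‖x‖ ^ p * ‖iteratedFDeriv ℝ (k - i) ψ x‖) := by ring
            _ ≤ (k.choose i : ℝ) * (M i * (2 ^ j) ^ k) *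
                (A (k - i) * (2 * (1/2) ^ j) ^ (k + 1)) := by
                refine mul_le_mul ?_ (hψb _) (by positivity) (by positivity)
                gcongr
                exact (hM i j x).trans (by gcongr)
            _ = (k.choose i : ℝ) * M i * A (k - i) * 2 ^ (k+1) * (1/2) ^ j *
                (((2:ℝ) ^ j) ^ k * ((1/2) ^ j) ^ k) := by rw [mul_pow, pow_succ ((1/2 : ℝ)^j)]; ring
            _ = _ := by rw [e1, mul_one]
  choose A hA0 hA using bound
  have hs : ∀ p k, Summable fun j : ℕ => A p k * (1/2 : ℝ) ^ j := fun p k =>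
    (summable_geometric_of_lt_one (by norm_num) (by norm_num)).mul_left _
  have hA' : ∀ k j x, ‖iteratedFDeriv ℝ k (fun x => m j x * ψ x) x‖ ≤ A 0 k * (1/2) ^ j := by
    intro k j x
    simpa using hA 0 k j x
  have hder : ∀ k x, iteratedFDeriv ℝ k (fun x => ∑' j, m j x * ψ x) x
      = ∑' j, iteratedFDeriv ℝ k (fun x => m j x * ψ x) x := fun k x =>
    iteratedFDeriv_tsum_apply (N := ⊤) hu (fun k _ => hs 0 k) (fun k j x _ => hA' k j x) le_top x
  let χ : SchwartzMap (Fin n → ℝ) ℝ :=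
    { toFun := fun x => ∑' j, m j x * ψ x
      smooth' := contDiff_tsum (N := ⊤) hu (fun k _ => hs 0 k) (fun k j x _ => hA' k j x)
      decay' := fun p k => by
        refine ⟨∑' j : ℕ, A p k * (1/2 : ℝ) ^ j, fun x => ?_⟩
        have hsn : Summable fun j => ‖iteratedFDeriv ℝ k (fun x => m j x * ψ x) x‖ :=
          Summable.of_nonneg_of_le (fun _ => norm_nonneg _) (fun j => hA' k j x) (hs 0 k)
        rw [hder]
        calc _ ≤ ‖x‖ ^ p * ∑' j, ‖iteratedFDeriv ℝ k (fun x => m j x * ψ x) x‖ := by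
              gcongr; exact norm_tsum_le_tsum_norm hsn
          _ = ∑' j, ‖x‖ ^ p * ‖iteratedFDeriv ℝ k (fun x => m j x * ψ x) x‖ := tsum_mul_left.symm
          _ ≤ _ := (hsn.mul_left _).tsum_le_tsum (fun j => hA p k j x) (hs p k) }
  refine ⟨χ, fun x => ?_, fun z hz k => ?_⟩
  · refine (Summable.of_norm_bounded (hs 0 0) fun j => ?_).hasSum
    simpa using hA' 0 j x
  · change iteratedFDeriv ℝ k (fun x => ∑' j, m j x * ψ x) z = 0
    rw [hder]
    convert tsum_zero with j
    have : (fun x => m j x * ψ x) =ᶠ[nhds z] fun _ => 0 := by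
      filter_upwards [hz j] with y hy
      simp [hy]
    rw [(this.iteratedFDeriv ℝ k).eq_of_nhds]
    simp

lemma shift_bound {n : ℕ} {a : ℕ → (Fin n → ℝ) → ℝ}
    (hA : ∀ k, ∃ M : ℝ, 0 ≤ M ∧ ∀ j x, ‖iteratedFDeriv ℝ k (a j) x‖ ≤ M * (2 ^ j) ^ k) (k : ℕ) :
    ∃ M : ℝ, 0 ≤ M ∧ ∀ j x, ‖iteratedFDeriv ℝ k (a (j+1)) x‖ ≤ M * (2 ^ j) ^ k := by
  obtain ⟨M, hM, h⟩ := hA k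
  refine ⟨M * 2 ^ k, by positivity, fun j x => ?_⟩
  have h1 := h (j+1) x
  have e2 : ((2:ℝ) ^ (j+1)) ^ k = 2 ^ k * (2 ^ j) ^ k := by rw [← mul_pow, pow_succ']
  rw [e2] at h1
  linarith

lemma eventually_one {n : ℕ} {C : Set (Fin n → ℝ)} (hC : IsClosed C)
    {a : ℕ → (Fin n → ℝ) → ℝ} (h : ∀ j x, (∀ z ∈ C, (1/2) ^ j ≤ dist x z) → a j x = 1)
    {x : Fin n → ℝ} (hx : x ∉ C) : ∀ᶠ j in Filter.atTop, a j x = 1 := by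
  obtain ⟨ε, hε, hb⟩ := Metric.isOpen_iff.1 hC.isOpen_compl x hx
  have ht : Filter.Tendsto (fun j : ℕ => (1/2 : ℝ) ^ j) Filter.atTop (nhds 0) :=
    tendsto_pow_atTop_nhds_zero_of_lt_one (by norm_num) (by norm_num)
  filter_upwards [ht.eventually_lt_const hε] with j hj
  apply h
  intro z hz
  by_contra hlt
  refine hb (a := z) ?_ hz
  rw [Metric.mem_ball, dist_comm]
  linarith

lemma main_aux {n : ℕ} (X C D : Set (Fin n → ℝ)) (hC : IsClosed C) (hD : IsClosed D)
    (ψ₁ ψ₂ : SchwartzMap (Fin n → ℝ) ℝ)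
    (h₁ : ∀ z ∈ C, ∀ k, iteratedFDeriv ℝ k ψ₁ z = 0)
    (h₂ : ∀ z ∈ D, ∀ k, iteratedFDeriv ℝ k ψ₂ z = 0)
    (hsum : ∀ x ∈ X, ψ₁ x + ψ₂ x = 0) :
    ∃ χ : SchwartzMap (Fin n → ℝ) ℝ,
      (∀ z ∈ C ∪ D, ∀ k, iteratedFDeriv ℝ k χ z = 0) ∧ ∀ x ∈ X, χ x = ψ₁ x := by
  obtain ⟨a, ha, haM, ha0, ha1⟩ := cutoffs C
  obtain ⟨b, hb, hbM, hb0, hb1⟩ := cutoffs D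
  have hhalf : ∀ j : ℕ, (1/2 : ℝ) ^ (j+1) ≤ (1/2) ^ j := fun j =>
    pow_le_pow_of_le_one (by norm_num) (by norm_num) (Nat.le_succ j)
  obtain ⟨S₁, hS₁, hf₁⟩ := series ψ₁ C h₁ (fun j x => (a (j+1) x - a j x) * b j x)
    (fun j => ((ha _).sub (ha _)).mul (hb _))
    (mul_bound (a := fun j x => a (j+1) x - a j x) (fun j => (ha _).sub (ha _)) hb
      (diff_bound ha haM) hbM)
    (fun j x hx => by
      rw [ha1 j x hx, ha1 (j+1) x fun z hz => (hhalf j).trans (hx z hz)]; simp)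
  obtain ⟨S₂, hS₂, hf₂⟩ := series ψ₂ D h₂ (fun j x => (b (j+1) x - b j x) * a (j+1) x)
    (fun j => ((hb _).sub (hb _)).mul (ha _))
    (mul_bound (a := fun j x => b (j+1) x - b j x) (b := fun j => a (j+1))
      (fun j => (hb _).sub (hb _)) (fun j => ha _)
      (diff_bound hb hbM) (shift_bound haM))
    (fun j x hx => by
      rw [hb1 j x hx, hb1 (j+1) x fun z hz => (hhalf j).trans (hx z hz)]; simp)
  have hg : (fun x => a 0 x * b 0 x).HasTemperateGrowth := by
    refine ⟨(ha 0).mul (hb 0), fun k => ?_⟩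
    obtain ⟨M, hM, h⟩ := mul_bound ha hb haM hbM k
    refine ⟨0, M, fun x => ?_⟩
    simpa using h 0 x
  let S₀ : SchwartzMap (Fin n → ℝ) ℝ := SchwartzMap.smulLeftCLM ℝ (fun x => a 0 x * b 0 x) ψ₁
  have hS₀ : ∀ x, S₀ x = a 0 x * b 0 x * ψ₁ x := fun x => by
    simp only [S₀, SchwartzMap.smulLeftCLM_apply_apply hg, smul_eq_mul]
  have flat : ∀ z ∈ C ∪ D, ∀ k, iteratedFDeriv ℝ k (S₀ + S₁ - S₂ : SchwartzMap _ ℝ) z = 0 := by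
    intro z hz k
    have e1 : iteratedFDeriv ℝ k S₁ z = 0 := by
      refine hf₁ z (fun j => ?_) k
      rcases hz with hz | hz
      · filter_upwards [ha0 j z hz, ha0 (j+1) z hz] with y h1 h2
        simp [h1, h2]
      · filter_upwards [hb0 j z hz] with y h1
        simp [h1]
    have e2 : iteratedFDeriv ℝ k S₂ z = 0 := by
      refine hf₂ z (fun j => ?_) k
      rcases hz with hz | hz
      · filter_upwards [ha0 (j+1) z hz] with y h1
        simp [h1]
      · filter_upwards [hb0 j z hz, hb0 (j+1) z hz] with y h1 h2
        simp [h1, h2]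
    have e0 : iteratedFDeriv ℝ k S₀ z = 0 := by
      have : S₀ =ᶠ[nhds z] fun _ => (0 : ℝ) := by
        rcases hz with hz | hz
        · filter_upwards [ha0 0 z hz] with y h1
          simp [hS₀, h1]
        · filter_upwards [hb0 0 z hz] with y h1
          simp [hS₀, h1]
      rw [(this.iteratedFDeriv ℝ k).eq_of_nhds]
      simp
    have c : ∀ S : SchwartzMap (Fin n → ℝ) ℝ, ContDiffAt ℝ k S z := fun S =>
      ((S.smooth ⊤).of_le (by exact_mod_cast le_top)).contDiffAt
    have e : ((S₀ + S₁ - S₂ : SchwartzMap _ ℝ) : (Fin n → ℝ) → ℝ) = (⇑S₀ + ⇑S₁) - ⇑S₂ := rfl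
    rw [e, iteratedFDeriv_sub_apply (f := ⇑S₀ + ⇑S₁) ((c S₀).add (c S₁)) (c S₂),
      iteratedFDeriv_add_apply (c S₀) (c S₁), e0, e1, e2]
    simp
  refine ⟨S₀ + S₁ - S₂, flat, fun x hx => ?_⟩
  have hψ : ψ₂ x = - ψ₁ x := by linarith [hsum x hx]
  by_cases hmem : x ∈ C ∪ D
  · have h0 : (S₀ + S₁ - S₂ : SchwartzMap _ ℝ) x = 0 := by
      have := congrArg norm (flat x hmem 0)
      rw [norm_iteratedFDeriv_zero, norm_zero, norm_eq_zero] at this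
      exact this
    rw [h0]
    rcases hmem with h | h
    · have := congrArg norm (h₁ x h 0)
      rw [norm_iteratedFDeriv_zero, norm_zero, norm_eq_zero] at this
      exact this.symm
    · have := congrArg norm (h₂ x h 0)
      rw [norm_iteratedFDeriv_zero, norm_zero, norm_eq_zero] at this
      linarith
  · have hxC : x ∉ C := fun h => hmem (Or.inl h)
    have hxD : x ∉ D := fun h => hmem (Or.inr h)
    have t := ((hS₁ x).sub (hS₂ x)).tendsto_sum_nat
    have hpart : ∀ N, ∑ j ∈ Finset.range N, ((a (j+1) x - a j x) * b j x * ψ₁ x -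
        (b (j+1) x - b j x) * a (j+1) x * ψ₂ x) = (a N x * b N x - a 0 x * b 0 x) * ψ₁ x := by
      intro N
      induction N with
      | zero => simp
      | succ N ih => rw [Finset.sum_range_succ, ih, hψ]; ring
    simp only [hpart] at t
    have t' : Filter.Tendsto (fun N => (a N x * b N x - a 0 x * b 0 x) * ψ₁ x) Filter.atTop
        (nhds ((1 - a 0 x * b 0 x) * ψ₁ x)) := by
      refine tendsto_const_nhds.congr' ?_
      filter_upwards [eventually_one hC ha1 hxC, eventually_one hD hb1 hxD] with j h1 h2
      rw [h1, h2, mul_one]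
    have := tendsto_nhds_unique t t'
    change S₀ x + S₁ x - S₂ x = ψ₁ x
    rw [hS₀]
    linarith


end SchwartzGlue

/-- Cosheaf exactness for Schwartz functions, affine case: if `ψ₁, ψ₂` are Schwartz,
`ψᵢ` is flat on `ℝⁿ \ Wᵢ`, and `ψ₁ + ψ₂ = 0` on `X`, then there is a Schwartz `χ`
flat on `ℝⁿ \ (W₁ ∩ W₂)` with `χ = ψ₁` on `X`. -/
theorem stmt_4 {n : ℕ} (X : Set (Fin n → ℝ))
    (hXcl : IsClosed X) (hXsa : IsSemialgebraic X)
    (W₁ W₂ : Set (Fin n → ℝ))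
    (hW₁o : IsOpen W₁) (hW₁sa : IsSemialgebraic W₁)
    (hW₂o : IsOpen W₂) (hW₂sa : IsSemialgebraic W₂)
    (hcov : X ⊆ W₁ ∪ W₂)
    (ψ₁ ψ₂ : SchwartzMap ((Fin n) → ℝ) ℝ)
    (h₁ : ∀ z ∈ W₁ᶜ, SmoothFlatAt (⇑ψ₁) z)
    (h₂ : ∀ z ∈ W₂ᶜ, SmoothFlatAt (⇑ψ₂) z)
    (hsum : ∀ x ∈ X, ψ₁ x + ψ₂ x = 0) :
    ∃ χ : SchwartzMap ((Fin n) → ℝ) ℝ,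
      (∀ z ∈ (W₁ ∩ W₂)ᶜ, SmoothFlatAt (⇑χ) z) ∧ ∀ x ∈ X, χ x = ψ₁ x := by
  obtain ⟨χ, hχ, hX⟩ := SchwartzGlue.main_aux X W₁ᶜ W₂ᶜ hW₁o.isClosed_compl hW₂o.isClosed_compl ψ₁ ψ₂
    h₁ h₂ hsum
  refine ⟨χ, fun z hz => hχ z ?_, hX⟩
  rwa [Set.compl_inter] at hz
end

section
/- (Cosheaf surjectivity for Schwartz functions, affine case.) Let X ⊆ ℝ^n be a closed semialgebraic set and W_1, …, W_m ⊆ ℝ^n open semialgebraic sets with X ⊆ W_1 ∪ … ∪ W_m. Then for every φ ∈ 𝓢(ℝ^n) there exist ψ_1, …, ψ_m ∈ 𝓢(ℝ^n) such that each ψ_i is flat on ℝ^n \ W_i and ψ_1(x) + … + ψ_m(x) = φ(x) for all x ∈ X. -/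
namespace CosheafAux
open Polynomial Filter Topology

lemma exists_move_up {a u v b : ℝ} (hau : a < u) (huv : u ≤ v) (hvb : v < b) :
    ∃ μ : ℝ ≃o ℝ, μ u = v ∧ ∀ x, x ∉ Set.Ioo a b → μ x = x := by
  set k1 : ℝ := (v - a) / (u - a) with hk1
  set k2 : ℝ := (b - v) / (b - u) with hk2
  have h1 : 1 ≤ k1 := by rw [hk1, one_le_div (by linarith)]; linarith
  have h2 : k2 ≤ 1 := by rw [hk2, div_le_one (by linarith)]; linarith
  have h2' : 0 < k2 := div_pos (by linarith) (by linarith)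
  have e1 : k1 * (u - a) = v - a := by rw [hk1]; field_simp [(by linarith : u - a ≠ 0)]
  have e2 : k2 * (b - u) = b - v := by
    rw [hk2]; field_simp [(by linarith : b - u ≠ 0)]
  let f : ℝ → ℝ := fun x => max x (min (a + k1 * (x - a)) (b - k2 * (b - x)))
  have hmono : StrictMono f := by
    intro x y hxy
    simp only [f]
    have hh1 : a + k1 * (x - a) < a + k1 * (y - a) := by nlinarith
    have hh2 : b - k2 * (b - x) < b - k2 * (b - y) := by nlinarith
    exact max_lt_max hxy (min_lt_min hh1 hh2)
  have hle : ∀ x, x ≤ f x := fun x => le_max_left _ _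
  have hout : ∀ x, x ∉ Set.Ioo a b → f x = x := by
    intro x hx
    apply max_eq_left
    by_cases hxa : x ≤ a
    · exact (min_le_left _ _).trans (by nlinarith)
    · have : b ≤ x := by
        by_contra h
        exact hx ⟨not_le.mp hxa, not_le.mp h⟩
      exact (min_le_right _ _).trans (by nlinarith)
  have hcont : Continuous f := by fun_prop
  have hsurj : Function.Surjective f := by
    apply hcont.surjective
    · exact tendsto_atTop_mono hle tendsto_id
    · refine tendsto_id.congr' ?_
      filter_upwards [eventually_le_atBot a] with x hx
      exact (hout x (fun h => absurd h.1 (not_lt.mpr hx))).symm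
  refine ⟨hmono.orderIsoOfSurjective f hsurj, ?_, ?_⟩
  · simp only [StrictMono.coe_orderIsoOfSurjective, f]
    rw [e1, e2]; simp [huv]
  · intro x hx
    simpa using hout x hx

lemma exists_move {a u v b : ℝ} (hau : a < u) (hub : u < b) (hav : a < v) (hvb : v < b) :
    ∃ μ : ℝ ≃o ℝ, μ u = v ∧ ∀ x, x ∉ Set.Ioo a b → μ x = x := by
  rcases le_total u v with h | h
  · exact exists_move_up hau h hvb
  · obtain ⟨μ, h1, h2⟩ := exists_move_up hav h hub
    refine ⟨μ.symm, by rw [← h1]; simp, fun x hx => ?_⟩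
    have := h2 x hx
    conv_lhs => rw [← this]
    simp

lemma sign_eventually_eq {P : ℝ[X]} {l : Filter ℝ}
    (h : Asymptotics.IsEquivalent l (fun x => P.eval x) (fun x => P.leadingCoeff * x ^ P.natDegree)) :
    ∀ᶠ x in l, SignType.sign (P.eval x) = SignType.sign P.leadingCoeff * SignType.sign x ^ P.natDegree := by
  obtain ⟨φ, hφ, he⟩ := h.exists_eq_mul
  filter_upwards [he, hφ.eventually (lt_mem_nhds (show (0:ℝ) < 1 by norm_num))] with x hx h0
  rw [hx]
  simp [sign_mul, sign_pos h0, sign_pow]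

lemma ends_top {P Q : ℝ[X]} (θ : ℝ ≃o ℝ) (hd : P.natDegree = Q.natDegree)
    (hl : SignType.sign P.leadingCoeff = SignType.sign Q.leadingCoeff) :
    ∀ᶠ x in atTop, SignType.sign (P.eval x) = SignType.sign (Q.eval (θ x)) := by
  have h1 := sign_eventually_eq (P.isEquivalent_atTop_lead)
  have h2 := θ.tendsto_atTop.eventually (sign_eventually_eq (Q.isEquivalent_atTop_lead))
  have h3 := θ.tendsto_atTop.eventually (eventually_gt_atTop (0:ℝ))
  filter_upwards [h1, h2, h3, eventually_gt_atTop (0:ℝ)] with x a b c d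
  rw [a, b, sign_pos c, sign_pos d, hd, hl]

lemma ends_bot {P Q : ℝ[X]} (θ : ℝ ≃o ℝ) (hd : P.natDegree = Q.natDegree)
    (hl : SignType.sign P.leadingCoeff = SignType.sign Q.leadingCoeff) :
    ∀ᶠ x in atBot, SignType.sign (P.eval x) = SignType.sign (Q.eval (θ x)) := by
  have h1 := sign_eventually_eq (P.isEquivalent_atBot_lead)
  have h2 := θ.tendsto_atBot.eventually (sign_eventually_eq (Q.isEquivalent_atBot_lead))
  have h3 := θ.tendsto_atBot.eventually (eventually_lt_atBot (0:ℝ))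
  filter_upwards [h1, h2, h3, eventually_lt_atBot (0:ℝ)] with x a b c d
  rw [a, b, sign_neg c, sign_neg d, hd, hl]

lemma gap {Z : Set ℝ} (hZ : Z.Finite) {P Q : ℝ[X]} (θ : ℝ ≃o ℝ) (hd : P.natDegree = Q.natDegree)
    (hl : SignType.sign P.leadingCoeff = SignType.sign Q.leadingCoeff)
    (hPZ : ∀ x ∈ Z, SignType.sign (P.eval x) = SignType.sign (Q.eval (θ x)))
    {x : ℝ} (hx : x ∉ Z) :
    ∃ a b, a < x ∧ x < b ∧ (∀ y ∈ Set.Ioo a b, y ∉ Z) ∧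
      SignType.sign (P.eval a) = SignType.sign (Q.eval (θ a)) ∧
      SignType.sign (P.eval b) = SignType.sign (Q.eval (θ b)) := by
  have hb : ∃ b, x < b ∧ (∀ y ∈ Set.Ico x b, y ∉ Z) ∧
      SignType.sign (P.eval b) = SignType.sign (Q.eval (θ b)) := by
    by_cases hne : (Z ∩ Set.Ioi x).Nonempty
    · obtain ⟨b, hb, hmin⟩ := Set.exists_min_image _ id (hZ.inter_of_left (Set.Ioi x)) hne
      refine ⟨b, hb.2, fun y hy hyZ => ?_, hPZ b hb.1⟩
      have hxy : x < y := lt_of_le_of_ne hy.1 (by rintro rfl; exact hx hyZ)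
      exact absurd (hmin y ⟨hyZ, hxy⟩) (not_le.mpr hy.2)
    · obtain ⟨b, h1, h2⟩ := ((ends_top θ hd hl).and (eventually_gt_atTop x)).exists
      refine ⟨b, h2, fun y hy hyZ => ?_, h1⟩
      have hxy : x < y := lt_of_le_of_ne hy.1 (by rintro rfl; exact hx hyZ)
      exact hne ⟨y, hyZ, hxy⟩
  have ha : ∃ a, a < x ∧ (∀ y ∈ Set.Ioc a x, y ∉ Z) ∧
      SignType.sign (P.eval a) = SignType.sign (Q.eval (θ a)) := by
    by_cases hne : (Z ∩ Set.Iio x).Nonempty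
    · obtain ⟨b, hb, hmin⟩ := Set.exists_max_image _ id (hZ.inter_of_left (Set.Iio x)) hne
      refine ⟨b, hb.2, fun y hy hyZ => ?_, hPZ b hb.1⟩
      have hxy : y < x := lt_of_le_of_ne hy.2 (by rintro rfl; exact hx hyZ)
      exact absurd (hmin y ⟨hyZ, hxy⟩) (not_le.mpr hy.1)
    · obtain ⟨b, h1, h2⟩ := ((ends_bot θ hd hl).and (eventually_lt_atBot x)).exists
      refine ⟨b, h2, fun y hy hyZ => ?_, h1⟩
      have hxy : y < x := lt_of_le_of_ne hy.2 (by rintro rfl; exact hx hyZ)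
      exact hne ⟨y, hyZ, hxy⟩
  obtain ⟨b, hb1, hb2, hb3⟩ := hb
  obtain ⟨a, ha1, ha2, ha3⟩ := ha
  refine ⟨a, b, ha1, hb1, fun y hy => ?_, ha3, hb3⟩
  rcases le_total x y with h | h
  · exact hb2 y ⟨h, hy.2⟩
  · exact ha2 y ⟨hy.1, h⟩

/-- a polynomial without roots in an open interval has constant sign there -/
lemma sign_const {f : ℝ[X]} {a b : ℝ} (h : ∀ y ∈ Set.Ioo a b, f.eval y ≠ 0) {x y : ℝ}
    (hx : x ∈ Set.Ioo a b) (hy : y ∈ Set.Ioo a b) :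
    SignType.sign (f.eval x) = SignType.sign (f.eval y) := by
  have key : ∀ x y, x ∈ Set.Ioo a b → y ∈ Set.Ioo a b → 0 < f.eval x → 0 < f.eval y := by
    intro x y hx hy hpos
    by_contra hneg
    have hc : IsPreconnected (Set.Ioo a b) := isPreconnected_Ioo
    obtain ⟨z, hz, hz0⟩ := hc.intermediate_value hy hx (f := fun x => f.eval x)
      f.continuous.continuousOn ⟨not_lt.mp hneg, hpos.le⟩
    exact h z hz hz0
  rcases lt_or_gt_of_ne (h x hx) with h1 | h1
  · have : f.eval y < 0 := by
      rcases lt_or_gt_of_ne (h y hy) with h2 | h2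
      · exact h2
      · exact absurd (key y x hy hx h2) (not_lt.mpr h1.le)
    rw [sign_neg h1, sign_neg this]
  · rw [sign_pos h1, sign_pos (key x y hx hy h1)]


lemma strictMonoOn_of_derivative_pos {P : ℝ[X]} {a b : ℝ}
    (h : ∀ y ∈ Set.Ioo a b, 0 < P.derivative.eval y) :
    StrictMonoOn (fun x => P.eval x) (Set.Icc a b) := by
  apply strictMonoOn_of_deriv_pos (convex_Icc a b) P.continuous.continuousOn
  intro x hx
  rw [interior_Icc] at hx
  simpa using h x hx

lemma interval_pos {P Q : ℝ[X]} {a b : ℝ} (θ : ℝ ≃o ℝ) (hab : a < b)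
    (hP : ∀ y ∈ Set.Ioo a b, 0 < P.derivative.eval y)
    (hQ : ∀ y ∈ Set.Ioo a b, 0 < Q.derivative.eval (θ y))
    (ha : SignType.sign (P.eval a) = SignType.sign (Q.eval (θ a)))
    (hb : SignType.sign (P.eval b) = SignType.sign (Q.eval (θ b))) :
    (∀ r ∈ Set.Ioo a b, P.eval r = 0 → (∀ x ∈ Set.Ioo a b, P.eval x = 0 → x = r) ∧
      ∃ r' ∈ Set.Ioo (θ a) (θ b), Q.eval r' = 0) ∧
    ((∀ x ∈ Set.Ioo a b, P.eval x = 0 → Q.eval (θ x) = 0) →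
      ∀ x ∈ Set.Ioo a b, SignType.sign (P.eval x) = SignType.sign (Q.eval (θ x))) := by
  have hQ1 : ∀ y ∈ Set.Ioo (θ a) (θ b), 0 < Q.derivative.eval y := by
    intro y hy
    have := hQ (θ.symm y) ⟨by rw [θ.lt_symm_apply]; exact hy.1, by rw [θ.symm_apply_lt]; exact hy.2⟩
    simpa using this
  have mP := strictMonoOn_of_derivative_pos hP
  have mQ := strictMonoOn_of_derivative_pos hQ1
  have hθab : θ a < θ b := θ.strictMono hab
  have la : a ∈ Set.Icc a b := Set.left_mem_Icc.mpr hab.le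
  have lb : b ∈ Set.Icc a b := Set.right_mem_Icc.mpr hab.le
  have la' : θ a ∈ Set.Icc (θ a) (θ b) := Set.left_mem_Icc.mpr hθab.le
  have lb' : θ b ∈ Set.Icc (θ a) (θ b) := Set.right_mem_Icc.mpr hθab.le
  have hmem : ∀ {x}, x ∈ Set.Ioo a b → θ x ∈ Set.Ioo (θ a) (θ b) := fun hx =>
    ⟨θ.strictMono hx.1, θ.strictMono hx.2⟩
  constructor
  · intro r hr hr0
    refine ⟨fun x hx hx0 => mP.injOn (Set.Ioo_subset_Icc_self hx) (Set.Ioo_subset_Icc_self hr)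
      (by simp [hx0, hr0]), ?_⟩
    have h1 : P.eval a < 0 := by
      have := mP la (Set.Ioo_subset_Icc_self hr) hr.1
      simpa [hr0] using this
    have h2 : 0 < P.eval b := by
      have := mP (Set.Ioo_subset_Icc_self hr) lb hr.2
      simpa [hr0] using this
    rw [sign_neg h1] at ha
    rw [sign_pos h2] at hb
    have h3 : Q.eval (θ a) < 0 := sign_eq_neg_one_iff.mp ha.symm
    have h4 : 0 < Q.eval (θ b) := sign_eq_one_iff.mp hb.symm
    obtain ⟨r', hr', h0⟩ := intermediate_value_Ioo hθab.le (f := fun x => Q.eval x)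
      Q.continuous.continuousOn ⟨h3, h4⟩
    exact ⟨r', hr', h0⟩
  · intro hroot x hx
    by_cases hPa : 0 ≤ P.eval a
    · have h1 : 0 < P.eval x := lt_of_le_of_lt hPa (mP la (Set.Ioo_subset_Icc_self hx) hx.1)
      have hQa : 0 ≤ Q.eval (θ a) := by
        rw [← sign_nonneg_iff] at hPa ⊢; rwa [← ha]
      have h2 : 0 < Q.eval (θ x) :=
        lt_of_le_of_lt hQa (mQ la' (Set.Ioo_subset_Icc_self (hmem hx)) (hmem hx).1)
      rw [sign_pos h1, sign_pos h2]
    by_cases hPb : P.eval b ≤ 0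
    · have h1 : P.eval x < 0 := lt_of_lt_of_le (mP (Set.Ioo_subset_Icc_self hx) lb hx.2) hPb
      have hQb : Q.eval (θ b) ≤ 0 := by
        rw [← sign_nonpos_iff] at hPb ⊢; rwa [← hb]
      have h2 : Q.eval (θ x) < 0 :=
        lt_of_lt_of_le (mQ (Set.Ioo_subset_Icc_self (hmem hx)) lb' (hmem hx).2) hQb
      rw [sign_neg h1, sign_neg h2]
    · obtain ⟨r, hr, h0⟩ := intermediate_value_Ioo hab.le (f := fun x => P.eval x)
        P.continuous.continuousOn ⟨not_le.mp hPa, not_le.mp hPb⟩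
      simp only at h0
      have h0' := hroot r hr h0
      rcases lt_trichotomy x r with h | h | h
      · have h1 := mP (Set.Ioo_subset_Icc_self hx) (Set.Ioo_subset_Icc_self hr) h
        have h2 := mQ (Set.Ioo_subset_Icc_self (hmem hx)) (Set.Ioo_subset_Icc_self (hmem hr))
          (θ.strictMono h)
        simp only [h0, h0'] at h1 h2
        rw [sign_neg h1, sign_neg h2]
      · rw [h, h0, h0']
      · have h1 := mP (Set.Ioo_subset_Icc_self hr) (Set.Ioo_subset_Icc_self hx) h
        have h2 := mQ (Set.Ioo_subset_Icc_self (hmem hr)) (Set.Ioo_subset_Icc_self (hmem hx))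
          (θ.strictMono h)
        simp only [h0, h0'] at h1 h2
        rw [sign_pos h1, sign_pos h2]

lemma interval_gen {P Q : ℝ[X]} {a b : ℝ} (θ : ℝ ≃o ℝ) (hab : a < b)
    (hP : ∀ y ∈ Set.Ioo a b, P.derivative.eval y ≠ 0)
    (hPQ : ∀ y ∈ Set.Ioo a b, SignType.sign (P.derivative.eval y) =
      SignType.sign (Q.derivative.eval (θ y)))
    (ha : SignType.sign (P.eval a) = SignType.sign (Q.eval (θ a)))
    (hb : SignType.sign (P.eval b) = SignType.sign (Q.eval (θ b))) :
    (∀ r ∈ Set.Ioo a b, P.eval r = 0 → (∀ x ∈ Set.Ioo a b, P.eval x = 0 → x = r) ∧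
      ∃ r' ∈ Set.Ioo (θ a) (θ b), Q.eval r' = 0) ∧
    ((∀ x ∈ Set.Ioo a b, P.eval x = 0 → Q.eval (θ x) = 0) →
      ∀ x ∈ Set.Ioo a b, SignType.sign (P.eval x) = SignType.sign (Q.eval (θ x))) := by
  obtain ⟨c, hc⟩ : ∃ c, c ∈ Set.Ioo a b := Set.nonempty_Ioo.mpr hab
  rcases lt_or_gt_of_ne (hP c hc) with h | h
  · have h1 : ∀ y ∈ Set.Ioo a b, P.derivative.eval y < 0 := by
      intro y hy
      have := sign_const hP hy hc
      rw [sign_neg h] at this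
      exact sign_eq_neg_one_iff.mp this
    have h2 : ∀ y ∈ Set.Ioo a b, Q.derivative.eval (θ y) < 0 := by
      intro y hy
      have := hPQ y hy
      rw [sign_neg (h1 y hy)] at this
      exact sign_eq_neg_one_iff.mp this.symm
    have := interval_pos (P := -P) (Q := -Q) θ hab (by simpa using h1) (by simpa using h2)
      (by simp [Left.sign_neg, ha]) (by simp [Left.sign_neg, hb])
    simpa [Left.sign_neg] using this
  · have h1 : ∀ y ∈ Set.Ioo a b, 0 < P.derivative.eval y := by
      intro y hy
      have := sign_const hP hy hc
      rw [sign_pos h] at this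
      exact sign_eq_one_iff.mp this
    have h2 : ∀ y ∈ Set.Ioo a b, 0 < Q.derivative.eval (θ y) := by
      intro y hy
      have := hPQ y hy
      rw [sign_pos (h1 y hy)] at this
      exact sign_eq_one_iff.mp this.symm
    exact interval_pos θ hab h1 h2 ha hb

lemma zeros_finite {ι : Type*} [Finite ι] (f : ι → ℝ[X]) :
    {x | ∃ i, f i ≠ 0 ∧ (f i).eval x = 0}.Finite := by
  have : {x | ∃ i, f i ≠ 0 ∧ (f i).eval x = 0} ⊆ ⋃ i, ((f i).roots.toFinset : Set ℝ) := by
    rintro x ⟨i, h1, h2⟩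
    simp only [Set.mem_iUnion, Finset.mem_coe, Multiset.mem_toFinset]
    exact ⟨i, by rw [mem_roots h1]; exact h2⟩
  exact (Set.finite_iUnion fun i => Finset.finite_toSet _).subset this

lemma step {ι : Type*} [Finite ι] (f g : ι → ℝ[X]) (P Q : ℝ[X])
    (hd : P.natDegree = Q.natDegree)
    (hl : SignType.sign P.leadingCoeff = SignType.sign Q.leadingCoeff)
    (i₀ : ι) (hf : f i₀ = P.derivative) (hg : g i₀ = Q.derivative) :
    ∀ (N : ℕ) (θ : ℝ ≃o ℝ),
      (∀ i x, SignType.sign ((f i).eval x) = SignType.sign ((g i).eval (θ x))) →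
      (∀ x, (∃ i, f i ≠ 0 ∧ (f i).eval x = 0) →
        SignType.sign (P.eval x) = SignType.sign (Q.eval (θ x))) →
      {x | P.eval x = 0 ∧ Q.eval (θ x) ≠ 0}.ncard ≤ N →
      ∃ θ' : ℝ ≃o ℝ, (∀ i x, SignType.sign ((f i).eval x) = SignType.sign ((g i).eval (θ' x))) ∧
        ∀ x, SignType.sign (P.eval x) = SignType.sign (Q.eval (θ' x)) := by
  by_cases hP0 : P.natDegree = 0
  · intro N θ h1 _ _
    refine ⟨θ, h1, fun x => ?_⟩
    have hQ0 : Q.natDegree = 0 := hd ▸ hP0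
    rw [eq_C_of_natDegree_eq_zero hP0, eq_C_of_natDegree_eq_zero hQ0]
    simpa [leadingCoeff, hP0, hQ0] using hl
  have hPne : P ≠ 0 := by rintro rfl; simp at hP0
  have hder : P.derivative ≠ 0 := by
    intro h
    exact hP0 (derivative_eq_zero.mp h)
  set Z := {x | ∃ i, f i ≠ 0 ∧ (f i).eval x = 0} with hZdef
  have hZ : Z.Finite := zeros_finite f
  have hfin : ∀ θ : ℝ ≃o ℝ, {x | P.eval x = 0 ∧ Q.eval (θ x) ≠ 0}.Finite := by
    intro θ
    refine (P.roots.toFinset.finite_toSet).subset ?_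
    rintro x ⟨h, _⟩
    simp only [Finset.mem_coe, Multiset.mem_toFinset]
    rw [mem_roots hPne]; exact h
  intro N
  induction N with
  | zero =>
    intro θ hM hPZ hN
    refine ⟨θ, hM, fun x => ?_⟩
    have hempty : {x | P.eval x = 0 ∧ Q.eval (θ x) ≠ 0} = ∅ := by
      rw [← Set.ncard_eq_zero (hfin θ)]; omega
    by_cases hx : x ∈ Z
    · exact hPZ x hx
    obtain ⟨a, b, hax, hxb, hno, ha, hb⟩ := gap hZ θ hd hl hPZ hx
    refine (interval_gen θ (hax.trans hxb) ?_ ?_ ha hb).2 ?_ x ⟨hax, hxb⟩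
    · intro y hy h0
      exact hno y hy ⟨i₀, by rwa [hf], by rwa [hf]⟩
    · intro y _
      rw [← hf, ← hg]; exact hM i₀ y
    · intro y _ h0
      by_contra h
      have : y ∈ {x | P.eval x = 0 ∧ Q.eval (θ x) ≠ 0} := ⟨h0, h⟩
      rw [hempty] at this
      exact this
  | succ N ih =>
    intro θ hM hPZ hN
    by_cases hne : {x | P.eval x = 0 ∧ Q.eval (θ x) ≠ 0}.Nonempty
    swap
    · apply ih θ hM hPZ
      rw [Set.not_nonempty_iff_eq_empty.mp hne]; simp
    obtain ⟨r, hr0, hr1⟩ := hne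
    have hrZ : r ∉ Z := by
      intro h
      have := hPZ r h
      rw [hr0, sign_zero] at this
      exact hr1 (sign_eq_zero_iff.mp this.symm)
    obtain ⟨a, b, hax, hxb, hno, ha, hb⟩ := gap hZ θ hd hl hPZ hrZ
    obtain ⟨huniq, r', hr', hr'0⟩ := (interval_gen θ (hax.trans hxb)
      (fun y hy h0 => hno y hy ⟨i₀, by rwa [hf], by rwa [hf]⟩)
      (fun y _ => by rw [← hf, ← hg]; exact hM i₀ y) ha hb).1 r ⟨hax, hxb⟩ hr0
    obtain ⟨μ, hμ1, hμ2⟩ := exists_move (θ.strictMono hax) (θ.strictMono hxb) hr'.1 hr'.2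
    have hin : ∀ y, θ y ∈ Set.Ioo (θ a) (θ b) ↔ y ∈ Set.Ioo a b := by
      intro y; simp [Set.mem_Ioo]
    have hout : ∀ y, y ∉ Set.Ioo a b → μ (θ y) = θ y := fun y hy =>
      hμ2 _ (fun h => hy ((hin y).mp h))
    have hμa : μ (θ a) = θ a := hout a (by simp)
    have hμb : μ (θ b) = θ b := hout b (by simp)
    have hM' : ∀ i x, SignType.sign ((f i).eval x) =
        SignType.sign ((g i).eval ((θ.trans μ) x)) := by
      intro i x
      rw [OrderIso.trans_apply]
      by_cases hx : x ∈ Set.Ioo a b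
      · rw [hM i x]
        by_cases hfi : f i = 0
        · have : ∀ y, (g i).eval y = 0 := by
            intro y
            have := hM i (θ.symm y)
            rw [hfi] at this
            simp only [eval_zero, sign_zero, OrderIso.apply_symm_apply] at this
            exact sign_eq_zero_iff.mp this.symm
          rw [this, this]
        · apply sign_const (a := θ a) (b := θ b) _ ((hin x).mpr hx)
          · constructor
            · rw [← hμa]; exact μ.strictMono ((hin x).mpr hx).1
            · rw [← hμb]; exact μ.strictMono ((hin x).mpr hx).2
          · intro y hy hy0
            have h1 := hM i (θ.symm y)
            rw [OrderIso.apply_symm_apply, hy0, sign_zero] at h1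
            refine hno (θ.symm y) ?_ ⟨i, hfi, sign_eq_zero_iff.mp h1⟩
            rw [← hin]; simpa using hy
      · rw [hout x hx]; exact hM i x
    have hPZ' : ∀ x, (∃ i, f i ≠ 0 ∧ (f i).eval x = 0) →
        SignType.sign (P.eval x) = SignType.sign (Q.eval ((θ.trans μ) x)) := by
      intro x hx
      rw [OrderIso.trans_apply, hout x (fun h => hno x h hx)]
      exact hPZ x hx
    apply ih (θ.trans μ) hM' hPZ'
    have hss : {x | P.eval x = 0 ∧ Q.eval ((θ.trans μ) x) ≠ 0} ⊂
        {x | P.eval x = 0 ∧ Q.eval (θ x) ≠ 0} := by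
      refine ⟨?_, fun h => ?_⟩
      · rintro x ⟨hx0, hx1⟩
        refine ⟨hx0, ?_⟩
        by_cases hx : x ∈ Set.Ioo a b
        · rw [huniq x hx hx0]; exact hr1
        · rw [OrderIso.trans_apply, hout x hx] at hx1; exact hx1
      · have := (h ⟨hr0, hr1⟩ : r ∈ {x | P.eval x = 0 ∧ Q.eval ((θ.trans μ) x) ≠ 0}).2
        rw [OrderIso.trans_apply, hμ1] at this
        exact this hr'0
    have := Set.ncard_lt_ncard hss (hfin θ)
    omega


lemma pseudo_div {A : Type*} [CommRing A] (g : A[X]) {j : ℕ} (hj : 1 ≤ j) (hg : g.natDegree ≤ j) :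
    ∀ (M : ℕ) (p : A[X]), p.natDegree ≤ M →
      ∃ (k : ℕ) (q r : A[X]), C (g.coeff j ^ k) * p = q * g + r ∧ r.natDegree < j := by
  intro M
  induction M with
  | zero =>
    intro p hp
    exact ⟨0, 0, p, by simp, by omega⟩
  | succ M ih =>
    intro p hp
    by_cases hlt : p.natDegree < j
    · exact ⟨0, 0, p, by simp, hlt⟩
    by_cases hp' : p.natDegree ≤ M
    · exact ih p hp'
    have hD : p.natDegree = M + 1 := by omega
    have hdeg : (C (g.coeff j) * p - C (p.coeff (M + 1)) * X ^ (M + 1 - j) * g).natDegree ≤ M := by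
      rw [natDegree_le_iff_coeff_eq_zero]
      intro N hN
      rw [coeff_sub, coeff_C_mul, mul_assoc, coeff_C_mul]
      have hN' : N = (N - (M + 1 - j)) + (M + 1 - j) := by omega
      have e : (X ^ (M + 1 - j) * g).coeff N = g.coeff (N - (M + 1 - j)) := by
        conv_lhs => rw [hN', X_pow_mul, coeff_mul_X_pow]
      rw [e]
      by_cases hNM : N = M + 1
      · subst hNM
        rw [show M + 1 - (M + 1 - j) = j by omega]; ring
      · rw [coeff_eq_zero_of_natDegree_lt (show p.natDegree < N by omega),
          coeff_eq_zero_of_natDegree_lt (show g.natDegree < N - (M + 1 - j) by omega)]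
        ring
    obtain ⟨k, q, r, h1, h2⟩ := ih _ hdeg
    refine ⟨k + 1, q + C (g.coeff j ^ k) * (C (p.coeff (M + 1)) * X ^ (M + 1 - j)), r, ?_, h2⟩
    have : C (g.coeff j ^ (k + 1)) * p = C (g.coeff j ^ k) * (C (g.coeff j) * p) := by
      rw [pow_succ, C_mul]; ring
    rw [this]
    linear_combination h1

/-- truncation of a polynomial at degree `j` -/
noncomputable def trunc {A : Type*} [CommRing A] (j : ℕ) (g : A[X]) : A[X] :=
  ∑ i ∈ Finset.range (j + 1), monomial i (g.coeff i)

lemma coeff_trunc {A : Type*} [CommRing A] (j : ℕ) (g : A[X]) (i : ℕ) :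
    (trunc j g).coeff i = if i ≤ j then g.coeff i else 0 := by
  simp [trunc, coeff_monomial]

lemma exists_rem {A : Type*} [CommRing A] (p g : A[X]) (j : ℕ) :
    ∃ r : A[X], 1 ≤ j → r.natDegree < j ∧
      ∃ (k : ℕ) (q : A[X]), C (g.coeff j ^ (k + k)) * p = q * trunc j g + r := by
  by_cases hj : 1 ≤ j
  · have hg : (trunc j g).natDegree ≤ j := by
      rw [natDegree_le_iff_coeff_eq_zero]
      intro N hN
      rw [coeff_trunc, if_neg (by omega)]
    obtain ⟨k, q, r, h1, h2⟩ := pseudo_div (trunc j g) hj hg _ p le_rfl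
    rw [coeff_trunc, if_pos le_rfl] at h1
    refine ⟨C (g.coeff j ^ k) * r, fun _ => ⟨lt_of_le_of_lt (natDegree_C_mul_le _ _) h2, k,
      C (g.coeff j ^ k) * q, ?_⟩⟩
    rw [pow_add, C_mul]
    linear_combination C (g.coeff j ^ k) * h1
  · exact ⟨0, fun h => absurd h hj⟩

/-- a chosen pseudo-remainder -/
noncomputable def prem {A : Type*} [CommRing A] (p g : A[X]) (j : ℕ) : A[X] :=
  Classical.choose (exists_rem p g j)

lemma prem_spec {A : Type*} [CommRing A] (p g : A[X]) {j : ℕ} (hj : 1 ≤ j) :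
    (prem p g j).natDegree < j ∧
      ∃ (k : ℕ) (q : A[X]), C (g.coeff j ^ (k + k)) * p = q * trunc j g + prem p g j :=
  Classical.choose_spec (exists_rem p g j) hj

lemma map_trunc {A : Type*} [CommRing A] (s : A →+* ℝ) (g : A[X]) (j : ℕ)
    (h : (g.map s).natDegree = j) : (trunc j g).map s = g.map s := by
  ext i
  rw [coeff_map, coeff_map, coeff_trunc]
  split_ifs with hi
  · rfl
  · rw [map_zero, ← coeff_map, coeff_eq_zero_of_natDegree_lt (by omega)]

lemma natDegree_map_eq {A : Type*} [CommRing A] (s t : A →+* ℝ) (g : A[X])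
    (h : ∀ i, SignType.sign (s (g.coeff i)) = SignType.sign (t (g.coeff i))) :
    (g.map s).natDegree = (g.map t).natDegree := by
  have h0 : ∀ i, s (g.coeff i) = 0 ↔ t (g.coeff i) = 0 := fun i => by
    rw [← sign_eq_zero_iff, h i, sign_eq_zero_iff]
  apply le_antisymm <;> rw [natDegree_le_iff_coeff_eq_zero] <;> intro N hN
  · rw [coeff_map, h0, ← coeff_map]; exact coeff_eq_zero_of_natDegree_lt hN
  · rw [coeff_map, ← h0, ← coeff_map]; exact coeff_eq_zero_of_natDegree_lt hN

lemma sign_prem {A : Type*} [CommRing A] (s : A →+* ℝ) (p g : A[X]) {j : ℕ} (hj : 1 ≤ j)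
    (h : (g.map s).natDegree = j) {x : ℝ} (hx : (g.map s).eval x = 0) :
    SignType.sign ((p.map s).eval x) = SignType.sign (((prem p g j).map s).eval x) := by
  obtain ⟨_, k, q, he⟩ := prem_spec p g hj
  have h1 := congrArg (fun u => (u.map s).eval x) he
  simp only [Polynomial.map_mul, Polynomial.map_add, map_trunc s g j h, eval_mul, eval_add, hx,
    mul_zero, zero_add, map_C, eval_C, map_pow, Polynomial.map_pow, eval_pow] at h1
  have hne : s (g.coeff j) ≠ 0 := by
    rw [← coeff_map, ← h]
    intro h0
    have : g.map s = 0 := leadingCoeff_eq_zero.mp h0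
    rw [this, natDegree_zero] at h
    omega
  have hpos : 0 < s (g.coeff j) ^ (k + k) := Even.pow_pos ⟨k, rfl⟩ hne
  rw [← h1, sign_mul, sign_pos hpos, one_mul]

open Classical in
theorem elim_one (A : Type*) [CommRing A] : ∀ (d k : ℕ) (G : Finset A[X]),
    (∀ p ∈ G, p.natDegree ≤ d) → (G.filter (fun p => p.natDegree = d)).card ≤ k →
    ∃ F : Finset A, ∀ s t : A →+* ℝ, (∀ a ∈ F, SignType.sign (s a) = SignType.sign (t a)) →
      ∃ θ : ℝ ≃o ℝ, ∀ p ∈ G, ∀ x,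
        SignType.sign ((p.map s).eval x) = SignType.sign ((p.map t).eval (θ x)) := by
  intro d
  induction d with
  | zero =>
    intro k G hG _
    refine ⟨G.image (fun p => p.coeff 0), fun s t h => ⟨OrderIso.refl ℝ, fun p hp x => ?_⟩⟩
    rw [eq_C_of_natDegree_eq_zero (Nat.le_zero.mp (hG p hp))]
    simpa using h _ (Finset.mem_image_of_mem _ hp)
  | succ d ihd =>
    intro k
    induction k with
    | zero =>
      intro G hG hk
      refine ihd _ G (fun p hp => ?_) le_rfl
      have h1 := hG p hp
      have h2 : p.natDegree ≠ d + 1 := by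
        have := Finset.card_eq_zero.mp (Nat.le_zero.mp hk)
        rw [Finset.filter_eq_empty_iff] at this
        exact this hp
      omega
    | succ k ihk =>
      intro G hG hk
      by_cases hne : (G.filter (fun p => p.natDegree = d + 1)).Nonempty
      swap
      · apply ihk G hG
        rw [Finset.not_nonempty_iff_eq_empty.mp hne]; simp
      obtain ⟨p, hp⟩ := hne
      have hpG : p ∈ G := (Finset.mem_filter.mp hp).1
      have hpd : p.natDegree = d + 1 := (Finset.mem_filter.mp hp).2
      have hp'd : p.derivative.natDegree ≤ d := by
        have := natDegree_derivative_le p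
        omega
      set G0 : Finset A[X] := insert p.derivative (G.erase p) with hG0
      set G1 : Finset A[X] := G0 ∪ (G0 ×ˢ Finset.Icc 1 (d + 1)).image
        (fun u => prem p u.1 u.2) with hG1
      have hremd : ∀ u ∈ G0 ×ˢ Finset.Icc 1 (d + 1), (prem p u.1 u.2).natDegree ≤ d := by
        intro u hu
        have hu2 := Finset.mem_Icc.mp (Finset.mem_product.mp hu).2
        have := (prem_spec p u.1 hu2.1).1
        omega
      have hG0d : ∀ q ∈ G0, q.natDegree ≤ d + 1 := by
        intro q hq
        rcases Finset.mem_insert.mp hq with rfl | hq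
        · omega
        · exact hG q (Finset.mem_of_mem_erase hq)
      have hG1d : ∀ q ∈ G1, q.natDegree ≤ d + 1 := by
        intro q hq
        rcases Finset.mem_union.mp hq with hq | hq
        · exact hG0d q hq
        · obtain ⟨u, hu, rfl⟩ := Finset.mem_image.mp hq
          have := hremd u hu
          omega
      have hcard : (G1.filter (fun p => p.natDegree = d + 1)).card ≤ k := by
        have hsub : G1.filter (fun p => p.natDegree = d + 1) ⊆
            (G.filter (fun p => p.natDegree = d + 1)).erase p := by
          intro q hq
          obtain ⟨hq1, hq2⟩ := Finset.mem_filter.mp hq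
          rcases Finset.mem_union.mp hq1 with hq | hq
          · rcases Finset.mem_insert.mp hq with rfl | hq
            · omega
            · exact Finset.mem_erase.mpr ⟨(Finset.mem_erase.mp hq).1,
                Finset.mem_filter.mpr ⟨(Finset.mem_erase.mp hq).2, hq2⟩⟩
          · obtain ⟨u, hu, rfl⟩ := Finset.mem_image.mp hq
            have := hremd u hu
            omega
        have := Finset.card_le_card hsub
        rw [Finset.card_erase_of_mem hp] at this
        omega
      obtain ⟨F', hF'⟩ := ihk G1 hG1d hcard
      refine ⟨F' ∪ (insert p G0).biUnion (fun g => (Finset.range (d + 2)).image g.coeff), ?_⟩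
      intro s t hst
      obtain ⟨θ, hθ⟩ := hF' s t (fun a ha => hst a (Finset.mem_union_left _ ha))
      have hcoef : ∀ g ∈ insert p G0, ∀ i,
          SignType.sign (s (g.coeff i)) = SignType.sign (t (g.coeff i)) := by
        intro g hg i
        by_cases hi : i < d + 2
        · apply hst
          apply Finset.mem_union_right
          exact Finset.mem_biUnion.mpr ⟨g, hg, Finset.mem_image_of_mem _ (Finset.mem_range.mpr hi)⟩
        · have : g.natDegree ≤ d + 1 := by
            rcases Finset.mem_insert.mp hg with rfl | hg
            · omega
            · exact hG0d g hg
          rw [coeff_eq_zero_of_natDegree_lt (by omega)]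
          simp
      have hd := natDegree_map_eq s t p (hcoef p (Finset.mem_insert_self _ _))
      have hl : SignType.sign (p.map s).leadingCoeff = SignType.sign (p.map t).leadingCoeff := by
        rw [leadingCoeff, leadingCoeff, ← hd, coeff_map, coeff_map]
        exact hcoef p (Finset.mem_insert_self _ _) _
      have hPZ : ∀ x, (∃ g : {g // g ∈ G0}, g.1.map s ≠ 0 ∧ (g.1.map s).eval x = 0) →
          SignType.sign ((p.map s).eval x) = SignType.sign ((p.map t).eval (θ x)) := by
        rintro x ⟨⟨g, hg⟩, hne, hx⟩
        simp only at hne hx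
        set j := (g.map s).natDegree with hj
        have hj1 : 1 ≤ j := by
          by_contra h
          have h0 : (g.map s).natDegree = 0 := by omega
          rw [eq_C_of_natDegree_eq_zero h0] at hx hne
          simp only [eval_C] at hx
          rw [hx] at hne
          simp at hne
        have hj2 : j ≤ d + 1 := natDegree_map_le.trans (hG0d g hg)
        have hjt : (g.map t).natDegree = j :=
          (natDegree_map_eq s t g (hcoef g (Finset.mem_insert_of_mem hg))).symm
        have hxt : (g.map t).eval (θ x) = 0 := by
          have := hθ g (Finset.mem_union_left _ hg) x
          rw [hx, sign_zero] at this
          exact sign_eq_zero_iff.mp this.symm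
        rw [sign_prem s p g hj1 hj.symm hx, sign_prem t p g hj1 hjt hxt]
        apply hθ
        apply Finset.mem_union_right
        exact Finset.mem_image.mpr ⟨(g, j), Finset.mem_product.mpr
          ⟨hg, Finset.mem_Icc.mpr ⟨hj1, hj2⟩⟩, rfl⟩
      obtain ⟨θ', h1, h2⟩ := step (ι := {g // g ∈ G0}) (fun g => g.1.map s) (fun g => g.1.map t)
        (p.map s) (p.map t) hd hl ⟨p.derivative, Finset.mem_insert_self _ _⟩
        (derivative_map p s).symm (derivative_map p t).symm _ θ
        (fun g x => hθ g.1 (Finset.mem_union_left _ g.2) x) hPZ le_rfl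
      refine ⟨θ', fun q hq x => ?_⟩
      by_cases hqp : q = p
      · rw [hqp]; exact h2 x
      · exact h1 ⟨q, Finset.mem_insert_of_mem (Finset.mem_erase.mpr ⟨hqp, hq⟩)⟩ x

theorem elim_one' {A : Type*} [CommRing A] (G : Finset A[X]) :
    ∃ F : Finset A, ∀ s t : A →+* ℝ, (∀ a ∈ F, SignType.sign (s a) = SignType.sign (t a)) →
      ∀ x, ∃ y, ∀ p ∈ G,
        SignType.sign (p.eval₂ s x) = SignType.sign (p.eval₂ t y) := by
  obtain ⟨F, hF⟩ := elim_one A (G.sup natDegree) _ G (fun p hp => Finset.le_sup hp) le_rfl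
  refine ⟨F, fun s t h x => ?_⟩
  obtain ⟨θ, hθ⟩ := hF s t h
  refine ⟨θ x, fun p hp => ?_⟩
  have := hθ p hp x
  rwa [eval_map, eval_map] at this

theorem elim_fin {A : Type*} [CommRing A] : ∀ (k : ℕ) (G : Finset (MvPolynomial (Fin k) A)),
    ∃ F : Finset A, ∀ s t : A →+* ℝ, (∀ a ∈ F, SignType.sign (s a) = SignType.sign (t a)) →
      ∀ x : Fin k → ℝ, ∃ y : Fin k → ℝ, ∀ p ∈ G,
        SignType.sign (p.eval₂ s x) = SignType.sign (p.eval₂ t y) := by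
  classical
  intro k
  induction k with
  | zero =>
    intro G
    refine ⟨G.image (MvPolynomial.coeff 0), fun s t h x => ⟨x, fun p hp => ?_⟩⟩
    have := h _ (Finset.mem_image_of_mem _ hp)
    obtain ⟨a, rfl⟩ := MvPolynomial.C_surjective (Fin 0) p
    simpa [MvPolynomial.coeff_C] using this
  | succ k ih =>
    intro G
    obtain ⟨F1, hF1⟩ := elim_one' (G.image (MvPolynomial.finSuccEquiv A k))
    obtain ⟨F, hF⟩ := ih F1
    have key : ∀ (s : A →+* ℝ) (x : Fin k → ℝ) (u : ℝ) (p : MvPolynomial (Fin (k + 1)) A),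
        (MvPolynomial.finSuccEquiv A k p).eval₂ (MvPolynomial.eval₂Hom s x) u =
          p.eval₂ s (Fin.cons u x : Fin (k + 1) → ℝ) := by
      intro s x u p
      induction p using MvPolynomial.induction_on with
      | C a => simp [MvPolynomial.finSuccEquiv_apply]
      | add p q hp hq => simp [hp, hq, eval₂_add]
      | mul_X p i hp =>
        rw [map_mul, eval₂_mul, hp, MvPolynomial.eval₂_mul, MvPolynomial.eval₂_X]
        congr 1
        refine Fin.cases ?_ (fun i => ?_) i
        · simp [MvPolynomial.finSuccEquiv_X_zero]
        · simp [MvPolynomial.finSuccEquiv_X_succ]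
    refine ⟨F, fun s t h x => ?_⟩
    obtain ⟨y, hy⟩ := hF s t h (Fin.tail x)
    obtain ⟨u, hu⟩ := hF1 (MvPolynomial.eval₂Hom s (Fin.tail x)) (MvPolynomial.eval₂Hom t y)
      (by simpa using hy) (x 0)
    refine ⟨Fin.cons u y, fun p hp => ?_⟩
    have := hu _ (Finset.mem_image_of_mem _ hp)
    rw [key, key, Fin.cons_self_tail] at this
    exact this

theorem elim_gen {A σ : Type*} [CommRing A] [Fintype σ] (G : Finset (MvPolynomial σ A)) :
    ∃ F : Finset A, ∀ s t : A →+* ℝ, (∀ a ∈ F, SignType.sign (s a) = SignType.sign (t a)) →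
      ∀ x : σ → ℝ, ∃ y : σ → ℝ, ∀ p ∈ G,
        SignType.sign (p.eval₂ s x) = SignType.sign (p.eval₂ t y) := by
  classical
  let e := Fintype.equivFin σ
  obtain ⟨F, hF⟩ := elim_fin (A := A) _ (G.image (MvPolynomial.rename e))
  refine ⟨F, fun s t h x => ?_⟩
  obtain ⟨y, hy⟩ := hF s t h (x ∘ e.symm)
  refine ⟨y ∘ e, fun p hp => ?_⟩
  have := hy _ (Finset.mem_image_of_mem _ hp)
  rw [MvPolynomial.eval₂_rename, MvPolynomial.eval₂_rename] at this
  simpa [Function.comp_assoc] using this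


/-- evaluation of a bivariate polynomial -/
noncomputable def ev2 (R ε : ℝ) : ℝ[X][X] →+* ℝ := eval₂RingHom (evalRingHom R) ε

lemma ev2_C (R ε : ℝ) (a : ℝ[X]) : ev2 R ε (C a) = a.eval R := by simp [ev2]

lemma ev2_X (R ε : ℝ) : ev2 R ε X = ε := by simp [ev2]

lemma bound_one (a : ℝ[X]) : ∃ (c : ℝ) (M : ℕ), ∀ R : ℝ, 1 ≤ R → |a.eval R| ≤ c * R ^ M := by
  have key : ∃ (c : ℝ) (M : ℕ), 0 ≤ c ∧ ∀ R : ℝ, 1 ≤ R → |a.eval R| ≤ c * R ^ M := by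
    induction a using Polynomial.induction_on' with
    | add p q hp hq =>
      obtain ⟨c1, M1, h1, hp⟩ := hp
      obtain ⟨c2, M2, h2, hq⟩ := hq
      refine ⟨c1 + c2, M1 + M2, by positivity, fun R hR => ?_⟩
      rw [eval_add]
      have e1 : R ^ M1 ≤ R ^ (M1 + M2) := pow_le_pow_right₀ hR (by omega)
      have e2 : R ^ M2 ≤ R ^ (M1 + M2) := pow_le_pow_right₀ hR (by omega)
      have := abs_add_le (p.eval R) (q.eval R)
      have := hp R hR
      have := hq R hR
      nlinarith
    | monomial n a =>
      refine ⟨|a|, n, abs_nonneg a, fun R hR => ?_⟩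
      rw [eval_monomial, abs_mul, abs_of_nonneg (a := R ^ n) (by positivity)]
  obtain ⟨c, M, _, h⟩ := key
  exact ⟨c, M, h⟩

lemma bound_two (f : ℝ[X][X]) : ∃ (c : ℝ) (M : ℕ), 0 ≤ c ∧ ∀ R ε : ℝ, 1 ≤ R → 0 < ε → ε ≤ 1 →
    |ev2 R ε f| ≤ c * R ^ M := by
  induction f using Polynomial.induction_on' with
  | add p q hp hq =>
    obtain ⟨c1, M1, h1, hp⟩ := hp
    obtain ⟨c2, M2, h2, hq⟩ := hq
    refine ⟨c1 + c2, M1 + M2, by positivity, fun R ε hR h0 h1' => ?_⟩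
    rw [map_add]
    have e1 : R ^ M1 ≤ R ^ (M1 + M2) := pow_le_pow_right₀ hR (by omega)
    have e2 : R ^ M2 ≤ R ^ (M1 + M2) := pow_le_pow_right₀ hR (by omega)
    have := abs_add_le (ev2 R ε p) (ev2 R ε q)
    have := hp R ε hR h0 h1'
    have := hq R ε hR h0 h1'
    nlinarith
  | monomial n a =>
    obtain ⟨c, M, h⟩ := bound_one a
    refine ⟨|c|, M, abs_nonneg _, fun R ε hR h0 h1 => ?_⟩
    have e : ev2 R ε (monomial n a) = a.eval R * ε ^ n := by simp [ev2]
    rw [e, abs_mul, abs_of_nonneg (a := ε ^ n) (by positivity)]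
    have h2 : ε ^ n ≤ 1 := pow_le_one₀ h0.le h1
    have h3 : |a.eval R| ≤ |c| * R ^ M := (h R hR).trans
      (mul_le_mul_of_nonneg_right (le_abs_self c) (by positivity))
    calc |a.eval R| * ε ^ n ≤ |a.eval R| * 1 := mul_le_mul_of_nonneg_left h2 (abs_nonneg _)
      _ ≤ _ := by rw [mul_one]; exact h3

lemma lower_one {a : ℝ[X]} (ha : a ≠ 0) : ∃ c > 0, ∀ᶠ R in atTop, c ≤ |a.eval R| := by
  by_cases h : 0 < a.degree
  · exact ⟨1, one_pos, (a.abs_tendsto_atTop h).eventually_ge_atTop 1⟩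
  · rw [eq_C_of_degree_le_zero (not_lt.mp h)] at ha ⊢
    refine ⟨|a.coeff 0|, abs_pos.mpr (by simpa using ha), ?_⟩
    simp

lemma sign_stable_one : ∀ (d : ℕ) (f : ℝ[X][X]), f.natDegree ≤ d →
    ∃ (N : ℕ) (R0 : ℝ), 1 ≤ R0 ∧ ∀ R ε ε' : ℝ, R0 ≤ R → 0 < ε → 0 < ε' → ε * R ^ N ≤ 1 →
      ε' * R ^ N ≤ 1 → SignType.sign (ev2 R ε f) = SignType.sign (ev2 R ε' f) := by
  intro d
  induction d with
  | zero =>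
    intro f hf
    refine ⟨0, 1, le_rfl, fun R ε ε' _ _ _ _ _ => ?_⟩
    rw [eq_C_of_natDegree_eq_zero (Nat.le_zero.mp hf), ev2_C, ev2_C]
  | succ d ih =>
    intro f hf
    have hdec : ∀ R ε, ev2 R ε f = ev2 R ε f.divX * ε + (f.coeff 0).eval R := by
      intro R ε
      conv_lhs => rw [← divX_mul_X_add f]
      rw [map_add, map_mul, ev2_C, ev2_X]
    by_cases h0 : f.coeff 0 = 0
    · obtain ⟨N, R0, h1, h2⟩ := ih f.divX (by rw [natDegree_divX_eq_natDegree_tsub_one]; omega)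
      refine ⟨N, R0, h1, fun R ε ε' hR a b c d => ?_⟩
      rw [hdec, hdec, h0]
      simp only [eval_zero, add_zero, sign_mul, sign_pos a, sign_pos b, mul_one]
      exact h2 R ε ε' hR a b c d
    · obtain ⟨c, hc, hev⟩ := lower_one h0
      obtain ⟨R1, hR1⟩ := eventually_atTop.mp hev
      obtain ⟨K, M, hK, hb⟩ := bound_two f.divX
      have key : ∀ R ε : ℝ, max (max 1 R1) (K / c + 1) ≤ R → 0 < ε → ε * R ^ (M + 1) ≤ 1 →
          SignType.sign (ev2 R ε f) = SignType.sign ((f.coeff 0).eval R) := by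
        intro R ε hR hε h
        have hR1' : 1 ≤ R := ((le_max_left _ _).trans (le_max_left _ _)).trans hR
        have hR2 : R1 ≤ R := ((le_max_right _ _).trans (le_max_left _ _)).trans hR
        have hR3 : K / c + 1 ≤ R := (le_max_right _ _).trans hR
        have hpow : 1 ≤ R ^ (M + 1) := one_le_pow₀ hR1'
        have hε1 : ε ≤ 1 := by nlinarith
        have h1 := hb R ε hR1' hε hε1
        have h2 := hR1 R hR2
        have h3 : |ev2 R ε f.divX * ε| < c := by
          rw [abs_mul, abs_of_pos hε]
          have h4 : K < c * R := by
            have : K / c < R := by linarith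
            rwa [div_lt_iff₀ hc, mul_comm] at this
          have h5 : ε * R ^ M * R ≤ 1 := by rw [mul_assoc, ← pow_succ]; exact h
          have h6 : 0 < ε * R ^ M := by positivity
          have h7 : |ev2 R ε f.divX| * ε ≤ K * (ε * R ^ M) := by nlinarith
          have h8 : K * (ε * R ^ M) < c * R * (ε * R ^ M) := mul_lt_mul_of_pos_right h4 h6
          nlinarith
        rw [hdec]
        have h9 := abs_lt.mp h3
        rcases lt_or_ge ((f.coeff 0).eval R) 0 with hneg | hpos
        · rw [abs_of_neg hneg] at h2
          rw [sign_neg hneg, sign_neg (by linarith [h9.2])]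
        · rw [abs_of_nonneg hpos] at h2
          rw [sign_pos (by linarith), sign_pos (by linarith [h9.1])]
      refine ⟨M + 1, max (max 1 R1) (K / c + 1), (le_max_left _ _).trans (le_max_left _ _), fun R ε ε' hR a b e d => ?_⟩
      rw [key R ε hR a e, key R ε' hR b d]

lemma sign_stable (F : Finset ℝ[X][X]) :
    ∃ (N : ℕ) (R0 : ℝ), 1 ≤ R0 ∧ ∀ R ε ε' : ℝ, R0 ≤ R → 0 < ε → 0 < ε' → ε * R ^ N ≤ 1 →
      ε' * R ^ N ≤ 1 → ∀ f ∈ F, SignType.sign (ev2 R ε f) = SignType.sign (ev2 R ε' f) := by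
  classical
  induction F using Finset.induction_on with
  | empty => exact ⟨0, 1, le_rfl, by simp⟩
  | insert f F _ ih =>
    obtain ⟨N1, R1, h1, hF⟩ := ih
    obtain ⟨N2, R2, h2, hf⟩ := sign_stable_one _ f le_rfl
    refine ⟨N1 + N2, max R1 R2, h1.trans (le_max_left _ _), ?_⟩
    intro R ε ε' hR hε hε' h h' g hg
    have hR1 : R1 ≤ R := (le_max_left _ _).trans hR
    have hR2 : R2 ≤ R := (le_max_right _ _).trans hR
    have hR0 : 1 ≤ R := h1.trans hR1
    have e1 : R ^ N1 ≤ R ^ (N1 + N2) := pow_le_pow_right₀ hR0 (by omega)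
    have e2 : R ^ N2 ≤ R ^ (N1 + N2) := pow_le_pow_right₀ hR0 (by omega)
    rcases Finset.mem_insert.mp hg with rfl | hg
    · exact hf R ε ε' hR2 hε hε' (by nlinarith) (by nlinarith)
    · exact hF R ε ε' hR1 hε hε' (by nlinarith) (by nlinarith) g hg

lemma semialg_sign {n : ℕ} {S : Set (Fin n → ℝ)} (hS : IsSemialgebraic S) :
    ∃ G : Finset (MvPolynomial (Fin n) ℝ), ∀ x y : Fin n → ℝ,
      (∀ g ∈ G, SignType.sign (MvPolynomial.eval x g) = SignType.sign (MvPolynomial.eval y g)) →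
      (x ∈ S ↔ y ∈ S) := by
  classical
  obtain ⟨m, p, Q, rfl⟩ := hS
  refine ⟨Finset.univ.biUnion (fun i => insert (p i) (Q i)), fun x y h => ?_⟩
  have h1 : ∀ i, SignType.sign (MvPolynomial.eval x (p i)) =
      SignType.sign (MvPolynomial.eval y (p i)) := fun i =>
    h _ (Finset.mem_biUnion.mpr ⟨i, Finset.mem_univ _, Finset.mem_insert_self _ _⟩)
  have h2 : ∀ i, ∀ q ∈ Q i, SignType.sign (MvPolynomial.eval x q) =
      SignType.sign (MvPolynomial.eval y q) := fun i q hq =>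
    h _ (Finset.mem_biUnion.mpr ⟨i, Finset.mem_univ _, Finset.mem_insert_of_mem hq⟩)
  simp only [Set.mem_iUnion, Set.mem_ofPred_eq]
  refine exists_congr fun i => and_congr ?_ (forall₂_congr fun q hq => ?_)
  · rw [← sign_eq_zero_iff, h1 i, sign_eq_zero_iff]
  · rw [← sign_eq_one_iff, h2 i q hq, sign_eq_one_iff]

lemma ev2_embed {n : ℕ} {σ : Type*} (R ε : ℝ) (z : σ → ℝ) (e : Fin n → σ)
    (p : MvPolynomial (Fin n) ℝ) :
    MvPolynomial.eval₂ (ev2 R ε) z (MvPolynomial.map ((C : ℝ[X] →+* ℝ[X][X]).comp C)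
      (MvPolynomial.rename e p)) = MvPolynomial.eval (z ∘ e) p := by
  rw [MvPolynomial.eval₂_map, MvPolynomial.eval₂_rename]
  have : (ev2 R ε).comp ((C : ℝ[X] →+* ℝ[X][X]).comp C) = RingHom.id ℝ := by
    ext x
    simp
  rw [this]
  rfl

theorem loj {n m : ℕ} (X : Set (Fin n → ℝ))
    (hXcl : IsClosed X) (hXsa : IsSemialgebraic X)
    (W : Fin m → Set (Fin n → ℝ))
    (hWo : ∀ i, IsOpen (W i)) (hWsa : ∀ i, IsSemialgebraic (W i))
    (hcov : X ⊆ ⋃ i, W i) :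
    ∃ (N : ℕ) (R0 : ℝ), 1 ≤ R0 ∧ ∀ x ∈ X, ∃ i, ∀ y ∉ W i,
      1 < (R0 + ∑ k, x k ^ 2) ^ N * ∑ k, (x k - y k) ^ 2 := by
  classical
  obtain ⟨GX, hGX⟩ := semialg_sign hXsa
  choose GW hGW using fun i => semialg_sign (hWsa i)
  let σ := Fin n ⊕ (Fin m × Fin n)
  let em (e : Fin n → σ) (p : MvPolynomial (Fin n) ℝ) : MvPolynomial σ ℝ[X][X] :=
    MvPolynomial.map ((C : ℝ[X] →+* ℝ[X][X]).comp C) (MvPolynomial.rename e p)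
  let u : MvPolynomial σ ℝ[X][X] :=
    MvPolynomial.C (C (Polynomial.X : ℝ[X]) : ℝ[X][X]) - ∑ k, MvPolynomial.X (Sum.inl k) ^ 2
  let v (i : Fin m) : MvPolynomial σ ℝ[X][X] :=
    MvPolynomial.C Polynomial.X -
      ∑ k, (MvPolynomial.X (Sum.inl k) - MvPolynomial.X (Sum.inr (i, k))) ^ 2
  let eW (i : Fin m) : Fin n → σ := fun k => Sum.inr (i, k)
  let G : Finset (MvPolynomial σ ℝ[X][X]) := GX.image (em Sum.inl) ∪
    Finset.univ.biUnion (fun i => (GW i).image (em (eW i))) ∪ insert u (Finset.univ.image v)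
  have hu : ∀ R ε z, MvPolynomial.eval₂ (ev2 R ε) z u = R - ∑ k, z (Sum.inl k) ^ 2 := by
    intro R ε z
    rw [← MvPolynomial.coe_eval₂Hom]
    simp [u, ev2_C]
  have hv : ∀ i R ε z, MvPolynomial.eval₂ (ev2 R ε) z (v i) =
      ε - ∑ k, (z (Sum.inl k) - z (Sum.inr (i, k))) ^ 2 := by
    intro i R ε z
    rw [← MvPolynomial.coe_eval₂Hom]
    simp [v, ev2_X]
  obtain ⟨F, hF⟩ := elim_gen G
  obtain ⟨N, R0, hR0, hst⟩ := sign_stable F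
  refine ⟨N, R0, hR0, fun x hx => ?_⟩
  by_contra hcon
  push Not at hcon
  choose y hyW hy using hcon
  set R := R0 + ∑ k, x k ^ 2 with hR
  have hsq : 0 ≤ ∑ k, x k ^ 2 := Finset.sum_nonneg fun k _ => sq_nonneg _
  have hR0R : R0 ≤ R := by linarith
  have hRpos : 0 < R := by linarith
  have hRN : 0 < R ^ N := by positivity
  let K : Set (Fin n → ℝ) := X ∩ {x | ∑ k, x k ^ 2 ≤ R}
  have hKcomp : IsCompact K := by
    apply Metric.isCompact_of_isClosed_isBounded
    · exact hXcl.inter (isClosed_le (by fun_prop) continuous_const)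
    · refine (Metric.isBounded_closedBall (x := (0 : Fin n → ℝ)) (r := R + 1)).subset ?_
      rintro w ⟨_, hw⟩
      rw [mem_closedBall_zero_iff, pi_norm_le_iff_of_nonneg (by linarith)]
      intro k
      have h1 : w k ^ 2 ≤ ∑ k, w k ^ 2 :=
        Finset.single_le_sum (f := fun k => w k ^ 2) (fun k _ => sq_nonneg _) (Finset.mem_univ k)
      have h2 : w k ^ 2 ≤ R := h1.trans hw
      rw [Real.norm_eq_abs]
      apply abs_le_of_sq_le_sq _ (by linarith)
      nlinarith
  obtain ⟨δ, hδ, hleb⟩ := lebesgue_number_lemma_of_metric hKcomp hWo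
    (Set.inter_subset_left.trans hcov)
  set ε := (R ^ N)⁻¹ with hε
  have hεpos : 0 < ε := by positivity
  have hεR : ε * R ^ N = 1 := inv_mul_cancel₀ hRN.ne'
  set ε' := min ε (δ ^ 2 / 2) with hε'
  have hε'pos : 0 < ε' := lt_min hεpos (by positivity)
  have hε'R : ε' * R ^ N ≤ 1 := by
    rw [← hεR]; exact mul_le_mul_of_nonneg_right (min_le_left _ _) hRN.le
  obtain ⟨z, hz⟩ := hF (ev2 R ε) (ev2 R ε') (hst R ε ε' hR0R hεpos hε'pos hεR.le hε'R)
    (Sum.elim x (fun q => y q.1 q.2))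
  have hxz : z ∘ Sum.inl ∈ X := by
    refine (hGX x _ fun g hg => ?_).mp hx
    have := hz (em Sum.inl g) (Finset.mem_union_left _ (Finset.mem_union_left _
      (Finset.mem_image_of_mem _ hg)))
    rw [ev2_embed, ev2_embed] at this
    exact this
  have hyz : ∀ i, z ∘ eW i ∉ W i := by
    intro i h
    refine hyW i ((hGW i (y i) _ fun g hg => ?_).mpr h)
    have := hz (em (eW i) g) (Finset.mem_union_left _ (Finset.mem_union_right _
      (Finset.mem_biUnion.mpr ⟨i, Finset.mem_univ _, Finset.mem_image_of_mem _ hg⟩)))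
    rw [ev2_embed, ev2_embed] at this
    exact this
  have huz : ∑ k, z (Sum.inl k) ^ 2 ≤ R := by
    have := hz u (Finset.mem_union_right _ (Finset.mem_insert_self _ _))
    rw [hu, hu] at this
    have h1 : 0 ≤ R - ∑ k, z (Sum.inl k) ^ 2 := by
      rw [← sign_nonneg_iff, ← this, sign_nonneg_iff]
      simp only [Sum.elim_inl]
      linarith
    linarith
  have hvz : ∀ i, ∑ k, (z (Sum.inl k) - z (Sum.inr (i, k))) ^ 2 ≤ ε' := by
    intro i
    have := hz (v i) (Finset.mem_union_right _ (Finset.mem_insert_of_mem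
      (Finset.mem_image_of_mem _ (Finset.mem_univ i))))
    rw [hv, hv] at this
    have h1 : 0 ≤ ε' - ∑ k, (z (Sum.inl k) - z (Sum.inr (i, k))) ^ 2 := by
      rw [← sign_nonneg_iff, ← this, sign_nonneg_iff]
      simp only [Sum.elim_inl, Sum.elim_inr]
      have h2 := hy i
      have h3 : R ^ N * (ε - ∑ k, (x k - y i k) ^ 2) ≥ 0 := by
        rw [mul_sub, mul_comm (R ^ N) ε, hεR]; linarith
      exact nonneg_of_mul_nonneg_right h3 hRN
    linarith
  obtain ⟨i, hi⟩ := hleb (z ∘ Sum.inl) ⟨hxz, huz⟩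
  apply hyz i
  apply hi
  rw [Metric.mem_ball, dist_pi_lt_iff hδ]
  intro k
  have h1 : (z (Sum.inl k) - z (Sum.inr (i, k))) ^ 2 ≤
      ∑ k, (z (Sum.inl k) - z (Sum.inr (i, k))) ^ 2 :=
    Finset.single_le_sum (f := fun k => (z (Sum.inl k) - z (Sum.inr (i, k))) ^ 2)
      (fun k _ => sq_nonneg _) (Finset.mem_univ k)
  have h2 : ε' ≤ δ ^ 2 / 2 := min_le_right _ _
  have h3 := hvz i
  have h4 : (z (Sum.inl k) - z (Sum.inr (i, k))) ^ 2 < δ ^ 2 := by nlinarith [sq_pos_of_pos hδ]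
  rw [dist_comm, Real.dist_eq]
  exact abs_lt_of_sq_lt_sq h4 hδ.le


open scoped ContDiff

lemma conv_bdd {n : ℕ} (f : (Fin n → ℝ) → ℝ) (hfb : ∀ t, ‖f t‖ ≤ 1)
    (hfi : MeasureTheory.LocallyIntegrable f) (j : ℕ) :
    ∀ (E' F' : Type) [NormedAddCommGroup E'] [NormedSpace ℝ E'] [NormedAddCommGroup F']
      [NormedSpace ℝ F'] (L : ℝ →L[ℝ] E' →L[ℝ] F') (g : (Fin n → ℝ) → E'),
      HasCompactSupport g → ContDiff ℝ ∞ g →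
      ∃ C : ℝ, ∀ x, ‖iteratedFDeriv ℝ j (MeasureTheory.convolution f g L
        MeasureTheory.volume) x‖ ≤ C := by
  induction j with
  | zero =>
    intro E' F' _ _ _ _ L g hgc hg
    have hgi : MeasureTheory.Integrable g := hg.continuous.integrable_of_hasCompactSupport hgc
    refine ⟨‖L‖ * ∫ t, ‖g t‖, fun x => ?_⟩
    rw [norm_iteratedFDeriv_zero, MeasureTheory.convolution_def]
    calc ‖∫ t, L (f t) (g (x - t))‖ ≤ ∫ t, ‖L‖ * ‖g (x - t)‖ := by
          apply MeasureTheory.norm_integral_le_of_norm_le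
          · exact ((hgi.comp_sub_left x).norm).const_mul _
          · refine Filter.Eventually.of_forall fun t => ?_
            refine (L.le_opNorm₂ _ _).trans ?_
            have h1 := hfb t
            have h2 : ‖L‖ * ‖f t‖ ≤ ‖L‖ * 1 := mul_le_mul_of_nonneg_left h1 L.opNorm_nonneg
            rw [mul_one] at h2
            exact mul_le_mul_of_nonneg_right h2 (norm_nonneg _)
      _ = ‖L‖ * ∫ t, ‖g t‖ := by
          rw [MeasureTheory.integral_const_mul]
          congr 1
          exact MeasureTheory.integral_sub_left_eq_self (fun t => ‖g t‖) MeasureTheory.volume x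
  | succ j ih =>
    intro E' F' _ _ _ _ L g hgc hg
    obtain ⟨C, hC⟩ := ih _ _ (L.precompR (Fin n → ℝ)) (fderiv ℝ g) (hgc.fderiv ℝ)
      (hg.fderiv_right (by simp))
    refine ⟨C, fun x => ?_⟩
    rw [← norm_iteratedFDeriv_fderiv]
    have : fderiv ℝ (MeasureTheory.convolution f g L MeasureTheory.volume) =
        MeasureTheory.convolution f (fderiv ℝ g) (L.precompR (Fin n → ℝ))
          MeasureTheory.volume := by
      ext1 x
      exact (hgc.hasFDerivAt_convolution_right L hfi (hg.of_le (by simp)) x).fderiv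
    rw [this]
    exact hC x

lemma exists_cutoff {n : ℕ} (Y : Set (Fin n → ℝ)) :
    ∃ B : (Fin n → ℝ) → ℝ, B.HasTemperateGrowth ∧
      (∀ y ∈ Y, ∀ w, dist w y < 1 / 6 → B w = 0) ∧
      (∀ w, (∀ y ∈ Y, 1 ≤ dist w y) → B w = 1) := by
  let b : ContDiffBump (0 : Fin n → ℝ) := ⟨1 / 6, 1 / 3, by norm_num, by norm_num⟩
  let g : (Fin n → ℝ) → ℝ := b.normed MeasureTheory.volume
  let S : Set (Fin n → ℝ) := {z | ∀ y ∈ Y, 1 / 2 ≤ dist z y}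
  have hS : IsClosed S := by
    have : S = ⋂ y ∈ Y, {z | 1 / 2 ≤ dist z y} := by ext; simp [S]
    rw [this]
    exact isClosed_biInter fun y _ => isClosed_le continuous_const (by fun_prop)
  let f : (Fin n → ℝ) → ℝ := S.indicator 1
  have hf1 : ∀ t ∈ S, f t = 1 := fun t ht => by simp [f, ht]
  have hf0 : ∀ t ∉ S, f t = 0 := fun t ht => by simp [f, ht]
  have hfb : ∀ t, ‖f t‖ ≤ 1 := by
    intro t
    by_cases h : t ∈ S
    · simp [hf1 t h]
    · simp [hf0 t h]
  have hfi : MeasureTheory.LocallyIntegrable f :=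
    (MeasureTheory.locallyIntegrable_const (1 : ℝ)).indicator hS.measurableSet
  have hgc : HasCompactSupport g := b.hasCompactSupport_normed
  have hg : ContDiff ℝ ∞ g := b.contDiff_normed
  have hgs : ∀ t, g t ≠ 0 → ‖t‖ < 1 / 3 := by
    intro t ht
    have : t ∈ Function.support g := ht
    rw [show Function.support g = _ from b.support_normed_eq] at this
    exact mem_ball_zero_iff.mp this
  have hgint : ∫ t, g t = 1 := b.integral_normed
  refine ⟨MeasureTheory.convolution f g (ContinuousLinearMap.mul ℝ ℝ) MeasureTheory.volume,
    ⟨hgc.contDiff_convolution_right _ hfi hg, fun j => ?_⟩, ?_, ?_⟩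
  · obtain ⟨C, hC⟩ := conv_bdd f hfb hfi j _ _ (ContinuousLinearMap.mul ℝ ℝ) g hgc hg
    exact ⟨0, C, fun x => by simpa using hC x⟩
  · intro y hy w hw
    rw [MeasureTheory.convolution_def]
    have : ∀ t, (ContinuousLinearMap.mul ℝ ℝ) (f t) (g (w - t)) = 0 := by
      intro t
      by_cases h : g (w - t) = 0
      · simp [h]
      · have h1 := hgs _ h
        have h2 : t ∉ S := by
          intro ht
          have h3 := ht y hy
          have h4 := dist_triangle t w y
          rw [← dist_eq_norm, dist_comm] at h1
          linarith
        simp [hf0 t h2]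
    simp [this]
  · intro w hw
    rw [MeasureTheory.convolution_def]
    have : ∀ t, (ContinuousLinearMap.mul ℝ ℝ) (f t) (g (w - t)) = g (w - t) := by
      intro t
      by_cases h : g (w - t) = 0
      · simp [h]
      · have h1 := hgs _ h
        have h2 : t ∈ S := by
          intro y hy
          have h3 := hw y hy
          have h4 := dist_triangle w t y
          rw [← dist_eq_norm] at h1
          linarith
        simp [hf1 t h2]
    simp only [this]
    rw [← hgint]
    exact MeasureTheory.integral_sub_left_eq_self g MeasureTheory.volume w

/-- The stretching map. -/
noncomputable def stretch {n : ℕ} (c R0 : ℝ) (N : ℕ) (x : Fin n → ℝ) : Fin n → ℝ :=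
  (c * (R0 + ∑ k, x k ^ 2) ^ N) • x

lemma stretch_tg {n : ℕ} (c R0 : ℝ) (N : ℕ) :
    (stretch c R0 N : (Fin n → ℝ) → (Fin n → ℝ)).HasTemperateGrowth := by
  have hk : ∀ k : Fin n, (fun x : Fin n → ℝ => x k).HasTemperateGrowth := fun k =>
    (ContinuousLinearMap.proj (R := ℝ) (φ := fun _ : Fin n => ℝ) k).hasTemperateGrowth
  have h1 : (fun x : Fin n → ℝ => ∑ k, x k ^ 2).HasTemperateGrowth :=
    Function.HasTemperateGrowth.sum fun k _ => (hk k).pow 2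
  have h2 : (fun x : Fin n → ℝ => c * (R0 + ∑ k, x k ^ 2) ^ N).HasTemperateGrowth :=
    (Function.HasTemperateGrowth.const c).mul
      (((Function.HasTemperateGrowth.const R0).add h1).pow N)
  exact h2.smul Function.HasTemperateGrowth.id'

lemma stretch_dist {n : ℕ} (R0 : ℝ) (N : ℕ) (hR0 : 1 ≤ R0) (x y : Fin n → ℝ)
    (h : 1 < (R0 + ∑ k, x k ^ 2) ^ N * ∑ k, (x k - y k) ^ 2) :
    1 ≤ dist (stretch (2 * (n + 1)) R0 N x) (stretch (2 * (n + 1)) R0 N y) := by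
  set a := R0 + ∑ k, x k ^ 2 with ha
  set b := R0 + ∑ k, y k ^ 2 with hb
  have hx0 : 0 ≤ ∑ k, x k ^ 2 := Finset.sum_nonneg fun k _ => sq_nonneg _
  have hy0 : 0 ≤ ∑ k, y k ^ 2 := Finset.sum_nonneg fun k _ => sq_nonneg _
  have ha1 : 1 ≤ a := by linarith
  have hb1 : 1 ≤ b := by linarith
  have haN : 1 ≤ a ^ N := one_le_pow₀ ha1
  have hbN : 1 ≤ b ^ N := one_le_pow₀ hb1
  set D := ∑ k, (x k - y k) ^ 2 with hD
  have hD0 : 0 ≤ D := Finset.sum_nonneg fun k _ => sq_nonneg _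
  set u := stretch (2 * ((n : ℝ) + 1)) R0 N x with hu
  set v := stretch (2 * ((n : ℝ) + 1)) R0 N y with hv
  have huk : ∀ k, u k = 2 * ((n : ℝ) + 1) * a ^ N * x k := fun k => by simp [hu, stretch, ha]
  have hvk : ∀ k, v k = 2 * ((n : ℝ) + 1) * b ^ N * y k := fun k => by simp [hv, stretch, hb]
  set P := ∑ k, (u k - v k) * (x k - y k) with hP
  have hmono : 0 ≤ (a ^ N - b ^ N) * (a - b) := by
    rcases le_total a b with hab | hab
    · have := pow_le_pow_left₀ (by linarith) hab N
      nlinarith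
    · have := pow_le_pow_left₀ (by linarith) hab N
      nlinarith
  have hPe : P = ((n : ℝ) + 1) * ((a ^ N + b ^ N) * D + (a ^ N - b ^ N) * (a - b)) := by
    have : a - b = ∑ k, (x k ^ 2 - y k ^ 2) := by
      rw [Finset.sum_sub_distrib, ha, hb]; ring
    rw [this, hP, hD, Finset.mul_sum, Finset.mul_sum, ← Finset.sum_add_distrib, Finset.mul_sum]
    refine Finset.sum_congr rfl fun k _ => ?_
    rw [huk, hvk]; ring
  have hn1 : (1 : ℝ) ≤ (n : ℝ) + 1 := by simp
  have hPl : ((n : ℝ) + 1) * (a ^ N * D) ≤ P := by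
    rw [hPe]
    apply mul_le_mul_of_nonneg_left _ (by linarith)
    nlinarith [mul_nonneg (by linarith : 0 ≤ b ^ N) hD0]
  set Q := ∑ k, (u k - v k) ^ 2 with hQ
  have hCS : P ^ 2 ≤ Q * D := Finset.sum_mul_sq_le_sq_mul_sq _ _ _
  have hQb : Q ≤ (n : ℝ) * dist u v ^ 2 := by
    have : Q ≤ ∑ _k : Fin n, dist u v ^ 2 := by
      refine Finset.sum_le_sum fun k _ => ?_
      have := dist_le_pi_dist u v k
      rw [← sq_abs, ← Real.dist_eq]
      exact pow_le_pow_left₀ dist_nonneg this 2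
    simpa using this
  by_contra hlt
  push Not at hlt
  have hd2 : dist u v ^ 2 ≤ 1 := pow_le_one₀ dist_nonneg hlt.le
  have hn0 : (0 : ℝ) ≤ n := Nat.cast_nonneg n
  have hQn : Q ≤ n := by nlinarith
  have hDpos : 0 < D := by
    rcases hD0.lt_or_eq with h' | h'
    · exact h'
    · rw [← h'] at h; linarith
  have h1 : ((n : ℝ) + 1) * (a ^ N * D) * (((n : ℝ) + 1) * (a ^ N * D)) ≤ Q * D := by
    have h0 : 0 ≤ ((n : ℝ) + 1) * (a ^ N * D) := by positivity
    nlinarith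
  have h2 : (((n : ℝ) + 1) * ((n : ℝ) + 1) * (a ^ N * (a ^ N * D))) * D ≤ n * D := by
    nlinarith
  have h3 := le_of_mul_le_mul_right h2 hDpos
  have h4 : 1 < a ^ N * (a ^ N * D) := by nlinarith
  nlinarith

theorem main {n m : ℕ} (X : Set (Fin n → ℝ)) (W : Fin m → Set (Fin n → ℝ))
    (N : ℕ) (R0 : ℝ) (hR0 : 1 ≤ R0) (hl : ∀ x ∈ X, ∃ i, ∀ y ∉ W i,
      1 < (R0 + ∑ k, x k ^ 2) ^ N * ∑ k, (x k - y k) ^ 2)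
    (φ : SchwartzMap ((Fin n) → ℝ) ℝ) :
    ∃ ψ : Fin m → SchwartzMap ((Fin n) → ℝ) ℝ,
      (∀ i, ∀ z ∈ (W i)ᶜ, ∀ k : ℕ, iteratedFDeriv ℝ k (⇑(ψ i)) z = 0) ∧
      ∀ x ∈ X, ∑ i, ψ i x = φ x := by
  let Φ : (Fin n → ℝ) → (Fin n → ℝ) := stretch (2 * (n + 1)) R0 N
  have hΦ : Φ.HasTemperateGrowth := stretch_tg _ _ _
  choose B hBt hB0 hB1 using fun i => exists_cutoff (Φ '' (W i)ᶜ)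
  let β : Fin m → (Fin n → ℝ) → ℝ := fun i x => B i (Φ x)
  have hβ : ∀ i, (β i).HasTemperateGrowth := fun i => (hBt i).comp hΦ
  have hprod : ∀ s : Finset (Fin m),
      (fun x => ∏ j ∈ s, (1 - β j x)).HasTemperateGrowth := by
    intro s
    induction s using Finset.induction_on with
    | empty => simp
    | insert j s hj ih =>
      simp only [Finset.prod_insert hj]
      exact ((Function.HasTemperateGrowth.const (1 : ℝ)).sub (hβ j)).mul ih
  let α : Fin m → (Fin n → ℝ) → ℝ := fun i x =>
    β i x * ∏ j ∈ Finset.univ.filter (fun j => j < i), (1 - β j x)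
  have hα : ∀ i, (α i).HasTemperateGrowth := fun i => (hβ i).mul (hprod _)
  refine ⟨fun i => SchwartzMap.smulLeftCLM ℝ (α i) φ, ?_, ?_⟩
  · intro i z hz k
    have hev : (⇑(SchwartzMap.smulLeftCLM ℝ (α i) φ)) =ᶠ[𝓝 z] fun _ => 0 := by
      have hc : ContinuousAt Φ z := hΦ.1.continuous.continuousAt
      have := hc.eventually (Metric.ball_mem_nhds (Φ z) (show (0 : ℝ) < 1 / 6 by norm_num))
      filter_upwards [this] with w hw
      rw [SchwartzMap.smulLeftCLM_apply_apply (hα i)]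
      have : β i w = 0 := hB0 i (Φ z) ⟨z, hz, rfl⟩ (Φ w) hw
      simp [α, this]
    have := (hev.iteratedFDeriv ℝ k).eq_of_nhds
    rw [this]
    simp
  · intro x hx
    simp only [SchwartzMap.smulLeftCLM_apply_apply (hα _), smul_eq_mul]
    rw [← Finset.sum_mul]
    obtain ⟨i, hi⟩ := hl x hx
    have hbi : β i x = 1 := by
      apply hB1
      rintro _ ⟨y, hy, rfl⟩
      exact stretch_dist R0 N hR0 x y (hi y hy)
    have h1 := Finset.prod_one_sub_ordered Finset.univ (fun i => β i x)
    rw [Finset.prod_eq_zero (Finset.mem_univ i) (by simp [hbi])] at h1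
    have h2 : ∑ i, α i x = 1 := by linarith
    rw [h2, one_mul]

end CosheafAux

/-- Cosheaf surjectivity for Schwartz functions, affine case: for any Schwartz `φ`
there are Schwartz functions `ψ₁, …, ψ_m`, with `ψᵢ` flat on `ℝⁿ \ Wᵢ`, such that
`ψ₁ + … + ψ_m = φ` on `X`. -/
theorem stmt_5 {n m : ℕ} (X : Set (Fin n → ℝ))
    (hXcl : IsClosed X) (hXsa : IsSemialgebraic X)
    (W : Fin m → Set (Fin n → ℝ))
    (hWo : ∀ i, IsOpen (W i)) (hWsa : ∀ i, IsSemialgebraic (W i))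
    (hcov : X ⊆ ⋃ i, W i)
    (φ : SchwartzMap ((Fin n) → ℝ) ℝ) :
    ∃ ψ : Fin m → SchwartzMap ((Fin n) → ℝ) ℝ,
      (∀ i, ∀ z ∈ (W i)ᶜ, SmoothFlatAt (⇑(ψ i)) z) ∧
      ∀ x ∈ X, ∑ i, ψ i x = φ x := by
  obtain ⟨N, R0, hR0, hl⟩ := CosheafAux.loj X hXcl hXsa W hWo hWsa hcov
  exact CosheafAux.main X W N R0 hR0 hl φ
end
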